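/- arXiv:2601.21620 — 2 statements merged into one kernel-verified Lean document; each statement's English description precedes it below -/
import Mathlib

section
/- Let d ≥ 1, 1 ≤ q < p ≤ ∞ with max(q,p′) ≥ 2, and let A = (A₁,A₂), B = (B₁,B₂) be pairs with all entries positive such that B₂ > d(1 − 1/p − 1/q). Define H(x) = sup { ‖f‖_q : f nonzero Schwartz on ℝ^d, ‖ x^A f ‖_q ≤ x, ‖ ξ^B f̂ ‖_p ≤ 1 } for x > 0, set m₁ = max(B₁ + d(1/p + 1/q − 1), 0), m₂ = B₂ + d(1/p + 1/q − 1), and 1/r = 1/q − 1/p. Then, with two-sided constants independent of x: (a) if B₁ + d(1/p + 1/q − 1) ≠ 0, then H(x) ≈ x^{m₂/(A₁+m₂)} for x < 1 and H(x) ≈ x^{m₁/(A₂+m₁)} for x ≥ 1; (b) if B₁ + d(1/p + 1/q − 1) = 0, then H(x) ≈ x^{m₂/(A₁+m₂)} for x < 1 and H(x) ≈ (log(x+1))^{1/r} for x ≥ 1. -/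
open MeasureTheory
open scoped ENNReal FourierTransform

/-- The broken power weight `x^A`: `|x|^{A₁}` for `|x| < 1`, `|x|^{A₂}` for `|x| ≥ 1`. -/
noncomputable def brokenWeight {d : ℕ} (A : ℝ × ℝ) (x : EuclideanSpace ℝ (Fin d)) : ℝ :=
  if ‖x‖ < 1 then ‖x‖ ^ A.1 else ‖x‖ ^ A.2

/-- `H(x) = sup { ‖f‖_q : f ≠ 0 Schwartz, ‖x^A f‖_q ≤ x, ‖ξ^B f̂‖_p ≤ 1 }`. -/
noncomputable def Hsup (d : ℕ) (A B : ℝ × ℝ) (q p : ℝ≥0∞) (x : ℝ) : ℝ≥0∞ :=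
  ⨆ f : {f : SchwartzMap (EuclideanSpace ℝ (Fin d)) ℂ // f ≠ 0 ∧
      eLpNorm (fun y => brokenWeight A y * ‖f y‖) q volume ≤ ENNReal.ofReal x ∧
      eLpNorm (fun ξ => brokenWeight B ξ * ‖𝓕 (⇑f) ξ‖) p volume ≤ 1},
    eLpNorm (⇑f.1) q volume

/-- Two-sided comparison `c·g ≤ X ≤ C·g`. -/
def Approx (X : ℝ≥0∞) (c C g : ℝ) : Prop :=
  ENNReal.ofReal (c * g) ≤ X ∧ X ≤ ENNReal.ofReal (C * g)

open scoped SchwartzMap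

/-- Plancherel's theorem for integrable, square integrable functions. -/
lemma eLpNorm_fourierInv_two {V : Type*} [NormedAddCommGroup V] [InnerProductSpace ℝ V]
    [FiniteDimensional ℝ V] [MeasurableSpace V] [BorelSpace V] {h : V → ℂ}
    (h1 : Integrable h volume) (h2 : MemLp h 2 volume) :
    eLpNorm (𝓕⁻ h) 2 volume = eLpNorm h 2 volume := by
  set H : Lp (α := V) ℂ 2 volume := h2.toLp h with hH
  set u : Lp (α := V) ℂ 2 volume := 𝓕⁻ H with hu
  have hL : Continuous fun p : V × V ↦ (-innerₗ V) p.1 p.2 := by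
    simp only [LinearMap.neg_apply, innerₗ_apply_apply]; fun_prop
  have key : ∀ g : 𝓢(V, ℂ), ∫ x, g x • (u : V → ℂ) x = ∫ x, g x • (𝓕⁻ h) x := by
    intro g
    have e1 := congrArg (fun T : 𝓢'(V, ℂ) => T g) (Lp.fourierInv_toTemperedDistribution_eq H)
    simp only [Lp.toTemperedDistribution_apply, TemperedDistribution.fourierInv_apply] at e1
    rw [← hu] at e1
    rw [← e1]
    have e2 : ∫ x, (𝓕⁻ g) x • (H : V → ℂ) x = ∫ x, (𝓕⁻ g) x • h x := by
      apply integral_congr_ae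
      filter_upwards [h2.coeFn_toLp] with x hx
      rw [hH, hx]
    rw [e2]
    have := VectorFourier.integral_fourierIntegral_smul_eq_flip (μ := volume) (ν := volume)
      (e := Real.fourierChar) (L := -innerₗ V) (f := g) (g := h) Real.continuous_fourierChar
      hL g.integrable h1
    have hflip : (-innerₗ V).flip = -innerₗ V := by
      ext x y; simp [real_inner_comm]
    rw [hflip] at this
    rw [SchwartzMap.fourierInv_coe]
    exact this
  have hcont : Continuous (𝓕⁻ h) :=
    VectorFourier.fourierIntegral_continuous Real.continuous_fourierChar hL h1
  have hul : LocallyIntegrable (u : V → ℂ) volume :=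
    (Lp.memLp u).locallyIntegrable (by norm_num)
  have hloc : LocallyIntegrable (fun x => (u : V → ℂ) x - (𝓕⁻ h) x) volume :=
    hul.sub hcont.locallyIntegrable
  have hae : (u : V → ℂ) =ᵐ[volume] 𝓕⁻ h := by
    have := ae_eq_zero_of_integral_contDiff_smul_eq_zero hloc ?_
    · filter_upwards [this] with x hx using sub_eq_zero.1 hx
    intro g hg hc
    have hc' : HasCompactSupport (fun x => (g x : ℂ)) := hc.comp_left (g := fun t : ℝ => (t : ℂ)) rfl
    have hk : ∫ x, (g x : ℂ) • (u : V → ℂ) x = ∫ x, (g x : ℂ) • (𝓕⁻ h) x :=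
      key (hc'.toSchwartzMap (Complex.ofRealCLM.contDiff.comp hg))
    have i1 : Integrable (fun x => g x • (u : V → ℂ) x) volume :=
      hul.integrable_smul_left_of_hasCompactSupport hg.continuous hc
    have i2 : Integrable (fun x => g x • (𝓕⁻ h) x) volume :=
      hcont.locallyIntegrable.integrable_smul_left_of_hasCompactSupport hg.continuous hc
    simp only [smul_sub]
    rw [integral_sub i1 i2, sub_eq_zero]
    simpa using hk
  rw [← eLpNorm_congr_ae hae]
  have hn : ‖u‖ = ‖H‖ := by
    rw [← Lp.norm_fourier_eq u, hu, FourierTransform.fourier_fourierInv_eq]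
  rw [← eLpNorm_congr_ae h2.coeFn_toLp]
  rw [Lp.norm_def, Lp.norm_def, ENNReal.toReal_eq_toReal_iff' (Lp.eLpNorm_ne_top _)
    (Lp.eLpNorm_ne_top _)] at hn
  exact hn

/-- The superlevel sets of a Schwartz function are controlled by the `L²` mass of its Fourier
transform off a set where the `L¹` mass is small. -/
lemma volume_two_mul_lt_norm_le {V : Type*} [NormedAddCommGroup V] [InnerProductSpace ℝ V]
    [FiniteDimensional ℝ V] [MeasurableSpace V] [BorelSpace V] (g : 𝓢(V, ℂ)) {S : Set V}
    (hS : MeasurableSet S) {t : ℝ} (ht : 0 < t)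
    (h : ∫⁻ ξ in S, ‖𝓕 (⇑g) ξ‖ₑ ≤ ENNReal.ofReal t) :
    volume {x | 2 * t < ‖g x‖} ≤
      ENNReal.ofReal (t ^ (-2 : ℝ)) * ∫⁻ ξ in Sᶜ, ‖𝓕 (⇑g) ξ‖ₑ ^ (2 : ℝ) := by
  set G : 𝓢(V, ℂ) := 𝓕 g with hG
  have hGc : 𝓕 (⇑g) = ⇑G := (SchwartzMap.fourier_coe g).symm
  rw [hGc] at h ⊢
  set h₁ : V → ℂ := S.indicator G
  set h₂ : V → ℂ := Sᶜ.indicator G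
  have i1 : Integrable h₁ volume := G.integrable.indicator hS
  have i2 : Integrable h₂ volume := G.integrable.indicator hS.compl
  have m2 : MemLp h₂ 2 volume := (G.memLp 2 volume).indicator hS.compl
  have hsum : ∀ x, g x = 𝓕⁻ h₁ x + 𝓕⁻ h₂ x := by
    intro x
    have e : g x = 𝓕⁻ (⇑G) x := by
      have := congrArg (fun f : 𝓢(V, ℂ) => f x) (FourierTransform.fourierInv_fourier_eq (F := 𝓢(V, ℂ)) g)
      rw [hG, ← SchwartzMap.fourierInv_coe]
      exact this.symm
    have : (⇑G) = h₁ + h₂ := (Set.indicator_self_add_compl S _).symm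
    rw [e, this]
    simp only [Real.fourierInv_eq, Pi.add_apply, smul_add]
    have key : ∀ {k : V → ℂ}, Integrable k volume →
        Integrable (fun v => Real.fourierChar (inner ℝ v x) • k v) volume := by
      intro k hk
      simpa using (Real.fourierIntegral_convergent_iff (-x)).2 hk
    exact integral_add (key i1) (key i2)
  have hb : ∀ x, ‖𝓕⁻ h₁ x‖ ≤ t := by
    intro x
    have e1 : ‖𝓕⁻ h₁ x‖ₑ ≤ ENNReal.ofReal t := by
      rw [Real.fourierInv_eq]
      refine (enorm_integral_le_lintegral_enorm _).trans (le_trans (le_of_eq ?_) h)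
      rw [← lintegral_indicator hS]
      refine lintegral_congr fun v => ?_
      rw [← ofReal_norm, Circle.norm_smul, ofReal_norm]
      exact enorm_indicator_eq_indicator_enorm _ _
    rw [← ofReal_norm] at e1
    exact (ENNReal.ofReal_le_ofReal_iff ht.le).1 e1
  have hsub : {x | 2 * t < ‖g x‖} ⊆ {x | ENNReal.ofReal t ≤ ‖𝓕⁻ h₂ x‖ₑ} := by
    intro x hx
    simp only [Set.mem_ofPred_eq] at hx ⊢
    rw [← ofReal_norm]
    apply ENNReal.ofReal_le_ofReal
    have := norm_add_le (𝓕⁻ h₁ x) (𝓕⁻ h₂ x)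
    rw [← hsum] at this
    linarith [hb x]
  refine (measure_mono hsub).trans ?_
  have hcont : Continuous (𝓕⁻ h₂) :=
    VectorFourier.fourierIntegral_continuous Real.continuous_fourierChar
      (by simp only [LinearMap.neg_apply, innerₗ_apply_apply]; fun_prop) i2
  have hch := meas_ge_le_mul_pow_eLpNorm_enorm (volume : Measure V) (p := 2) (by norm_num)
    (by norm_num) hcont.aestronglyMeasurable (ε := ENNReal.ofReal t) (by simpa using ht)
    (by simp)
  refine hch.trans (le_of_eq ?_)
  rw [eLpNorm_fourierInv_two i2 m2]
  have e3 : eLpNorm h₂ 2 volume ^ (2 : ℝ≥0∞).toReal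
      = ∫⁻ ξ in Sᶜ, ‖G ξ‖ₑ ^ (2 : ℝ) := by
    rw [eLpNorm_eq_lintegral_rpow_enorm_toReal (by norm_num) (by norm_num), ← ENNReal.rpow_mul]
    simp only [ENNReal.toReal_ofNat, one_div, ne_eq, OfNat.ofNat_ne_zero, not_false_eq_true,
      inv_mul_cancel₀, ENNReal.rpow_one]
    rw [← lintegral_indicator hS.compl]
    refine lintegral_congr fun v => ?_
    by_cases hv : v ∈ Sᶜ
    · simp only [h₂, Set.indicator_of_mem hv]
    · simp only [h₂, Set.indicator_of_notMem hv]; simp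
  rw [e3]
  congr 1
  rw [← ENNReal.ofReal_inv_of_pos ht, ENNReal.ofReal_rpow_of_pos (by positivity),
    Real.inv_rpow ht.le, Real.rpow_neg ht.le]
  simp

lemma lintegral_Ioi_indicator_rpow_le {q : ℝ} (hq : 2 < q) (w : ℝ≥0∞) :
    ∫⁻ t in Set.Ioi (0 : ℝ), (if ENNReal.ofReal t < w then ENNReal.ofReal (t ^ (q - 3)) else 0) ≤
      ENNReal.ofReal (1 / (q - 2)) * w ^ (q - 2) := by
  have hq2 : 0 < q - 2 := by linarith
  rcases eq_or_ne w ∞ with rfl | hw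
  · rw [ENNReal.top_rpow_of_pos hq2, ENNReal.mul_top (by simpa using hq2)]
    exact le_top
  lift w to NNReal using hw
  have e : ∀ t ∈ Set.Ioi (0 : ℝ), (if ENNReal.ofReal t < (w : ℝ≥0∞) then
      ENNReal.ofReal (t ^ (q - 3)) else 0)
      = (Set.Iio (w : ℝ)).indicator (fun t => ENNReal.ofReal (t ^ (q - 3))) t := by
    intro t ht
    have : ENNReal.ofReal t < (w : ℝ≥0∞) ↔ t < w := by
      rw [← ENNReal.ofReal_coe_nnreal]
      rw [ENNReal.ofReal_lt_ofReal_iff']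
      constructor
      · exact fun h => h.1
      · exact fun h => ⟨h, lt_trans ht h⟩
    simp only [this, Set.indicator_apply, Set.mem_Iio]
  rw [setLIntegral_congr_fun measurableSet_Ioi e, setLIntegral_indicator measurableSet_Iio,
    Set.inter_comm, Set.Ioi_inter_Iio]
  have h_pow : IntervalIntegrable (fun t : ℝ => t ^ (q - 3)) volume 0 w :=
    intervalIntegral.intervalIntegrable_rpow' (by linarith)
  rw [Measure.restrict_congr_set Ioo_ae_eq_Ioc, ← ofReal_integral_eq_lintegral_ofReal
    ((intervalIntegrable_iff_integrableOn_Ioc_of_le w.coe_nonneg).1 h_pow)]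
  · rw [← intervalIntegral.integral_of_le w.coe_nonneg, integral_rpow (Or.inl (by linarith)),
      Real.zero_rpow (by linarith), show q - 3 + 1 = q - 2 by ring, sub_zero,
      ← ENNReal.ofReal_coe_nnreal, ENNReal.ofReal_rpow_of_nonneg w.coe_nonneg hq2.le,
      ← ENNReal.ofReal_mul (by positivity)]
    apply ENNReal.ofReal_le_ofReal
    apply le_of_eq; ring
  · filter_upwards [ae_restrict_mem measurableSet_Ioc] with t ht
    exact Real.rpow_nonneg ht.1.le _

lemma lintegral_rpow_le_of_sublevel {V : Type*} [NormedAddCommGroup V] [InnerProductSpace ℝ V]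
    [FiniteDimensional ℝ V] [MeasurableSpace V] [BorelSpace V] (g : 𝓢(V, ℂ)) {q : ℝ} (hq : 2 < q)
    {W : V → ℝ≥0∞} (hW : Measurable W)
    (h : ∀ t : ℝ, 0 < t →
      ∫⁻ ξ in {ξ | W ξ ≤ ENNReal.ofReal t}, ‖𝓕 (⇑g) ξ‖ₑ ≤ ENNReal.ofReal t) :
    ∫⁻ x, ‖g x‖ₑ ^ q ≤
      ENNReal.ofReal (2 ^ q * (q * (1 / (q - 2)))) *
        ∫⁻ ξ, ‖𝓕 (⇑g) ξ‖ₑ ^ (2 : ℝ) * W ξ ^ (q - 2) := by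
  have hq0 : 0 < q := by linarith
  have hGm : Measurable fun ξ => ‖𝓕 (⇑g) ξ‖ₑ ^ (2 : ℝ) := by
    have : Continuous (𝓕 (⇑g)) := (𝓕 g : 𝓢(V, ℂ)).continuous
    fun_prop
  have lc := lintegral_rpow_eq_lintegral_meas_lt_mul (volume : Measure V)
    (f := fun x => ‖g x‖ / 2) (Filter.Eventually.of_forall fun x => by positivity)
    (by have := g.continuous; fun_prop) hq0
  have e1 : ∫⁻ x, ‖g x‖ₑ ^ q = ENNReal.ofReal (2 ^ q) * ∫⁻ x, ENNReal.ofReal ((‖g x‖ / 2) ^ q) := by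
    rw [← lintegral_const_mul' _ _ ENNReal.ofReal_ne_top]
    refine lintegral_congr fun x => ?_
    rw [← ENNReal.ofReal_mul (by positivity), ← Real.mul_rpow (by positivity) (by positivity),
      mul_div_cancel₀ _ (by norm_num), ← ofReal_norm, ENNReal.ofReal_rpow_of_nonneg (norm_nonneg _)
      hq0.le]
  rw [e1, lc, ENNReal.ofReal_mul (by positivity), ENNReal.ofReal_mul (by positivity),
    mul_assoc, mul_assoc]
  gcongr
  have hF : Measurable (Function.uncurry fun (t : ℝ) (ξ : V) => ‖𝓕 (⇑g) ξ‖ₑ ^ (2 : ℝ) *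
      (if ENNReal.ofReal t < W ξ then ENNReal.ofReal (t ^ (q - 3)) else 0)) := by
    refine (hGm.comp measurable_snd).mul (Measurable.ite ?_ ?_ measurable_const)
    · exact measurableSet_lt (by fun_prop) (by fun_prop)
    · fun_prop
  calc ∫⁻ t in Set.Ioi (0 : ℝ), volume {a : V | t < ‖g a‖ / 2} * ENNReal.ofReal (t ^ (q - 1))
      ≤ ∫⁻ t in Set.Ioi (0 : ℝ), ∫⁻ ξ, ‖𝓕 (⇑g) ξ‖ₑ ^ (2 : ℝ) *
          (if ENNReal.ofReal t < W ξ then ENNReal.ofReal (t ^ (q - 3)) else 0) := by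
        refine setLIntegral_mono' measurableSet_Ioi fun t ht => ?_
        have ht : 0 < t := ht
        have hS : MeasurableSet {ξ | W ξ ≤ ENNReal.ofReal t} := hW measurableSet_Iic
        have hv := volume_two_mul_lt_norm_le g hS ht (h t ht)
        have hset : {a : V | t < ‖g a‖ / 2} = {a | 2 * t < ‖g a‖} := by
          ext a; simp only [Set.mem_ofPred_eq]; constructor <;> intro h <;> linarith
        rw [hset]
        grw [hv]
        rw [← lintegral_indicator hS.compl, mul_right_comm,
          ← ENNReal.ofReal_mul (by positivity), ← Real.rpow_add ht,
          show -2 + (q - 1) = q - 3 by ring, ← lintegral_const_mul' _ _ ENNReal.ofReal_ne_top]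
        refine lintegral_mono fun ξ => ?_
        by_cases hξ : ENNReal.ofReal t < W ξ
        · simp only [hξ, if_true]
          rw [Set.indicator_of_mem (by simpa using hξ), mul_comm]
        · simp only [hξ, if_false]
          rw [Set.indicator_of_notMem (by simpa using hξ)]; simp
    _ = ∫⁻ ξ, ∫⁻ t in Set.Ioi (0 : ℝ), ‖𝓕 (⇑g) ξ‖ₑ ^ (2 : ℝ) *
          (if ENNReal.ofReal t < W ξ then ENNReal.ofReal (t ^ (q - 3)) else 0) :=
        lintegral_lintegral_swap hF.aemeasurable
    _ ≤ ∫⁻ ξ, ENNReal.ofReal (1 / (q - 2)) * (‖𝓕 (⇑g) ξ‖ₑ ^ (2 : ℝ) * W ξ ^ (q - 2)) := by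
        refine lintegral_mono fun ξ => ?_
        have hne : ‖𝓕 (⇑g) ξ‖ₑ ^ (2 : ℝ) ≠ ∞ := by simp
        rw [lintegral_const_mul' _ _ hne, mul_left_comm]
        gcongr
        exact lintegral_Ioi_indicator_rpow_le hq _
    _ = _ := lintegral_const_mul' _ _ ENNReal.ofReal_ne_top

section
variable {V : Type*} [NormedAddCommGroup V] [InnerProductSpace ℝ V]
    [FiniteDimensional ℝ V] [MeasurableSpace V] [BorelSpace V]

lemma eLpNorm_two_eq_fourier (g : 𝓢(V, ℂ)) :
    eLpNorm g 2 volume = eLpNorm (𝓕 (⇑g)) 2 volume := by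
  have h := eLpNorm_fourierInv_two (h := ⇑(𝓕 g : 𝓢(V, ℂ))) (𝓕 g : 𝓢(V, ℂ)).integrable
    ((𝓕 g : 𝓢(V, ℂ)).memLp 2 volume)
  rw [← SchwartzMap.fourierInv_coe, FourierTransform.fourierInv_fourier_eq,
    SchwartzMap.fourier_coe] at h
  exact h

variable (V) in
/-- The Hausdorff–Young inequality for Schwartz functions, up to a constant. -/
lemma exists_hausdorff_young {p s : ℝ} (hps : p.HolderConjugate s) (hp2 : p ≤ 2) :
    ∃ C : NNReal, ∀ g : 𝓢(V, ℂ), eLpNorm g (ENNReal.ofReal s) volume ≤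
      C * eLpNorm (𝓕 (⇑g)) (ENNReal.ofReal p) volume := by
  have hp1 := hps.lt
  rcases hp2.eq_or_lt with rfl | hp2
  · have : s = 2 := by rw [hps.conjugate_eq]; norm_num
    subst this
    refine ⟨1, fun g => ?_⟩
    simpa using (eLpNorm_two_eq_fourier g).le
  have hs2 : 2 < s := by
    rw [hps.conjugate_eq, lt_div_iff₀ (by linarith)]; linarith
  refine ⟨(2 ^ s * (s * (1 / (s - 2)))).toNNReal ^ (1 / s), fun g => ?_⟩
  have hs0 : 0 < s := by linarith
  have hp0 : 0 < p := by linarith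
  set M := ∫⁻ ξ, ‖𝓕 (⇑g) ξ‖ₑ ^ p with hM
  have hGc : Continuous (𝓕 (⇑g)) := (𝓕 g : 𝓢(V, ℂ)).continuous
  have hpE : ENNReal.ofReal p ≠ 0 := by simpa using hp0
  have hsE : ENNReal.ofReal s ≠ 0 := by simpa using hs0
  have hn : eLpNorm (𝓕 (⇑g)) (ENNReal.ofReal p) volume = M ^ (1 / p) := by
    rw [eLpNorm_eq_lintegral_rpow_enorm_toReal hpE ENNReal.ofReal_ne_top,
      ENNReal.toReal_ofReal hp0.le]
  have hMtop : M ≠ ∞ := by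
    intro h
    have := ((𝓕 g : 𝓢(V, ℂ)).memLp (ENNReal.ofReal p) volume).2
    rw [SchwartzMap.fourier_coe, hn, h, ENNReal.top_rpow_of_pos (by positivity)] at this
    exact lt_irrefl _ this
  have key := lintegral_rpow_le_of_sublevel g hs2 (W := fun ξ => M * ‖𝓕 (⇑g) ξ‖ₑ ^ (1 - p))
    (by fun_prop) ?_
  · have hpt : ∀ ξ, ‖𝓕 (⇑g) ξ‖ₑ ^ (2 : ℝ) * (M * ‖𝓕 (⇑g) ξ‖ₑ ^ (1 - p)) ^ (s - 2)
        ≤ M ^ (s - 2) * ‖𝓕 (⇑g) ξ‖ₑ ^ p := by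
      intro ξ
      rcases eq_or_ne ‖𝓕 (⇑g) ξ‖ₑ 0 with h0 | h0
      · rw [h0]; simp
      rw [ENNReal.mul_rpow_of_nonneg _ _ (by linarith), ← ENNReal.rpow_mul, mul_left_comm,
        ← ENNReal.rpow_add _ _ h0 (by simp)]
      apply le_of_eq
      congr 2
      have := hps.sub_one_mul_conj
      nlinarith
    rw [eLpNorm_eq_lintegral_rpow_enorm_toReal hsE ENNReal.ofReal_ne_top,
      ENNReal.toReal_ofReal hs0.le, hn, ENNReal.coe_rpow_of_nonneg _ (by positivity)]
    calc (∫⁻ x, ‖g x‖ₑ ^ s) ^ (1 / s)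
        ≤ (ENNReal.ofReal (2 ^ s * (s * (1 / (s - 2)))) * M ^ (s - 1)) ^ (1 / s) := by
          gcongr
          refine key.trans ?_
          gcongr
          refine (lintegral_mono hpt).trans ?_
          rw [lintegral_const_mul' _ _ (ENNReal.rpow_ne_top_of_nonneg (by linarith) hMtop), ← hM]
          nth_rewrite 2 [← ENNReal.rpow_one M]
          rw [← ENNReal.rpow_add_of_nonneg _ _ (by linarith) (by norm_num)]
          apply le_of_eq; congr 1; ring
      _ = _ := by
          rw [ENNReal.mul_rpow_of_nonneg _ _ (by positivity), ← ENNReal.rpow_mul]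
          congr 2
          have := hps.symm.one_div_add_one_div
          have hs : s ≠ 0 := hs0.ne'
          have hp : p ≠ 0 := hp0.ne'
          have h3 := hps.sub_one_mul_conj
          field_simp
          linarith
  · intro t ht
    have hS : MeasurableSet {ξ | M * ‖𝓕 (⇑g) ξ‖ₑ ^ (1 - p) ≤ ENNReal.ofReal t} :=
      measurableSet_le (by fun_prop) measurable_const
    rcases eq_or_ne M 0 with h0 | h0
    · have hz : ∫⁻ ξ, ‖𝓕 (⇑g) ξ‖ₑ = 0 := by
        rw [lintegral_eq_zero_iff (by fun_prop)]
        rw [hM, lintegral_eq_zero_iff (by fun_prop)] at h0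
        filter_upwards [h0] with ξ hξ
        simpa [hp0, hp0.le, hp0.not_gt] using hξ
      exact (setLIntegral_le_lintegral _ _).trans (hz.le.trans bot_le)
    calc ∫⁻ ξ in {ξ | M * ‖𝓕 (⇑g) ξ‖ₑ ^ (1 - p) ≤ ENNReal.ofReal t}, ‖𝓕 (⇑g) ξ‖ₑ
        ≤ ∫⁻ ξ in {ξ | M * ‖𝓕 (⇑g) ξ‖ₑ ^ (1 - p) ≤ ENNReal.ofReal t},
          (ENNReal.ofReal t * M⁻¹) * ‖𝓕 (⇑g) ξ‖ₑ ^ p := by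
          refine setLIntegral_mono' hS fun ξ hξ => ?_
          have hξ : M * ‖𝓕 (⇑g) ξ‖ₑ ^ (1 - p) ≤ ENNReal.ofReal t := hξ
          rcases eq_or_ne ‖𝓕 (⇑g) ξ‖ₑ 0 with hx0 | hx0
          · rw [hx0]; simp
          have : ‖𝓕 (⇑g) ξ‖ₑ ^ (1 - p) ≤ ENNReal.ofReal t * M⁻¹ := by
            rw [← div_eq_mul_inv, ENNReal.le_div_iff_mul_le (Or.inl h0) (Or.inl hMtop), mul_comm]
            exact hξ
          grw [← this]
          rw [← ENNReal.rpow_add _ _ hx0 (by simp)]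
          simp
      _ ≤ ∫⁻ ξ, (ENNReal.ofReal t * M⁻¹) * ‖𝓕 (⇑g) ξ‖ₑ ^ p := setLIntegral_le_lintegral _ _
      _ = ENNReal.ofReal t := by
          rw [lintegral_const_mul _ (by fun_prop), ← hM, mul_assoc,
            ENNReal.inv_mul_cancel h0 hMtop, mul_one]

/-- Integration of radial functions in polar coordinates. -/
lemma lintegral_fun_norm_eq [Nontrivial V] {f : ℝ → ℝ≥0∞} (hf : Measurable f) :
    ∫⁻ x : V, f ‖x‖ = (volume : Measure V).toSphere Set.univ *
      ∫⁻ r in Set.Ioi (0 : ℝ), ENNReal.ofReal (r ^ (Module.finrank ℝ V - 1)) * f r := by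
  have h1 : ∫⁻ x : V, f ‖x‖ = ∫⁻ x : ({(0 : V)}ᶜ : Set V), f ‖x.1‖
      ∂((volume : Measure V).comap (↑)) := by
    rw [lintegral_subtype_comap (measurableSet_singleton _).compl (fun x : V => f ‖x‖),
      restrict_compl_singleton]
  have h2 := (volume : Measure V).measurePreserving_homeomorphUnitSphereProd.lintegral_comp_emb
      (Homeomorph.measurableEmbedding _) (fun x => f x.2.1)
  simp only [homeomorphUnitSphereProd_apply_snd_coe] at h2
  rw [h1, h2, lintegral_prod _ (by fun_prop)]
  simp only [lintegral_const]
  rw [mul_comm, Measure.volumeIoiPow, lintegral_withDensity_eq_lintegral_mul _ (by fun_prop)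
    (by fun_prop)]
  simp only [Pi.mul_apply]
  rw [lintegral_subtype_comap measurableSet_Ioi
    (fun r : ℝ => ENNReal.ofReal (r ^ (Module.finrank ℝ V - 1)) * f r)]

end

section
variable {V : Type*} [NormedAddCommGroup V] [InnerProductSpace ℝ V] [FiniteDimensional ℝ V]
  [MeasurableSpace V] [BorelSpace V]

lemma lintegral_Ioc_rpow {b ρ : ℝ} (hb : -1 < b) (hρ : 0 ≤ ρ) :
    ∫⁻ r in Set.Ioc 0 ρ, ENNReal.ofReal (r ^ b) = ENNReal.ofReal (ρ ^ (b + 1) / (b + 1)) := by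
  rw [← ofReal_integral_eq_lintegral_ofReal, ← intervalIntegral.integral_of_le hρ,
    integral_rpow (Or.inl hb), Real.zero_rpow (by linarith), sub_zero]
  · exact (intervalIntegrable_iff_integrableOn_Ioc_of_le hρ).1
      (intervalIntegral.intervalIntegrable_rpow' hb)
  · filter_upwards [ae_restrict_mem measurableSet_Ioc] with r hr
    exact Real.rpow_nonneg hr.1.le _

lemma lintegral_Ioi_rpow {b ρ : ℝ} (hb : b < -1) (hρ : 0 < ρ) :
    ∫⁻ r in Set.Ioi ρ, ENNReal.ofReal (r ^ b) = ENNReal.ofReal (ρ ^ (b + 1) / (-(b + 1))) := by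
  rw [← ofReal_integral_eq_lintegral_ofReal (integrableOn_Ioi_rpow_of_lt hb hρ),
    integral_Ioi_rpow_of_lt hb hρ, div_neg, neg_div]
  filter_upwards [ae_restrict_mem measurableSet_Ioi] with r hr
  exact Real.rpow_nonneg (hρ.trans hr).le _

lemma lintegral_Ioc_inv {ρ : ℝ} (hρ : 0 < ρ) (hρ1 : ρ ≤ 1) :
    ∫⁻ r in Set.Ioc ρ 1, ENNReal.ofReal r⁻¹ = ENNReal.ofReal (Real.log ρ⁻¹) := by
  rw [← ofReal_integral_eq_lintegral_ofReal, ← intervalIntegral.integral_of_le hρ1,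
    integral_inv_of_pos hρ one_pos, one_div]
  · exact (intervalIntegrable_iff_integrableOn_Ioc_of_le hρ1).1
      (intervalIntegral.intervalIntegrable_inv (fun x hx => by
        rw [Set.uIcc_of_le hρ1] at hx; exact (hρ.trans_le hx.1).ne') continuousOn_id)
  · filter_upwards [ae_restrict_mem measurableSet_Ioc] with r hr
    exact inv_nonneg.2 (hρ.trans hr.1).le

/-- Integration of powers of the norm over spherical shells. -/
lemma setLIntegral_enorm_rpow [Nontrivial V] (a : ℝ) {s : Set ℝ} (hs : MeasurableSet s)
    (hs0 : s ⊆ Set.Ioi 0) :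
    ∫⁻ x : V in norm ⁻¹' s, ‖x‖ₑ ^ a = (volume : Measure V).toSphere Set.univ *
      ∫⁻ r in s, ENNReal.ofReal (r ^ (a + Module.finrank ℝ V - 1)) := by
  have h := lintegral_fun_norm_eq (V := V) (f := s.indicator (fun r => ENNReal.ofReal r ^ a))
    (Measurable.indicator (by fun_prop) hs)
  rw [← lintegral_indicator (measurable_norm hs)]
  have hn : 1 ≤ Module.finrank ℝ V := Module.finrank_pos
  calc _ = ∫⁻ x : V, s.indicator (fun r => ENNReal.ofReal r ^ a) ‖x‖ := by
        congr 1; ext x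
        by_cases hx : ‖x‖ ∈ s
        · simp [hx, Set.indicator]
        · simp [hx, Set.indicator]
    _ = _ := by
        rw [h]
        congr 1
        rw [← lintegral_indicator hs, ← lintegral_indicator measurableSet_Ioi]
        congr 1; ext r
        by_cases hr : r ∈ s
        · have hr0 : 0 < r := hs0 hr
          rw [Set.indicator_of_mem hr, Set.indicator_of_mem (hs0 hr), Set.indicator_of_mem hr,
            ENNReal.ofReal_rpow_of_pos hr0, ← ENNReal.ofReal_mul (by positivity),
            ← Real.rpow_natCast, ← Real.rpow_add hr0]
          push_cast [hn]; congr 2; ring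
        · by_cases hr0 : r ∈ Set.Ioi (0 : ℝ) <;> simp [hr, hr0]

lemma setLIntegral_closedBall_eq_shell [Nontrivial V] (f : V → ℝ≥0∞) (ρ : ℝ) :
    ∫⁻ x in Metric.closedBall 0 ρ, f x = ∫⁻ x in norm ⁻¹' (Set.Ioc 0 ρ), f x := by
  refine setLIntegral_congr ?_
  have : ∀ᵐ x : V, x ≠ 0 := by simp [ae_iff]
  filter_upwards [this] with x hx
  change (x ∈ Metric.closedBall (0 : V) ρ) = (x ∈ norm ⁻¹' (Set.Ioc 0 ρ))
  simp [hx]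

lemma exists_setLIntegral_closedBall_enorm_rpow_le (V : Type*) [NormedAddCommGroup V]
    [InnerProductSpace ℝ V] [FiniteDimensional ℝ V] [MeasurableSpace V] [BorelSpace V]
    [Nontrivial V] {a : ℝ} (ha : 0 < a + Module.finrank ℝ V) :
    ∃ C : NNReal, ∀ ρ : ℝ, 0 ≤ ρ → ∫⁻ x : V in Metric.closedBall 0 ρ, ‖x‖ₑ ^ a ≤
      C * ENNReal.ofReal ρ ^ (a + Module.finrank ℝ V) := by
  refine ⟨((volume : Measure V).toSphere Set.univ).toNNReal *
    (1 / (a + Module.finrank ℝ V)).toNNReal, fun ρ hρ => ?_⟩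
  rw [setLIntegral_closedBall_eq_shell, setLIntegral_enorm_rpow a measurableSet_Ioc
    (fun x hx => hx.1), lintegral_Ioc_rpow (by linarith) hρ, ENNReal.coe_mul,
    ENNReal.coe_toNNReal (measure_ne_top _ _), mul_assoc, sub_add_cancel,
    div_eq_inv_mul, ← one_div, ENNReal.ofReal_mul (by positivity),
    ENNReal.ofReal_rpow_of_nonneg hρ ha.le]
  rfl

lemma exists_setLIntegral_compl_ball_enorm_rpow_le (V : Type*) [NormedAddCommGroup V]
    [InnerProductSpace ℝ V] [FiniteDimensional ℝ V] [MeasurableSpace V] [BorelSpace V]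
    [Nontrivial V] {a : ℝ} (ha : a + Module.finrank ℝ V < 0) :
    ∃ C : NNReal, ∀ ρ : ℝ, 0 < ρ → ∫⁻ x : V in {x | ρ ≤ ‖x‖}, ‖x‖ₑ ^ a ≤
      C * ENNReal.ofReal ρ ^ (a + Module.finrank ℝ V) := by
  refine ⟨((volume : Measure V).toSphere Set.univ).toNNReal *
    (1 / -(a + Module.finrank ℝ V)).toNNReal, fun ρ hρ => ?_⟩
  have : {x : V | ρ ≤ ‖x‖} = norm ⁻¹' (Set.Ici ρ) := rfl
  rw [this, setLIntegral_enorm_rpow a measurableSet_Ici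
    (fun x hx => hρ.trans_le hx), ← restrict_Ioi_eq_restrict_Ici, lintegral_Ioi_rpow (by linarith) hρ, ENNReal.coe_mul,
    ENNReal.coe_toNNReal (measure_ne_top _ _), mul_assoc, sub_add_cancel,
    div_eq_inv_mul, ← one_div, ENNReal.ofReal_mul (by rw [one_div_nonneg]; linarith),
    ENNReal.ofReal_rpow_of_pos hρ]
  rfl

lemma exists_setLIntegral_annulus_le (V : Type*) [NormedAddCommGroup V]
    [InnerProductSpace ℝ V] [FiniteDimensional ℝ V] [MeasurableSpace V] [BorelSpace V]
    [Nontrivial V] :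
    ∃ C : NNReal, ∀ ρ : ℝ, 0 < ρ → ρ ≤ 1 →
      ∫⁻ x : V in norm ⁻¹' (Set.Ioc ρ 1), ‖x‖ₑ ^ (-(Module.finrank ℝ V : ℝ)) ≤
      C * ENNReal.ofReal (Real.log ρ⁻¹) := by
  refine ⟨((volume : Measure V).toSphere Set.univ).toNNReal, fun ρ hρ hρ1 => ?_⟩
  rw [setLIntegral_enorm_rpow _ measurableSet_Ioc
    (fun x hx => hρ.trans hx.1), ENNReal.coe_toNNReal (measure_ne_top _ _),
    ← lintegral_Ioc_inv hρ hρ1]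
  simp only [neg_add_cancel, zero_sub, Real.rpow_neg_one]
  rfl

/-- The measure of a norm-lower set is controlled by the closed balls it contains. -/
lemma setLIntegral_le_of_closedBall_le {G : V → ℝ≥0∞} {S : Set V} {t : ℝ≥0∞}
    (hS : ∀ x ∈ S, ∫⁻ y in Metric.closedBall 0 ‖x‖, G y ≤ t) : ∫⁻ y in S, G y ≤ t := by
  rcases S.eq_empty_or_nonempty with rfl | hne
  · simp
  set T : Set EReal := (fun x : V => ((‖x‖ : ℝ) : EReal)) '' S with hT
  obtain ⟨u, hum, hux, hut, huT⟩ := (isLUB_sSup T).exists_seq_monotone_tendsto (hne.image _)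
  choose x hxS hxu' using huT
  have hxu (n : ℕ) : ((‖x n‖ : ℝ) : EReal) = u n := hxu' n
  by_cases hmem : sSup T ∈ T
  · obtain ⟨z, hzS, hz⟩ := hmem
    refine (lintegral_mono_set fun y hy => ?_).trans (hS z hzS)
    have : ((‖y‖ : ℝ) : EReal) ≤ sSup T := le_sSup ⟨y, hy, rfl⟩
    rw [← hz] at this
    simpa using this
  · have hsub : S ⊆ ⋃ n, Metric.closedBall (0 : V) ‖x n‖ := by
      intro y hy
      have h1 : ((‖y‖ : ℝ) : EReal) < sSup T := lt_of_le_of_ne (le_sSup ⟨y, hy, rfl⟩)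
        (fun h => hmem (h ▸ ⟨y, hy, rfl⟩))
      obtain ⟨n, hn⟩ := (hut.eventually (lt_mem_nhds h1)).exists
      rw [← hxu n] at hn
      have : ‖y‖ < ‖x n‖ := by exact_mod_cast hn
      exact Set.mem_iUnion.2 ⟨n, by simpa using this.le⟩
    refine (lintegral_mono_set hsub).trans ?_
    have hmono : Monotone fun n => Metric.closedBall (0 : V) ‖x n‖ := by
      intro m n hmn
      refine Metric.closedBall_subset_closedBall ?_
      have := hum hmn
      rw [← hxu m, ← hxu n] at this
      exact_mod_cast this
    rw [setLIntegral_iUnion_of_directed _ hmono.directed_le]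
    exact iSup_le fun n => hS _ (hxS n)
end

section
variable {V : Type*} [NormedAddCommGroup V] [InnerProductSpace ℝ V] [FiniteDimensional ℝ V]
  [MeasurableSpace V] [BorelSpace V]

lemma ae_ne_zero [Nontrivial V] : ∀ᵐ x : V, x ≠ 0 := by simp [ae_iff]

lemma enorm_rpow_mul_rpow {V : Type*} [NormedAddCommGroup V] {x : V} (hx : x ≠ 0) (a b : ℝ) :
    ‖x‖ₑ ^ a * ‖x‖ₑ ^ b = ‖x‖ₑ ^ (a + b) :=
  (ENNReal.rpow_add _ _ (by simpa using hx) (by simp)).symm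

/-- Hölder's inequality against a power of the norm on a ball. -/
lemma exists_setLIntegral_closedBall_le (V : Type*) [NormedAddCommGroup V]
    [InnerProductSpace ℝ V] [FiniteDimensional ℝ V] [MeasurableSpace V] [BorelSpace V]
    [Nontrivial V] {q : ℝ} (hq : 2 < q) :
    ∃ C : NNReal, ∀ G : V → ℝ≥0∞, Measurable G → ∀ ρ : ℝ, 0 ≤ ρ →
      ∫⁻ η in Metric.closedBall 0 ρ, G η ≤ C * ENNReal.ofReal ρ ^ (Module.finrank ℝ V / (2 * q)) *
        (∫⁻ η in Metric.closedBall 0 ρ,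
          G η ^ q * ‖η‖ₑ ^ (Module.finrank ℝ V * (q - 3 / 2))) ^ (1 / q) := by
  set n : ℝ := ((Module.finrank ℝ V : ℕ) : ℝ) with hn
  have hn0 : 0 < n := by
    have : 0 < Module.finrank ℝ V := Module.finrank_pos
    rw [hn]; exact_mod_cast this
  have hq0 : 0 < q := by linarith
  have hconj : q.HolderConjugate (q / (q - 1)) := Real.HolderConjugate.conjExponent (by linarith)
  set q' := q / (q - 1) with hq'
  have hq'0 : 0 < q' := hconj.symm.pos
  set s : ℝ := n * (1 - 3 / (2 * q)) with hs
  have hq1 : q - 1 ≠ 0 := by linarith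
  have ha : 0 < -(s * q') + n := by
    have : -(s * q') + n = n / (2 * (q - 1)) := by
      rw [hs, hq']; field_simp; ring
    rw [this]; have : 0 < q - 1 := by linarith
    positivity
  obtain ⟨C, hC⟩ := exists_setLIntegral_closedBall_enorm_rpow_le V ha
  refine ⟨C ^ (1 / q'), fun G hG ρ hρ => ?_⟩
  calc ∫⁻ η in Metric.closedBall 0 ρ, G η
      ≤ ∫⁻ η in Metric.closedBall 0 ρ, (fun η => G η * ‖η‖ₑ ^ s) η * (fun η => ‖η‖ₑ ^ (-s)) η := by
        refine lintegral_mono_ae ?_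
        filter_upwards [ae_restrict_of_ae ae_ne_zero] with η hη
        simp only [mul_assoc]
        rw [enorm_rpow_mul_rpow hη]; simp
    _ ≤ (∫⁻ η in Metric.closedBall 0 ρ, (G η * ‖η‖ₑ ^ s) ^ q) ^ (1 / q) *
        (∫⁻ η in Metric.closedBall 0 ρ, (‖η‖ₑ ^ (-s)) ^ q') ^ (1 / q') :=
        ENNReal.lintegral_mul_le_Lp_mul_Lq _ hconj (by fun_prop) (by fun_prop)
    _ = (∫⁻ η in Metric.closedBall (0 : V) ρ, ‖η‖ₑ ^ (-(s * q'))) ^ (1 / q') *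
        (∫⁻ η in Metric.closedBall 0 ρ, G η ^ q * ‖η‖ₑ ^ (n * (q - 3 / 2))) ^ (1 / q) := by
        rw [mul_comm]
        congr 2
        · simp only [← ENNReal.rpow_mul, neg_mul]
        · congr 1; ext η
          rw [ENNReal.mul_rpow_of_nonneg _ _ hq0.le, ← ENNReal.rpow_mul]
          congr 2
          rw [hs]; field_simp
    _ ≤ _ := by
        gcongr ?_ * _
        grw [hC ρ hρ]
        rw [ENNReal.mul_rpow_of_nonneg _ _ (by positivity), ← ENNReal.rpow_mul,
          ENNReal.coe_rpow_of_nonneg _ (by positivity)]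
        apply le_of_eq
        congr 2
        rw [hs, hq']; field_simp; ring

/-- The Hardy–Littlewood–Paley inequality for Schwartz functions. -/
lemma exists_hardy_littlewood_paley (V : Type*) [NormedAddCommGroup V]
    [InnerProductSpace ℝ V] [FiniteDimensional ℝ V] [MeasurableSpace V] [BorelSpace V]
    [Nontrivial V] {q : ℝ} (hq : 2 ≤ q) :
    ∃ C : NNReal, ∀ g : 𝓢(V, ℂ), ∫⁻ x, ‖g x‖ₑ ^ q ≤
      C * ∫⁻ ξ, ‖𝓕 (⇑g) ξ‖ₑ ^ q * ‖ξ‖ₑ ^ (Module.finrank ℝ V * (q - 2)) := by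
  rcases hq.eq_or_lt with rfl | hq
  · refine ⟨1, fun g => ?_⟩
    have h := eLpNorm_two_eq_fourier g
    rw [eLpNorm_eq_lintegral_rpow_enorm_toReal (by simp) (by simp),
      eLpNorm_eq_lintegral_rpow_enorm_toReal (by simp) (by simp)] at h
    have h2 := congrArg (fun y => y ^ (2 : ℝ)) h
    simp only [← ENNReal.rpow_mul] at h2
    simpa using h2.le
  set n : ℝ := ((Module.finrank ℝ V : ℕ) : ℝ) with hn
  have hn0 : 0 < n := by
    have : 0 < Module.finrank ℝ V := Module.finrank_pos
    rw [hn]; exact_mod_cast this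
  have hq0 : 0 < q := by linarith
  obtain ⟨C1, hC1⟩ := exists_setLIntegral_closedBall_le V hq
  obtain ⟨C2, hC2⟩ := exists_setLIntegral_compl_ball_enorm_rpow_le V
    (a := -(3 * n / 2)) (by rw [← hn]; linarith)
  refine ⟨(2 ^ q * (q * (1 / (q - 2)))).toNNReal * (C1 ^ q * C2) ^ ((q - 2) / q), fun g => ?_⟩
  set G : V → ℝ≥0∞ := fun ξ => ‖𝓕 (⇑g) ξ‖ₑ with hG
  have hGc : Continuous (𝓕 (⇑g)) := by
    rw [← SchwartzMap.fourier_coe]; exact SchwartzMap.continuous _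
  have hGm : Measurable G := hGc.enorm.measurable
  set Ψ : ℝ → ℝ≥0∞ := fun ρ => ∫⁻ η in Metric.closedBall (0 : V) ρ,
    G η ^ q * ‖η‖ₑ ^ (n * (q - 3 / 2)) with hΨ
  have hΨmono : Monotone Ψ := fun a b hab =>
    lintegral_mono_set (Metric.closedBall_subset_closedBall hab)
  have hΨm : Measurable Ψ := hΨmono.measurable
  set W : V → ℝ≥0∞ := fun ξ => C1 * ‖ξ‖ₑ ^ (n / (2 * q)) * Ψ ‖ξ‖ ^ (1 / q) with hW
  have hWm : Measurable W := by fun_prop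
  have hWq : ∫⁻ ξ, W ξ ^ q * ‖ξ‖ₑ ^ (-(2 * n)) ≤
      (C1 ^ q * C2 : NNReal) * ∫⁻ ξ, G ξ ^ q * ‖ξ‖ₑ ^ (n * (q - 2)) := by
    have h1 : ∀ᵐ ξ : V, W ξ ^ q * ‖ξ‖ₑ ^ (-(2 * n)) =
        (C1 : ℝ≥0∞) ^ q * ∫⁻ η, {z : V × V | ‖z.2‖ ≤ ‖z.1‖}.indicator (fun z =>
          (G z.2 ^ q * ‖z.2‖ₑ ^ (n * (q - 3 / 2))) * ‖z.1‖ₑ ^ (-(3 * n / 2))) (ξ, η) := by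
      filter_upwards [ae_ne_zero] with ξ hξ
      have h2 : ∫⁻ η, {z : V × V | ‖z.2‖ ≤ ‖z.1‖}.indicator (fun z =>
          (G z.2 ^ q * ‖z.2‖ₑ ^ (n * (q - 3 / 2))) * ‖z.1‖ₑ ^ (-(3 * n / 2))) (ξ, η) =
          Ψ ‖ξ‖ * ‖ξ‖ₑ ^ (-(3 * n / 2)) := by
        rw [hΨ]
        dsimp only
        rw [← lintegral_mul_const _ (by fun_prop), ← lintegral_indicator
          Metric.isClosed_closedBall.measurableSet]
        congr 1; ext η
        simp [Set.indicator]
      rw [h2, hW]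
      dsimp only
      rw [ENNReal.mul_rpow_of_nonneg _ _ hq0.le, ENNReal.mul_rpow_of_nonneg _ _ hq0.le,
        ← ENNReal.rpow_mul, ← ENNReal.rpow_mul, one_div_mul_cancel hq0.ne', ENNReal.rpow_one]
      have : ‖ξ‖ₑ ^ (-(3 * n / 2)) = ‖ξ‖ₑ ^ (n / (2 * q) * q) * ‖ξ‖ₑ ^ (-(2 * n)) := by
        rw [enorm_rpow_mul_rpow hξ]; congr 1; field_simp; ring
      rw [this]; ring
    have hSm : MeasurableSet {z : V × V | ‖z.2‖ ≤ ‖z.1‖} :=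
      measurableSet_le (by fun_prop) (by fun_prop)
    rw [lintegral_congr_ae h1, lintegral_const_mul', lintegral_lintegral_swap]
    rotate_left
    · exact (Measurable.indicator (by fun_prop) hSm).aemeasurable
    · simp [hq0.le]
    rw [← lintegral_const_mul' _ _ (by simp [hq0.le]), ← lintegral_const_mul' _ _ ENNReal.coe_ne_top]
    refine lintegral_mono_ae ?_
    filter_upwards [ae_ne_zero] with η hη
    have h3 : ∫⁻ ξ, {z : V × V | ‖z.2‖ ≤ ‖z.1‖}.indicator (fun z =>
        (G z.2 ^ q * ‖z.2‖ₑ ^ (n * (q - 3 / 2))) * ‖z.1‖ₑ ^ (-(3 * n / 2))) (ξ, η) =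
        (G η ^ q * ‖η‖ₑ ^ (n * (q - 3 / 2))) *
          ∫⁻ ξ in {ξ : V | ‖η‖ ≤ ‖ξ‖}, ‖ξ‖ₑ ^ (-(3 * n / 2)) := by
      rw [← lintegral_const_mul _ (by fun_prop), ← lintegral_indicator
          (measurableSet_le (by fun_prop) (by fun_prop))]
      rfl
    rw [h3]
    grw [hC2 ‖η‖ (norm_pos_iff.2 hη)]
    rw [← hn, ofReal_norm]
    have : ‖η‖ₑ ^ (n * (q - 2)) = ‖η‖ₑ ^ (n * (q - 3 / 2)) * ‖η‖ₑ ^ (-(3 * n / 2) + n) := by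
      rw [enorm_rpow_mul_rpow hη]; congr 1; ring
    rw [this, ENNReal.coe_mul, ENNReal.coe_rpow_of_nonneg _ hq0.le]
    apply le_of_eq; ring
  refine (lintegral_rpow_le_of_sublevel g hq hWm ?_).trans ?_
  · intro t ht
    refine setLIntegral_le_of_closedBall_le fun ξ hξ => ?_
    have h := hC1 G hGm ‖ξ‖ (norm_nonneg _)
    rw [ofReal_norm] at h
    exact h.trans hξ
  rw [ENNReal.coe_mul, mul_assoc]
  gcongr ?_ * ?_
  · exact le_rfl
  set I := ∫⁻ ξ, G ξ ^ q * ‖ξ‖ₑ ^ (n * (q - 2)) with hI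
  have hconj : (q / 2).HolderConjugate (q / (q - 2)) := by
    have h := Real.HolderConjugate.conjExponent (p := q / 2) (by linarith)
    have h2 : Real.conjExponent (q / 2) = q / (q - 2) := by
      rw [Real.conjExponent]; 
      have : q - 2 ≠ 0 := by linarith
      field_simp
    rwa [h2] at h
  have hq2 : q - 2 ≠ 0 := by linarith
  have hq2' : 0 < q - 2 := by linarith
  calc ∫⁻ ξ, G ξ ^ (2 : ℝ) * W ξ ^ (q - 2)
      ≤ ∫⁻ ξ, (fun ξ => G ξ ^ (2 : ℝ) * ‖ξ‖ₑ ^ (2 * n * (q - 2) / q)) ξ *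
          (fun ξ => W ξ ^ (q - 2) * ‖ξ‖ₑ ^ (-(2 * n * (q - 2) / q))) ξ := by
        refine lintegral_mono_ae ?_
        filter_upwards [ae_ne_zero] with ξ hξ
        have : G ξ ^ (2 : ℝ) * ‖ξ‖ₑ ^ (2 * n * (q - 2) / q) *
            (W ξ ^ (q - 2) * ‖ξ‖ₑ ^ (-(2 * n * (q - 2) / q))) = G ξ ^ (2 : ℝ) * W ξ ^ (q - 2) *
            (‖ξ‖ₑ ^ (2 * n * (q - 2) / q) * ‖ξ‖ₑ ^ (-(2 * n * (q - 2) / q))) := by ring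
        rw [this, enorm_rpow_mul_rpow hξ]; simp
    _ ≤ (∫⁻ ξ, (G ξ ^ (2 : ℝ) * ‖ξ‖ₑ ^ (2 * n * (q - 2) / q)) ^ (q / 2)) ^ (1 / (q / 2)) *
        (∫⁻ ξ, (W ξ ^ (q - 2) * ‖ξ‖ₑ ^ (-(2 * n * (q - 2) / q))) ^ (q / (q - 2))) ^
          (1 / (q / (q - 2))) :=
        ENNReal.lintegral_mul_le_Lp_mul_Lq _ hconj (by fun_prop) (by fun_prop)
    _ = I ^ (2 / q) * (∫⁻ ξ, W ξ ^ q * ‖ξ‖ₑ ^ (-(2 * n))) ^ ((q - 2) / q) := by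
        congr 2
        · congr 1; ext ξ
          rw [ENNReal.mul_rpow_of_nonneg _ _ (by positivity), ← ENNReal.rpow_mul,
            ← ENNReal.rpow_mul]
          congr 2 <;> field_simp
        · field_simp
        · congr 1; ext ξ
          rw [ENNReal.mul_rpow_of_nonneg _ _ (by positivity), ← ENNReal.rpow_mul,
            ← ENNReal.rpow_mul]
          congr 2 <;> field_simp
        · field_simp
    _ ≤ I ^ (2 / q) * ((C1 ^ q * C2 : NNReal) * I) ^ ((q - 2) / q) := by grw [hWq]
    _ = _ := by
        rw [ENNReal.mul_rpow_of_nonneg _ _ (by positivity),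
          ENNReal.coe_rpow_of_nonneg _ (by positivity), mul_left_comm,
          ← ENNReal.rpow_add_of_nonneg _ _ (by positivity) (by positivity)]
        have : 2 / q + (q - 2) / q = 1 := by field_simp; ring
        rw [this, ENNReal.rpow_one]
end

section
variable {V : Type*} [NormedAddCommGroup V] [InnerProductSpace ℝ V] [FiniteDimensional ℝ V]
  [MeasurableSpace V] [BorelSpace V]

lemma norm_fourier_comp_add_sub_le (f : 𝓢(V, ℂ)) (h ξ : V) :
    ‖𝓕 (fun y => f (y + h) - f y) ξ‖ ≤ 2 * Real.pi * min 1 (‖h‖ * ‖ξ‖) * ‖𝓕 (⇑f) ξ‖ := by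
  have h0 : 𝓕 (fun y => f (y + h) - f y) ξ =
      𝓕 (fun y => f (y + h)) ξ - 𝓕 (⇑f) ξ := by
    rw [Real.fourier_eq, Real.fourier_eq, Real.fourier_eq, ← integral_sub]
    · simp only [smul_sub]
    · rw [Real.fourierIntegral_convergent_iff]
      exact f.integrable.comp_add_right h
    · rw [Real.fourierIntegral_convergent_iff]
      exact f.integrable
  have h1 : 𝓕 (fun y => f (y + h)) ξ = Real.fourierChar (inner ℝ h ξ) • 𝓕 (⇑f) ξ := by
    have := congrFun (VectorFourier.fourierIntegral_comp_add_right Real.fourierChar volume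
      (innerₗ V) (⇑f) h) ξ
    exact this
  have h2 : ‖((Real.fourierChar (inner ℝ h ξ) : Circle) : ℂ) - 1‖ ≤
      2 * Real.pi * min 1 (‖h‖ * ‖ξ‖) := by
    rw [mul_min_of_nonneg _ _ (by positivity)]
    refine le_min ?_ ?_
    · calc _ ≤ ‖((Real.fourierChar (inner ℝ h ξ) : Circle) : ℂ)‖ + ‖(1 : ℂ)‖ := norm_sub_le _ _
        _ ≤ 2 * Real.pi * 1 := by
          rw [Circle.norm_coe, norm_one]; linarith [Real.pi_gt_three]
    · rw [Real.fourierChar_apply]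
      have := Real.norm_exp_I_mul_ofReal_sub_one_le (x := 2 * Real.pi * inner ℝ h ξ)
      rw [mul_comm Complex.I] at this
      refine this.trans ?_
      rw [norm_mul, Real.norm_of_nonneg (by positivity)]
      gcongr
      exact norm_inner_le_norm _ _
  rw [h0, h1, Circle.smul_def, smul_eq_mul, ← sub_one_mul, norm_mul]
  gcongr

/-- Iterated differences of a Schwartz function. -/
lemma exists_iterate_fwdDiff (f : 𝓢(V, ℂ)) (h : V) (M : ℕ) :
    ∃ g : 𝓢(V, ℂ), (∀ y, g y = (fwdDiff h)^[M] (⇑f) y) ∧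
      ∀ ξ, ‖𝓕 (⇑g) ξ‖ ≤ (2 * Real.pi * min 1 (‖h‖ * ‖ξ‖)) ^ M * ‖𝓕 (⇑f) ξ‖ := by
  induction M with
  | zero => exact ⟨f, by simp⟩
  | succ M ih =>
    obtain ⟨g, hg, hgF⟩ := ih
    refine ⟨SchwartzMap.compSubConstCLM ℂ (-h) g - g, fun y => ?_, fun ξ => ?_⟩
    · rw [Function.iterate_succ_apply']
      simp [fwdDiff, hg]
    · have : ⇑(SchwartzMap.compSubConstCLM ℂ (-h) g - g) = fun y => g (y + h) - g y := by
        ext y; simp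
      rw [this, pow_succ']
      refine (norm_fourier_comp_add_sub_le g h ξ).trans ?_
      rw [mul_assoc (2 * Real.pi * min 1 (‖h‖ * ‖ξ‖))]
      gcongr
      exact hgF ξ

/-- A function is controlled by its iterated difference near the origin and its values away
from the origin. -/
lemma exists_localization [Nontrivial V] (f : 𝓢(V, ℂ)) {δ : ℝ} (hδ : 0 < δ) (M : ℕ) :
    ∃ g : 𝓢(V, ℂ),
      (∀ ξ, ‖𝓕 (⇑g) ξ‖ ≤ (4 * Real.pi) ^ M * min 1 (δ * ‖ξ‖) ^ M * ‖𝓕 (⇑f) ξ‖) ∧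
      ∀ q : ℝ≥0∞, 1 ≤ q → eLpNorm f q volume ≤
        eLpNorm g q (volume.restrict (Metric.ball 0 δ)) +
          2 ^ M * eLpNorm f q (volume.restrict (Metric.ball 0 δ)ᶜ) := by
  obtain ⟨h, hh⟩ := exists_norm_eq V (show 0 ≤ 2 * δ by positivity)
  obtain ⟨g, hg, hgF⟩ := exists_iterate_fwdDiff f h M
  refine ⟨g, fun ξ => (hgF ξ).trans ?_, fun q hq => ?_⟩
  · rw [← mul_pow, hh]
    gcongr ?_ ^ M * _
    rw [mul_min_of_nonneg _ _ (by positivity), mul_min_of_nonneg _ _ (by positivity)]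
    refine min_le_min ?_ (le_of_eq (by ring))
    nlinarith [Real.pi_pos]
  set F : V → ℂ := (Metric.ball 0 δ)ᶜ.indicator f with hF
  have hm : MeasurableSet (Metric.ball (0 : V) δ) := measurableSet_ball
  have hFm : AEStronglyMeasurable F volume :=
    f.continuous.aestronglyMeasurable.indicator hm.compl
  have hmp (k : ℕ) : MeasurePreserving (fun y : V => y + k • h) volume volume :=
    measurePreserving_add_right _ _
  have hpt (y : V) : ‖f y‖ ≤ ‖(fun y => ‖(Metric.ball 0 δ).indicator g y‖ +
      (∑ k ∈ Finset.range (M + 1), fun y => (M.choose k : ℝ) * ‖F (y + k • h)‖) y) y‖ := by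
    have hnn : 0 ≤ ∑ k ∈ Finset.range (M + 1), (M.choose k : ℝ) * ‖F (y + k • h)‖ :=
      Finset.sum_nonneg fun _ _ => by positivity
    simp only [Finset.sum_apply]
    rw [Real.norm_of_nonneg (by positivity)]
    by_cases hy : y ∈ Metric.ball 0 δ
    · have hk (k : ℕ) : F (y + (k + 1) • h) = f (y + (k + 1) • h) := by
        rw [hF, Set.indicator_of_mem]
        simp only [Set.mem_compl_iff, Metric.mem_ball, dist_zero_right, not_lt] at hy ⊢
        have h1 : ‖(k + 1) • h‖ ≤ ‖y + (k + 1) • h‖ + ‖y‖ := by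
          simpa using norm_sub_le (y + (k + 1) • h) y
        rw [← Nat.cast_smul_eq_nsmul ℝ, norm_smul, hh] at h1
        simp only [Real.norm_natCast] at h1
        push_cast at h1
        rw [← Nat.cast_smul_eq_nsmul ℝ]
        push_cast
        nlinarith
      have h2 := hg y
      rw [fwdDiff_iter_eq_sum_shift, Finset.sum_range_succ'] at h2
      have h3 : ‖f y‖ ≤ ‖g y‖ + ‖∑ k ∈ Finset.range M,
          ((-1 : ℤ) ^ (M - (k + 1)) * (M.choose (k + 1))) • f (y + (k + 1) • h)‖ := by
        have h4 : ((-1 : ℤ) ^ (M - 0) * (M.choose 0)) • f (y + 0 • h) = g y -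
            ∑ k ∈ Finset.range M,
            ((-1 : ℤ) ^ (M - (k + 1)) * (M.choose (k + 1))) • f (y + (k + 1) • h) := by
          rw [h2]; ring
        have h5 : ‖f y‖ = ‖((-1 : ℤ) ^ (M - 0) * (M.choose 0)) • f (y + 0 • h)‖ := by simp
        rw [h5, h4]
        exact norm_sub_le _ _
      rw [Set.indicator_of_mem hy, Finset.sum_range_succ']
      refine h3.trans ?_
      gcongr
      refine (norm_sum_le _ _).trans ?_
      have : 0 ≤ (M.choose 0 : ℝ) * ‖F (y + 0 • h)‖ := by positivity
      refine le_trans (le_of_eq ?_) (le_add_of_nonneg_right this)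
      refine Finset.sum_congr rfl fun k _ => ?_
      rw [hk]
      simp
    · have : ‖f y‖ = (M.choose 0 : ℝ) * ‖F (y + 0 • h)‖ := by
        have : y ∈ (Metric.ball 0 δ)ᶜ := hy
        simp [hF, this]
      rw [this]
      refine le_trans ?_ (le_add_of_nonneg_left (norm_nonneg _))
      exact Finset.single_le_sum (f := fun k => (M.choose k : ℝ) * ‖F (y + k • h)‖)
        (fun _ _ => by positivity) (by simp)
  have hFk (k : ℕ) : AEStronglyMeasurable (fun y => F (y + k • h)) volume :=
    hFm.comp_measurePreserving (hmp k)
  calc eLpNorm f q volume ≤ eLpNorm (fun y => ‖(Metric.ball 0 δ).indicator g y‖ +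
      (∑ k ∈ Finset.range (M + 1), fun y => (M.choose k : ℝ) * ‖F (y + k • h)‖) y) q volume :=
        eLpNorm_mono hpt
    _ ≤ eLpNorm (fun y => ‖(Metric.ball 0 δ).indicator g y‖) q volume +
        eLpNorm (∑ k ∈ Finset.range (M + 1), fun y => (M.choose k : ℝ) * ‖F (y + k • h)‖)
          q volume := by
        refine eLpNorm_add_le (g.continuous.aestronglyMeasurable.indicator hm).norm ?_ hq
        exact Finset.aestronglyMeasurable_sum _ fun k _ => (hFk k).norm.const_mul _
    _ ≤ eLpNorm (fun y => ‖(Metric.ball 0 δ).indicator g y‖) q volume +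
        ∑ k ∈ Finset.range (M + 1), eLpNorm (fun y => (M.choose k : ℝ) * ‖F (y + k • h)‖)
          q volume := by
        gcongr
        exact eLpNorm_sum_le (fun k _ => (hFk k).norm.const_mul _) hq
    _ = eLpNorm g q (volume.restrict (Metric.ball 0 δ)) +
        ∑ k ∈ Finset.range (M + 1), M.choose k * eLpNorm F q volume := by
        congr 1
        · rw [eLpNorm_norm, eLpNorm_indicator_eq_eLpNorm_restrict hm]
        · refine Finset.sum_congr rfl fun k _ => ?_
          have h6 := eLpNorm_const_smul (M.choose k : ℝ) (fun y => ‖F (y + k • h)‖) q volume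
          have h7 : ((M.choose k : ℝ) • fun y => ‖F (y + k • h)‖) =
            fun y => (M.choose k : ℝ) * ‖F (y + k • h)‖ := rfl
          rw [h7] at h6
          rw [h6, eLpNorm_norm]
          have h8 := eLpNorm_comp_measurePreserving (p := q) hFm (hmp k)
          have h9 : (F ∘ fun y => y + k • h) = fun y => F (y + k • h) := rfl
          rw [h9] at h8
          rw [h8]
          congr 1
          simp
    _ = _ := by
        congr 1
        rw [← Finset.sum_mul, eLpNorm_indicator_eq_eLpNorm_restrict hm.compl]
        congr 1
        exact_mod_cast Nat.sum_range_choose M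
end

section
/-- Integrals of broken powers against a truncated dilated power. -/
lemma exists_lintegral_broken_rpow_le (V : Type*) [NormedAddCommGroup V]
    [InnerProductSpace ℝ V] [FiniteDimensional ℝ V] [MeasurableSpace V] [BorelSpace V]
    [Nontrivial V] {n a₁ a₂ κ : ℝ} (hn : n = Module.finrank ℝ V) (ha₂ : a₂ + n < 0)
    (hκ₁ : 0 < κ + a₁ + n) (hκ₂ : 0 < κ + a₂ + n) (hκ : 0 < κ) :
    ∃ C : NNReal, ∀ δ : ℝ, 0 < δ →
      (δ ≤ 1 → ∫⁻ ξ : V, (if ‖ξ‖ < 1 then ‖ξ‖ₑ ^ a₁ else ‖ξ‖ₑ ^ a₂) *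
        min 1 (ENNReal.ofReal δ * ‖ξ‖ₑ) ^ κ ≤ C * ENNReal.ofReal (δ ^ (-(a₂ + n)))) ∧
      (1 ≤ δ → ∫⁻ ξ : V, (if ‖ξ‖ < 1 then ‖ξ‖ₑ ^ a₁ else ‖ξ‖ₑ ^ a₂) *
        min 1 (ENNReal.ofReal δ * ‖ξ‖ₑ) ^ κ ≤ C * ENNReal.ofReal
          (if a₁ + n = 0 then 1 + Real.log δ else δ ^ max (-(a₁ + n)) 0)) := by
  obtain ⟨C₁, hC₁⟩ := exists_setLIntegral_closedBall_enorm_rpow_le V (a := κ + a₁)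
    (by rw [← hn]; exact hκ₁)
  obtain ⟨C₂, hC₂⟩ := exists_setLIntegral_closedBall_enorm_rpow_le V (a := κ + a₂)
    (by rw [← hn]; exact hκ₂)
  obtain ⟨C₃, hC₃⟩ := exists_setLIntegral_compl_ball_enorm_rpow_le V (a := a₂)
    (by rw [← hn]; exact ha₂)
  rw [← hn] at hC₁ hC₂ hC₃
  obtain ⟨C₄, hC₄⟩ : ∃ C : NNReal, ∀ δ : ℝ, 1 ≤ δ →
      ∫⁻ ξ : V in norm ⁻¹' (Set.Ioc δ⁻¹ 1), ‖ξ‖ₑ ^ a₁ ≤ C * ENNReal.ofReal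
        (if a₁ + n = 0 then 1 + Real.log δ else δ ^ max (-(a₁ + n)) 0) := by
    rcases lt_trichotomy (a₁ + n) 0 with h | h | h
    · obtain ⟨C, hC⟩ := exists_setLIntegral_compl_ball_enorm_rpow_le V (a := a₁)
        (by rw [← hn]; exact h)
      refine ⟨C, fun δ hδ => ?_⟩
      have hδ0 : 0 < δ := by linarith
      rw [if_neg h.ne, max_eq_left (by linarith)]
      refine (lintegral_mono_set fun x hx => ?_).trans ((hC δ⁻¹ (by positivity)).trans ?_)
      · exact hx.1.le
      · rw [← hn, ENNReal.ofReal_rpow_of_pos (by positivity), Real.inv_rpow hδ0.le,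
          ← Real.rpow_neg hδ0.le]
    · obtain ⟨C, hC⟩ := exists_setLIntegral_annulus_le V
      refine ⟨C, fun δ hδ => ?_⟩
      have hδ0 : 0 < δ := by linarith
      rw [if_pos h]
      have := hC δ⁻¹ (by positivity) (inv_le_one_of_one_le₀ hδ)
      rw [← hn, inv_inv, ← eq_neg_of_add_eq_zero_left h] at this
      refine this.trans ?_
      gcongr
      linarith
    · obtain ⟨C, hC⟩ := exists_setLIntegral_closedBall_enorm_rpow_le V (a := a₁)
        (by rw [← hn]; exact h)
      refine ⟨C, fun δ hδ => ?_⟩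
      rw [if_neg h.ne', max_eq_right (by linarith)]
      refine (lintegral_mono_set fun x hx => ?_).trans ((hC 1 (by positivity)).trans ?_)
      · simpa using hx.2
      · simp
  refine ⟨C₁ + C₂ + C₃ + C₄, fun δ hδ => ⟨fun hδ1 => ?_, fun hδ1 => ?_⟩⟩
  · set D := ENNReal.ofReal δ with hD
    have hD0 : D ≠ 0 := by simpa [hD] using hδ
    have hDt : D ≠ ⊤ := by simp [hD]
    have hD1 : D ≤ 1 := by simpa [hD] using hδ1
    rw [← ENNReal.ofReal_rpow_of_pos hδ, ← hD]
    have hpt : ∀ᵐ ξ : V, (if ‖ξ‖ < 1 then ‖ξ‖ₑ ^ a₁ else ‖ξ‖ₑ ^ a₂) * min 1 (D * ‖ξ‖ₑ) ^ κ ≤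
        D ^ κ * (Metric.closedBall 0 1).indicator (fun ξ => ‖ξ‖ₑ ^ (κ + a₁)) ξ +
        D ^ κ * (Metric.closedBall 0 δ⁻¹).indicator (fun ξ => ‖ξ‖ₑ ^ (κ + a₂)) ξ +
        {ξ | δ⁻¹ ≤ ‖ξ‖}.indicator (fun ξ => ‖ξ‖ₑ ^ a₂) ξ := by
      filter_upwards [ae_ne_zero] with ξ hξ
      have key (a : ℝ) : ‖ξ‖ₑ ^ a * min 1 (D * ‖ξ‖ₑ) ^ κ ≤ D ^ κ * ‖ξ‖ₑ ^ (κ + a) := by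
        grw [min_le_right]
        rw [ENNReal.mul_rpow_of_nonneg _ _ hκ.le, ← enorm_rpow_mul_rpow hξ]
        apply le_of_eq; ring
      by_cases h1 : ‖ξ‖ < 1
      · rw [if_pos h1, Set.indicator_of_mem (by simpa using h1.le), add_assoc]
        exact (key a₁).trans le_self_add
      · rw [if_neg h1]
        by_cases h2 : ‖ξ‖ ≤ δ⁻¹
        · rw [Set.indicator_of_mem (s := Metric.closedBall 0 δ⁻¹) (by simpa using h2)]
          exact (key a₂).trans (le_add_self.trans le_self_add)
        · rw [Set.indicator_of_mem (s := {ξ | δ⁻¹ ≤ ‖ξ‖}) (show δ⁻¹ ≤ ‖ξ‖ by linarith)]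
          refine le_trans ?_ le_add_self
          grw [min_le_left]; simp
    refine (lintegral_mono_ae hpt).trans ?_
    have hm : MeasurableSet {ξ : V | δ⁻¹ ≤ ‖ξ‖} := measurableSet_le (by fun_prop) (by fun_prop)
    rw [lintegral_add_right _ (Measurable.indicator (by fun_prop) hm),
      lintegral_add_right _ ((Measurable.indicator (by fun_prop)
        measurableSet_closedBall).const_mul _),
      lintegral_const_mul _ (Measurable.indicator (by fun_prop) measurableSet_closedBall),
      lintegral_const_mul _ (Measurable.indicator (by fun_prop) measurableSet_closedBall),
      lintegral_indicator measurableSet_closedBall, lintegral_indicator measurableSet_closedBall,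
      lintegral_indicator hm]
    grw [hC₁ 1 zero_le_one, hC₂ δ⁻¹ (by positivity), hC₃ δ⁻¹ (by positivity)]
    rw [ENNReal.ofReal_inv_of_pos hδ, ← hD, ENNReal.ofReal_one, ENNReal.one_rpow,
      ENNReal.inv_rpow, ENNReal.inv_rpow, ← ENNReal.rpow_neg, ← ENNReal.rpow_neg]
    have e1 : D ^ κ ≤ D ^ (-(a₂ + n)) :=
      ENNReal.rpow_le_rpow_of_exponent_ge hD1 (by linarith)
    have e2 : D ^ κ * D ^ (-(κ + a₂ + n)) = D ^ (-(a₂ + n)) := by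
      rw [← ENNReal.rpow_add _ _ hD0 hDt]; congr 1; ring
    calc D ^ κ * (C₁ * 1) + D ^ κ * (C₂ * D ^ (-(κ + a₂ + n))) + C₃ * D ^ (-(a₂ + n))
        ≤ D ^ (-(a₂ + n)) * (C₁ * 1) + C₂ * (D ^ κ * D ^ (-(κ + a₂ + n))) +
          C₃ * D ^ (-(a₂ + n)) := by
          gcongr ?_ * _ + ?_ + _
          apply le_of_eq; ring
      _ = (C₁ + C₂ + C₃ : NNReal) * D ^ (-(a₂ + n)) := by rw [e2]; push_cast; ring
      _ ≤ _ := by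
        gcongr ?_ * _
        exact_mod_cast (le_self_add : C₁ + C₂ + C₃ ≤ C₁ + C₂ + C₃ + C₄)
  · set D := ENNReal.ofReal δ with hD
    have hD0 : D ≠ 0 := by simpa [hD] using hδ
    have hDt : D ≠ ⊤ := by simp [hD]
    set X := ENNReal.ofReal (if a₁ + n = 0 then 1 + Real.log δ else δ ^ max (-(a₁ + n)) 0)
      with hX
    have hlog := Real.log_nonneg hδ1
    have hX1 : 1 ≤ X := by
      rw [hX, ENNReal.one_le_ofReal]
      split_ifs
      · linarith
      · exact Real.one_le_rpow hδ1 (le_max_right _ _)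
    have hX2 : D ^ (-(a₁ + n)) ≤ X := by
      rw [hX, hD, ENNReal.ofReal_rpow_of_pos hδ]
      apply ENNReal.ofReal_le_ofReal
      split_ifs with h
      · simp [h, hlog]
      · exact Real.rpow_le_rpow_of_exponent_le hδ1 (le_max_left _ _)
    have hpt : ∀ᵐ ξ : V, (if ‖ξ‖ < 1 then ‖ξ‖ₑ ^ a₁ else ‖ξ‖ₑ ^ a₂) * min 1 (D * ‖ξ‖ₑ) ^ κ ≤
        D ^ κ * (Metric.closedBall 0 δ⁻¹).indicator (fun ξ => ‖ξ‖ₑ ^ (κ + a₁)) ξ +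
        (norm ⁻¹' (Set.Ioc δ⁻¹ 1)).indicator (fun ξ => ‖ξ‖ₑ ^ a₁) ξ +
        {ξ | 1 ≤ ‖ξ‖}.indicator (fun ξ => ‖ξ‖ₑ ^ a₂) ξ := by
      filter_upwards [ae_ne_zero] with ξ hξ
      by_cases h1 : ‖ξ‖ < 1
      · rw [if_pos h1]
        by_cases h2 : ‖ξ‖ ≤ δ⁻¹
        · rw [Set.indicator_of_mem (s := Metric.closedBall 0 δ⁻¹) (by simpa using h2), add_assoc]
          refine le_trans ?_ le_self_add
          grw [min_le_right]
          rw [ENNReal.mul_rpow_of_nonneg _ _ hκ.le, ← enorm_rpow_mul_rpow hξ]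
          apply le_of_eq; ring
        · rw [Set.indicator_of_mem (s := norm ⁻¹' (Set.Ioc δ⁻¹ 1)) ⟨not_le.1 h2, h1.le⟩]
          refine le_trans ?_ (le_add_self.trans le_self_add)
          grw [min_le_left]; simp
      · rw [if_neg h1, Set.indicator_of_mem (s := {ξ | 1 ≤ ‖ξ‖}) (not_lt.1 h1)]
        refine le_trans ?_ le_add_self
        grw [min_le_left]; simp
    refine (lintegral_mono_ae hpt).trans ?_
    have hm : MeasurableSet {ξ : V | 1 ≤ ‖ξ‖} := measurableSet_le (by fun_prop) (by fun_prop)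
    have hm' : MeasurableSet (norm ⁻¹' (Set.Ioc δ⁻¹ 1) : Set V) :=
      measurable_norm measurableSet_Ioc
    rw [lintegral_add_right _ (Measurable.indicator (by fun_prop) hm),
      lintegral_add_right _ (Measurable.indicator (by fun_prop) hm'),
      lintegral_const_mul _ (Measurable.indicator (by fun_prop) measurableSet_closedBall),
      lintegral_indicator measurableSet_closedBall, lintegral_indicator hm',
      lintegral_indicator hm]
    grw [hC₁ δ⁻¹ (by positivity), hC₄ δ hδ1, hC₃ 1 one_pos]
    rw [ENNReal.ofReal_inv_of_pos hδ, ← hD, ENNReal.ofReal_one, ENNReal.one_rpow,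
      ENNReal.inv_rpow, ← ENNReal.rpow_neg]
    have e2 : D ^ κ * D ^ (-(κ + a₁ + n)) = D ^ (-(a₁ + n)) := by
      rw [← ENNReal.rpow_add _ _ hD0 hDt]; congr 1; ring
    calc D ^ κ * (C₁ * D ^ (-(κ + a₁ + n))) + C₄ * X + C₃ * 1
        ≤ C₁ * (D ^ κ * D ^ (-(κ + a₁ + n))) + C₄ * X + C₃ * X := by
          gcongr ?_ + _ + _ * ?_
          exact le_of_eq (mul_left_comm _ _ _)
      _ ≤ C₁ * X + C₄ * X + C₃ * X := by rw [e2]; gcongr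
      _ = (C₁ + C₃ + C₄ : NNReal) * X := by push_cast; ring
      _ ≤ _ := by
        gcongr ?_ * _
        have : C₁ + C₃ + C₄ ≤ C₁ + C₂ + C₃ + C₄ := by gcongr; exact le_self_add
        exact_mod_cast this
end

section
variable {d : ℕ}

lemma brokenWeight_nonneg (A : ℝ × ℝ) (x : EuclideanSpace ℝ (Fin d)) : 0 ≤ brokenWeight A x := by
  unfold brokenWeight; split_ifs <;> positivity

lemma measurable_brokenWeight (A : ℝ × ℝ) :
    Measurable (brokenWeight A : EuclideanSpace ℝ (Fin d) → ℝ) :=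
  Measurable.ite (measurableSet_lt (by fun_prop) (by fun_prop)) (by fun_prop) (by fun_prop)

lemma aestronglyMeasurable_brokenWeight_mul (A : ℝ × ℝ) {f : EuclideanSpace ℝ (Fin d) → ℂ}
    (hf : Continuous f) : AEStronglyMeasurable (fun y => brokenWeight A y * ‖f y‖) volume :=
  ((measurable_brokenWeight A).mul hf.norm.measurable).aestronglyMeasurable

lemma continuous_fourier (f : 𝓢(EuclideanSpace ℝ (Fin d), ℂ)) : Continuous (𝓕 (⇑f)) := by
  rw [← SchwartzMap.fourier_coe]; exact SchwartzMap.continuous _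

/-- A weight evaluated away from the ball of radius `δ` dominates its scale at `δ`. -/
lemma eLpNorm_compl_ball_le {A : ℝ × ℝ} {a δ : ℝ} (hA1 : 0 ≤ A.1) (hA2 : 0 ≤ A.2) (hδ : 0 < δ)
    (ha : (δ ≤ 1 ∧ a = A.1) ∨ (1 ≤ δ ∧ a = A.2)) (f : EuclideanSpace ℝ (Fin d) → ℂ)
    (q : ℝ≥0∞) :
    eLpNorm f q (volume.restrict (Metric.ball 0 δ)ᶜ) ≤
      ENNReal.ofReal (δ ^ (-a)) * eLpNorm (fun y => brokenWeight A y * ‖f y‖) q volume := by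
  refine (eLpNorm_le_mul_eLpNorm_of_ae_le_mul (g := fun y => brokenWeight A y * ‖f y‖)
    (c := δ ^ (-a)) ?_ q).trans ?_
  · filter_upwards [ae_restrict_mem measurableSet_ball.compl] with y hy
    have hy : δ ≤ ‖y‖ := by simpa using hy
    have hw : δ ^ a ≤ brokenWeight A y := by
      unfold brokenWeight
      rcases ha with ⟨h, rfl⟩ | ⟨h, rfl⟩
      · split_ifs with h1
        · gcongr
        · exact (Real.rpow_le_one hδ.le h hA1).trans (Real.one_le_rpow (not_lt.1 h1) hA2)
      · rw [if_neg (by linarith)]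
        gcongr
    rw [Real.norm_of_nonneg (mul_nonneg (brokenWeight_nonneg _ _) (norm_nonneg _)), ← mul_assoc]
    refine le_mul_of_one_le_left (norm_nonneg _) ?_
    rw [Real.rpow_neg hδ.le]
    rw [inv_mul_eq_div, one_le_div (by positivity)]
    exact hw
  · gcongr
    exact Measure.restrict_le_self

/-- The growth rate of the local part at scale `δ ≥ 1`. -/
noncomputable def localRate (m s δ : ℝ) : ℝ :=
  if m = 0 then (1 + Real.log δ) ^ s else δ ^ max m 0

/-- The bound on the local part, Hardy–Littlewood–Paley range. -/
lemma exists_eLpNorm_le_of_two_le [Nontrivial (EuclideanSpace ℝ (Fin d))] {p q : ℝ≥0∞}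
    (hq2 : 2 ≤ q) (hqp : q < p) {B : ℝ × ℝ} {m₁ m₂ : ℝ}
    (hm₁ : m₁ = B.1 + (d : ℝ) * ((1/p).toReal + (1/q).toReal - 1))
    (hm₂ : m₂ = B.2 + (d : ℝ) * ((1/p).toReal + (1/q).toReal - 1)) (hm₂0 : 0 < m₂) :
    ∃ (M : ℕ) (C : NNReal), ∀ δ : ℝ, 0 < δ → ∀ f g : 𝓢(EuclideanSpace ℝ (Fin d), ℂ),
      (∀ ξ, ‖𝓕 (⇑g) ξ‖ ≤ (4 * Real.pi) ^ M * min 1 (δ * ‖ξ‖) ^ M * ‖𝓕 (⇑f) ξ‖) →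
      (δ ≤ 1 → eLpNorm g q (volume.restrict (Metric.ball 0 δ)) ≤ C * ENNReal.ofReal (δ ^ m₂) *
        eLpNorm (fun ξ => brokenWeight B ξ * ‖𝓕 (⇑f) ξ‖) p volume) ∧
      (1 ≤ δ → eLpNorm g q (volume.restrict (Metric.ball 0 δ)) ≤
        C * ENNReal.ofReal (localRate m₁ ((1/q).toReal - (1/p).toReal) δ) *
        eLpNorm (fun ξ => brokenWeight B ξ * ‖𝓕 (⇑f) ξ‖) p volume) := by
  have hqt : q ≠ ⊤ := hqp.ne_top
  have hq0 : q ≠ 0 := by rintro rfl; simp at hq2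
  have hp0 : p ≠ 0 := (hqp.trans_le' (zero_le)).ne'
  have hQ2 : 2 ≤ q.toReal := by
    have := ENNReal.toReal_mono hqt hq2
    simpa using this
  have hinv : (1/p).toReal < (1/q).toReal := by
    rw [ENNReal.toReal_lt_toReal (by simp [hp0]) (by simp [hq0])]
    simpa using hqp
  have hQi : (1/q).toReal = 1 / q.toReal := by simp
  rw [hQi] at hinv hm₁ hm₂ ⊢
  set Q := q.toReal with hQ
  set iP := (1/p).toReal with hiP
  have hQ0 : 0 < Q := by linarith
  set R : ℝ := (1 / Q - iP)⁻¹ with hR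
  have hRi : 1 / R = 1 / Q - iP := by rw [hR, one_div, inv_inv]
  have hR0 : 0 < R := by rw [hR, inv_pos]; linarith
  obtain ⟨M, hM⟩ := exists_nat_gt (max 0 (max m₁ m₂))
  simp only [max_lt_iff] at hM
  obtain ⟨hM0, hM1, hM2⟩ := hM
  set n : ℝ := (d : ℝ) with hn
  have hnf : n = Module.finrank ℝ (EuclideanSpace ℝ (Fin d)) := by simp [hn]
  set e : ℝ := n * (1 - 2 / Q) with he
  have hn0 : 0 ≤ n := by simp [hn]
  have he0 : 0 ≤ e := by
    have : 2 / Q ≤ 1 := by rw [div_le_one hQ0]; exact hQ2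
    have : 0 ≤ 1 - 2 / Q := by linarith
    positivity
  have hRQ : R * (1 / Q - iP) = 1 := by rw [hR]; exact inv_mul_cancel₀ (by linarith)
  have ha (b m : ℝ) (hm : m = b + n * (iP + 1 / Q - 1)) : R * (e - b) + n = -(R * m) := by
    rw [hm, he]
    linear_combination (-n) * hRQ
  have ha₁ := ha B.1 m₁ hm₁
  have ha₂ := ha B.2 m₂ hm₂
  obtain ⟨C, hC⟩ := exists_lintegral_broken_rpow_le (EuclideanSpace ℝ (Fin d))
    (a₁ := R * (e - B.1)) (a₂ := R * (e - B.2)) (κ := R * M) hnf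
    (by rw [ha₂]; have := mul_pos hR0 hm₂0; linarith)
    (by rw [add_assoc, ha₁]; nlinarith) (by rw [add_assoc, ha₂]; nlinarith) (by positivity)
  obtain ⟨CH, hCH⟩ := exists_hardy_littlewood_paley (EuclideanSpace ℝ (Fin d)) hQ2
  rw [← hnf] at hCH
  refine ⟨M, CH ^ (1 / Q) * ((4 * Real.pi) ^ M).toNNReal * C ^ (1 / R), fun δ hδ f g hfg => ?_⟩
  set u : EuclideanSpace ℝ (Fin d) → ℝ := fun ξ =>
    ‖ξ‖ ^ e * (brokenWeight B ξ)⁻¹ * min 1 (δ * ‖ξ‖) ^ M with hu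
  set v : EuclideanSpace ℝ (Fin d) → ℝ := fun ξ => brokenWeight B ξ * ‖𝓕 (⇑f) ξ‖ with hv
  have hvm : AEStronglyMeasurable v volume :=
    aestronglyMeasurable_brokenWeight_mul B (continuous_fourier f)
  have hum : Measurable u := by
    have := measurable_brokenWeight (d := d) B
    fun_prop
  have h1 : eLpNorm g q volume ≤ (CH ^ (1 / Q) : NNReal) *
      eLpNorm (fun ξ => ‖ξ‖ ^ e * ‖𝓕 (⇑g) ξ‖) q volume := by
    rw [eLpNorm_eq_lintegral_rpow_enorm_toReal hq0 hqt,
      eLpNorm_eq_lintegral_rpow_enorm_toReal hq0 hqt, ← hQ]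
    grw [hCH g]
    rw [ENNReal.mul_rpow_of_nonneg _ _ (by positivity), ENNReal.coe_rpow_of_nonneg _ (by positivity)]
    apply le_of_eq
    congr 3; ext ξ
    rw [enorm_mul, enorm_norm, Real.enorm_rpow_of_nonneg (norm_nonneg _) he0, enorm_norm,
      ENNReal.mul_rpow_of_nonneg _ _ hQ0.le, ← ENNReal.rpow_mul, mul_comm]
    congr 2
    rw [he]; field_simp
  have h2 : eLpNorm (fun ξ => ‖ξ‖ ^ e * ‖𝓕 (⇑g) ξ‖) q volume ≤
      ENNReal.ofReal ((4 * Real.pi) ^ M) * eLpNorm (u • v) q volume := by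
    refine eLpNorm_le_mul_eLpNorm_of_ae_le_mul ?_ q
    filter_upwards [ae_ne_zero] with ξ hξ
    have hξ0 : 0 < ‖ξ‖ := norm_pos_iff.2 hξ
    have hw : 0 < brokenWeight B ξ := by
      unfold brokenWeight; split_ifs <;> positivity
    have : (u • v) ξ = ‖ξ‖ ^ e * (min 1 (δ * ‖ξ‖) ^ M * ‖𝓕 (⇑f) ξ‖) := by
      simp only [hu, hv, Pi.smul_apply', smul_eq_mul]
      field_simp
    have hmin : 0 ≤ min 1 (δ * ‖ξ‖) := by positivity
    rw [this, Real.norm_of_nonneg (by positivity), Real.norm_of_nonneg (by positivity)]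
    grw [hfg ξ]
    apply le_of_eq; ring
  have hH : ENNReal.HolderTriple (ENNReal.ofReal R) p q := by
    constructor
    rw [← ENNReal.ofReal_inv_of_pos hR0, hR, inv_inv, ENNReal.ofReal_sub _ ENNReal.toReal_nonneg,
      ENNReal.ofReal_toReal (by simp [hp0]), ← hQi,
      ENNReal.ofReal_toReal (by simp [hq0]), one_div, one_div]
    exact tsub_add_cancel_of_le (ENNReal.inv_le_inv.2 hqp.le)
  have h3 : eLpNorm (u • v) q volume ≤ eLpNorm u (ENNReal.ofReal R) volume * eLpNorm v p volume :=
    eLpNorm_smul_le_mul_eLpNorm hvm hum.aestronglyMeasurable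
  have h4 : eLpNorm u (ENNReal.ofReal R) volume =
      (∫⁻ ξ : EuclideanSpace ℝ (Fin d),
        (if ‖ξ‖ < 1 then ‖ξ‖ₑ ^ (R * (e - B.1)) else ‖ξ‖ₑ ^ (R * (e - B.2))) *
        min 1 (ENNReal.ofReal δ * ‖ξ‖ₑ) ^ (R * M)) ^ (1 / R) := by
    rw [eLpNorm_eq_lintegral_rpow_enorm_toReal (by simpa using hR0) (by simp),
      ENNReal.toReal_ofReal hR0.le]
    congr 1
    refine lintegral_congr_ae ?_
    filter_upwards [ae_ne_zero] with ξ hξ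
    have hξ0 : 0 < ‖ξ‖ := norm_pos_iff.2 hξ
    have hmin : 0 < min 1 (δ * ‖ξ‖) := by positivity
    have key (b : ℝ) : ‖‖ξ‖ ^ e * (‖ξ‖ ^ b)⁻¹ * min 1 (δ * ‖ξ‖) ^ M‖ₑ ^ R =
        ‖ξ‖ₑ ^ (R * (e - b)) * min 1 (ENNReal.ofReal δ * ‖ξ‖ₑ) ^ (R * M) := by
      have e1 : ENNReal.ofReal (min 1 (δ * ‖ξ‖)) = min 1 (ENNReal.ofReal δ * ‖ξ‖ₑ) := by
        rw [ENNReal.ofReal_min, ENNReal.ofReal_mul hδ.le, ofReal_norm, ENNReal.ofReal_one]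
      rw [← Real.rpow_neg hξ0.le, ← Real.rpow_add hξ0, Real.enorm_of_nonneg (by positivity),
        ENNReal.ofReal_mul (by positivity), ENNReal.mul_rpow_of_nonneg _ _ hR0.le,
        ← ENNReal.ofReal_rpow_of_pos hξ0, ← Real.rpow_natCast, ← ENNReal.ofReal_rpow_of_pos hmin,
        ← ENNReal.rpow_mul, ← ENNReal.rpow_mul, e1, ofReal_norm]
      congr 2 <;> ring
    simp only [hu, brokenWeight]
    split_ifs
    · exact key _
    · exact key _
  have hfin : ∀ X : ℝ, 0 ≤ X → (∫⁻ ξ : EuclideanSpace ℝ (Fin d),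
        (if ‖ξ‖ < 1 then ‖ξ‖ₑ ^ (R * (e - B.1)) else ‖ξ‖ₑ ^ (R * (e - B.2))) *
        min 1 (ENNReal.ofReal δ * ‖ξ‖ₑ) ^ (R * M)) ≤ C * ENNReal.ofReal X →
      eLpNorm g q (volume.restrict (Metric.ball 0 δ)) ≤
      (CH ^ (1 / Q) * ((4 * Real.pi) ^ M).toNNReal * C ^ (1 / R) : NNReal) *
        ENNReal.ofReal (X ^ (1 / R)) * eLpNorm v p volume := by
    intro X hX hle
    refine (eLpNorm_mono_measure _ Measure.restrict_le_self).trans ?_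
    grw [h1, h2, h3, h4, hle]
    rw [ENNReal.mul_rpow_of_nonneg _ _ (by positivity),
      ENNReal.ofReal_rpow_of_nonneg hX (by positivity), ENNReal.coe_mul, ENNReal.coe_mul,
      ENNReal.coe_rpow_of_nonneg C (by positivity)]
    apply le_of_eq
    rw [ENNReal.ofReal]
    ring
  obtain ⟨hs, hl⟩ := hC δ hδ
  refine ⟨fun hδ1 => ?_, fun hδ1 => ?_⟩
  · have := hfin _ (by positivity) (hs hδ1)
    rw [ha₂, neg_neg, ← Real.rpow_mul hδ.le] at this
    rwa [show R * m₂ * (1 / R) = m₂ by field_simp] at this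
  · have hlog := Real.log_nonneg hδ1
    have hrate : localRate m₁ (1 / Q - iP) δ = (if -(R * m₁) = 0 then 1 + Real.log δ else
        δ ^ max (R * m₁) 0) ^ (1 / Q - iP) := by
      rw [localRate]
      by_cases h : m₁ = 0
      · simp [h]
      · have : -(R * m₁) ≠ 0 := by simpa [hR0.ne'] using h
        rw [if_neg h, if_neg this, ← Real.rpow_mul hδ.le]
        congr 1
        rw [← hRi, max_mul_of_nonneg _ _ (by positivity)]
        congr 1
        · field_simp
        · simp
    have := hfin _ (by split_ifs <;> positivity) (hl hδ1)
    rw [ha₁, neg_neg, hRi, ← hrate] at this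
    rw [hRi]
    exact this
end

section
variable {d : ℕ}

lemma min_one_mul_pow_le_brokenWeight {B : ℝ × ℝ} (hB1 : 0 < B.1) (hB2 : 0 < B.2) {M : ℕ}
    (hM1 : B.1 ≤ M) (hM2 : B.2 ≤ M) {b δ : ℝ} (hδ : 0 < δ)
    (hb : (δ ≤ 1 ∧ b = B.2) ∨ (1 ≤ δ ∧ b = B.1)) {ξ : EuclideanSpace ℝ (Fin d)} (hξ : ξ ≠ 0) :
    min 1 (δ * ‖ξ‖) ^ M ≤ δ ^ b * brokenWeight B ξ := by
  have ht : 0 < ‖ξ‖ := norm_pos_iff.2 hξ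
  have hmin : 0 < min 1 (δ * ‖ξ‖) := by positivity
  have key (c : ℝ) (hc0 : 0 ≤ c) (hc : c ≤ M) : min 1 (δ * ‖ξ‖) ^ M ≤ δ ^ c * ‖ξ‖ ^ c := by
    rw [← Real.rpow_natCast, ← Real.mul_rpow hδ.le ht.le]
    exact (Real.rpow_le_rpow_of_exponent_ge hmin (min_le_left _ _) hc).trans
      (Real.rpow_le_rpow hmin.le (min_le_right _ _) hc0)
  have hpow1 : min 1 (δ * ‖ξ‖) ^ M ≤ 1 := pow_le_one₀ hmin.le (min_le_left _ _)
  unfold brokenWeight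
  rcases hb with ⟨h, rfl⟩ | ⟨h, rfl⟩
  · split_ifs with h1
    · have h2 : min 1 (δ * ‖ξ‖) ≤ δ * ‖ξ‖ := min_le_right _ _
      calc min 1 (δ * ‖ξ‖) ^ M ≤ (δ * ‖ξ‖) ^ M := by gcongr
        _ = δ ^ (M : ℝ) * ‖ξ‖ ^ (M : ℝ) := by
          rw [mul_pow, Real.rpow_natCast, Real.rpow_natCast]
        _ ≤ _ := mul_le_mul (Real.rpow_le_rpow_of_exponent_ge hδ h hM2)
          (Real.rpow_le_rpow_of_exponent_ge ht h1.le hM1) (by positivity) (by positivity)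
    · exact key _ hB2.le hM2
  · split_ifs with h1
    · exact key _ hB1.le hM1
    · exact hpow1.trans (one_le_mul_of_one_le_of_one_le (Real.one_le_rpow h hB1.le)
        (Real.one_le_rpow (not_lt.1 h1) hB2.le))

/-- The bound on the local part, Hausdorff–Young range. -/
lemma exists_eLpNorm_le_of_le_two [Nontrivial (EuclideanSpace ℝ (Fin d))] {p q : ℝ≥0∞}
    (hq : 1 ≤ q) (hqp : q < p) (hp2 : p ≤ 2) {B : ℝ × ℝ} (hB1 : 0 < B.1) (hB2 : 0 < B.2)
    {m₁ m₂ : ℝ}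
    (hm₁ : m₁ = B.1 + (d : ℝ) * ((1/p).toReal + (1/q).toReal - 1))
    (hm₂ : m₂ = B.2 + (d : ℝ) * ((1/p).toReal + (1/q).toReal - 1)) :
    ∃ (M : ℕ) (C : NNReal), ∀ δ : ℝ, 0 < δ → ∀ f g : 𝓢(EuclideanSpace ℝ (Fin d), ℂ),
      (∀ ξ, ‖𝓕 (⇑g) ξ‖ ≤ (4 * Real.pi) ^ M * min 1 (δ * ‖ξ‖) ^ M * ‖𝓕 (⇑f) ξ‖) →
      (δ ≤ 1 → eLpNorm g q (volume.restrict (Metric.ball 0 δ)) ≤ C * ENNReal.ofReal (δ ^ m₂) *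
        eLpNorm (fun ξ => brokenWeight B ξ * ‖𝓕 (⇑f) ξ‖) p volume) ∧
      (1 ≤ δ → eLpNorm g q (volume.restrict (Metric.ball 0 δ)) ≤
        C * ENNReal.ofReal (localRate m₁ ((1/q).toReal - (1/p).toReal) δ) *
        eLpNorm (fun ξ => brokenWeight B ξ * ‖𝓕 (⇑f) ξ‖) p volume) := by
  have hpt : p ≠ ⊤ := (hp2.trans_lt (by simp)).ne
  have hqt : q ≠ ⊤ := hqp.ne_top
  have hQ1 : 1 ≤ q.toReal := by simpa using ENNReal.toReal_mono hqt hq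
  have hQP : q.toReal < p.toReal := (ENNReal.toReal_lt_toReal hqt hpt).2 hqp
  have hP2 : p.toReal ≤ 2 := by simpa using ENNReal.toReal_mono (by simp) hp2
  have hQi : (1/q).toReal = 1 / q.toReal := by simp
  have hPi : (1/p).toReal = 1 / p.toReal := by simp
  rw [hQi, hPi] at hm₁ hm₂
  rw [hQi, hPi]
  set Q := q.toReal with hQ
  set P := p.toReal with hP
  have hP0 : 0 < P := by linarith
  have hQ0 : 0 < Q := by linarith
  have hps : P.HolderConjugate (P / (P - 1)) := Real.HolderConjugate.conjExponent (by linarith)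
  set s := P / (P - 1) with hs
  have hs0 : 0 < s := hps.symm.pos
  have hsi : 1 / s = 1 - 1 / P := by
    have := hps.one_div_add_one_div; linarith
  have hP1 : 1 / 2 ≤ 1 / P := one_div_le_one_div_of_le hP0 hP2
  have hQPi : 1 / P < 1 / Q := one_div_lt_one_div_of_lt hQ0 hQP
  have hqs : q ≤ ENNReal.ofReal s := by
    rw [ENNReal.le_ofReal_iff_toReal_le hqt hs0.le, ← one_div_le_one_div hs0 hQ0]
    linarith
  obtain ⟨C, hC⟩ := exists_hausdorff_young (EuclideanSpace ℝ (Fin d)) hps hP2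
  rw [ENNReal.ofReal_toReal hpt] at hC
  obtain ⟨M, hM⟩ := exists_nat_ge (max B.1 B.2)
  rw [max_le_iff] at hM
  have hs1 : 0 ≤ 1 / Q - 1 / s := by linarith
  set K : NNReal := (volume (Metric.ball (0 : EuclideanSpace ℝ (Fin d)) 1)).toNNReal with hK
  refine ⟨M, K ^ (1 / Q - 1 / s) * C * ((4 * Real.pi) ^ M).toNNReal, fun δ hδ f g hfg => ?_⟩
  have main (b : ℝ) (hb : (δ ≤ 1 ∧ b = B.2) ∨ (1 ≤ δ ∧ b = B.1)) :
      eLpNorm g q (volume.restrict (Metric.ball 0 δ)) ≤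
        (K ^ (1 / Q - 1 / s) * C * ((4 * Real.pi) ^ M).toNNReal : NNReal) *
        ENNReal.ofReal (δ ^ (b + (d : ℝ) * (1 / P + 1 / Q - 1))) *
        eLpNorm (fun ξ => brokenWeight B ξ * ‖𝓕 (⇑f) ξ‖) p volume := by
    have h1 := eLpNorm_le_eLpNorm_mul_rpow_measure_univ
      (μ := volume.restrict (Metric.ball (0 : EuclideanSpace ℝ (Fin d)) δ)) (f := ⇑g) hqs
      g.continuous.aestronglyMeasurable
    have h2 : eLpNorm (𝓕 (⇑g)) p volume ≤ ENNReal.ofReal ((4 * Real.pi) ^ M * δ ^ b) *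
        eLpNorm (fun ξ => brokenWeight B ξ * ‖𝓕 (⇑f) ξ‖) p volume := by
      refine eLpNorm_le_mul_eLpNorm_of_ae_le_mul ?_ p
      filter_upwards [ae_ne_zero] with ξ hξ
      rw [Real.norm_of_nonneg (mul_nonneg (brokenWeight_nonneg _ _) (norm_nonneg _))]
      refine (hfg ξ).trans ?_
      rw [← mul_assoc, mul_assoc _ (δ ^ b)]
      gcongr
      exact min_one_mul_pow_le_brokenWeight hB1 hB2 hM.1 hM.2 hδ hb hξ
    have h3 : volume (Metric.ball (0 : EuclideanSpace ℝ (Fin d)) δ) =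
        ENNReal.ofReal (δ ^ (d : ℝ)) * K := by
      rw [Measure.addHaar_ball _ _ hδ.le, hK, ENNReal.coe_toNNReal measure_ball_lt_top.ne]
      simp
    grw [h1, Measure.restrict_apply_univ, h3, Measure.restrict_le_self, hC g, h2]
    rw [ENNReal.toReal_ofReal hs0.le, ENNReal.mul_rpow_of_nonneg _ _ hs1,
      ENNReal.ofReal_rpow_of_pos (by positivity), ← Real.rpow_mul hδ.le,
      ENNReal.coe_mul, ENNReal.coe_mul, ENNReal.coe_rpow_of_nonneg K hs1,
      ENNReal.ofReal_mul (by positivity), Real.rpow_add hδ, ENNReal.ofReal_mul (by positivity), hsi,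
      show (1 / Q - (1 - 1 / P)) = 1 / P + 1 / Q - 1 by ring]
    apply le_of_eq
    rw [ENNReal.ofReal, ENNReal.ofReal, ENNReal.ofReal]
    ring
  refine ⟨fun h => ?_, fun h => ?_⟩
  · rw [hm₂]; exact main _ (Or.inl ⟨h, rfl⟩)
  · have h0 : 0 < m₁ := by
      have : 0 ≤ (d : ℝ) * (1 / P + 1 / Q - 1) := mul_nonneg (by positivity) (by linarith)
      linarith
    rw [localRate, if_neg h0.ne', max_eq_left h0.le, hm₁]
    exact main _ (Or.inr ⟨h, rfl⟩)

/-- The scale-invariant upper bound for `‖f‖_q`. -/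
lemma exists_eLpNorm_le_add (hd : 1 ≤ d) {p q p' : ℝ≥0∞} (hq : 1 ≤ q) (hqp : q < p)
    (hconj : 1/p + 1/p' = 1) (hmax : 2 ≤ q ∨ 2 ≤ p') {A B : ℝ × ℝ}
    (hA1 : 0 < A.1) (hA2 : 0 < A.2) (hB1 : 0 < B.1) (hB2 : 0 < B.2) {m₁ m₂ : ℝ}
    (hm₁ : m₁ = B.1 + (d : ℝ) * ((1/p).toReal + (1/q).toReal - 1))
    (hm₂ : m₂ = B.2 + (d : ℝ) * ((1/p).toReal + (1/q).toReal - 1)) (hm₂0 : 0 < m₂) :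
    ∃ C : NNReal, ∀ δ : ℝ, 0 < δ → ∀ f : 𝓢(EuclideanSpace ℝ (Fin d), ℂ),
      (δ ≤ 1 → eLpNorm f q volume ≤ C * (ENNReal.ofReal (δ ^ (-A.1)) *
          eLpNorm (fun y => brokenWeight A y * ‖f y‖) q volume + ENNReal.ofReal (δ ^ m₂) *
          eLpNorm (fun ξ => brokenWeight B ξ * ‖𝓕 (⇑f) ξ‖) p volume)) ∧
      (1 ≤ δ → eLpNorm f q volume ≤ C * (ENNReal.ofReal (δ ^ (-A.2)) *
          eLpNorm (fun y => brokenWeight A y * ‖f y‖) q volume +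
          ENNReal.ofReal (localRate m₁ ((1/q).toReal - (1/p).toReal) δ) *
          eLpNorm (fun ξ => brokenWeight B ξ * ‖𝓕 (⇑f) ξ‖) p volume)) := by
  have : Nontrivial (EuclideanSpace ℝ (Fin d)) :=
    Module.nontrivial_of_finrank_pos (R := ℝ) (by simp; lia)
  obtain ⟨M, C, hC⟩ := show ∃ (M : ℕ) (C : NNReal), ∀ δ : ℝ, 0 < δ →
      ∀ f g : 𝓢(EuclideanSpace ℝ (Fin d), ℂ),
      (∀ ξ, ‖𝓕 (⇑g) ξ‖ ≤ (4 * Real.pi) ^ M * min 1 (δ * ‖ξ‖) ^ M * ‖𝓕 (⇑f) ξ‖) →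
      (δ ≤ 1 → eLpNorm g q (volume.restrict (Metric.ball 0 δ)) ≤ C * ENNReal.ofReal (δ ^ m₂) *
        eLpNorm (fun ξ => brokenWeight B ξ * ‖𝓕 (⇑f) ξ‖) p volume) ∧
      (1 ≤ δ → eLpNorm g q (volume.restrict (Metric.ball 0 δ)) ≤
        C * ENNReal.ofReal (localRate m₁ ((1/q).toReal - (1/p).toReal) δ) *
        eLpNorm (fun ξ => brokenWeight B ξ * ‖𝓕 (⇑f) ξ‖) p volume) by
    rcases hmax with h | h
    · exact exists_eLpNorm_le_of_two_le h hqp hm₁ hm₂ hm₂0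
    · refine exists_eLpNorm_le_of_le_two hq hqp ?_ hB1 hB2 hm₁ hm₂
      have h1 : 1 / p' ≤ 1 / 2 := ENNReal.div_le_div_left h 1
      have h2 : (1 : ℝ≥0∞) / 2 + 1 / 2 = 1 := ENNReal.add_halves 1
      have h3 : (1 : ℝ≥0∞) / 2 ≤ 1 / p := by
        by_contra! h3
        have : 1 / p + 1 / p' < 1 / 2 + 1 / 2 :=
          ENNReal.add_lt_add_of_lt_of_le (h1.trans_lt (by simp)).ne h3 h1
        rw [hconj, h2] at this
        exact lt_irrefl _ this
      simpa using h3
  refine ⟨max C (2 ^ M), fun δ hδ f => ?_⟩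
  obtain ⟨g, hg, hloc⟩ := exists_localization f hδ M
  obtain ⟨hs, hl⟩ := hC δ hδ f g hg
  have comb (X Y Z N : ℝ≥0∞) (h1 : eLpNorm g q (volume.restrict (Metric.ball 0 δ)) ≤ C * Y * N)
      (h2 : eLpNorm f q (volume.restrict (Metric.ball 0 δ)ᶜ) ≤ X * Z) :
      eLpNorm f q volume ≤ (max C (2 ^ M) : NNReal) * (X * Z + Y * N) := by
    have e1 : (C : ℝ≥0∞) ≤ (max C (2 ^ M) : NNReal) := by exact_mod_cast le_max_left _ _
    have e2 : (2 : ℝ≥0∞) ^ M ≤ (max C (2 ^ M) : NNReal) := by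
      exact_mod_cast (le_max_right C (2 ^ M) : (2 ^ M : NNReal) ≤ _)
    calc _ ≤ C * Y * N + 2 ^ M * (X * Z) := by grw [hloc q hq, h1, h2]
      _ ≤ (max C (2 ^ M) : NNReal) * Y * N + (max C (2 ^ M) : NNReal) * (X * Z) := by gcongr
      _ = _ := by ring
  exact ⟨fun h => comb _ _ _ _ (hs h) (eLpNorm_compl_ball_le hA1.le hA2.le hδ (Or.inl ⟨h, rfl⟩) f q),
    fun h => comb _ _ _ _ (hl h) (eLpNorm_compl_ball_le hA1.le hA2.le hδ (Or.inr ⟨h, rfl⟩) f q)⟩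
end

section
variable {d : ℕ}

lemma Hsup_le_of_forall {A B : ℝ × ℝ} {q p : ℝ≥0∞} {x : ℝ} {C : NNReal}
    {X Y a b T : ℝ} (hX : 0 ≤ X) (hXT : X * x ≤ a * T) (hYT : Y ≤ b * T)
    (h : ∀ f : 𝓢(EuclideanSpace ℝ (Fin d), ℂ), eLpNorm f q volume ≤ C * (ENNReal.ofReal X *
          eLpNorm (fun y => brokenWeight A y * ‖f y‖) q volume + ENNReal.ofReal Y *
          eLpNorm (fun ξ => brokenWeight B ξ * ‖𝓕 (⇑f) ξ‖) p volume))
    (ha : 0 ≤ a) (hb : 0 ≤ b) (hT : 0 ≤ T) :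
    Hsup d A B q p x ≤ ENNReal.ofReal (C * (a + b) * T) := by
  refine iSup_le fun f => ?_
  obtain ⟨f, -, h1, h2⟩ := f
  refine (h f).trans ?_
  grw [h1, h2]
  rw [← ENNReal.ofReal_mul hX, mul_one]
  grw [hXT, hYT]
  rw [← ENNReal.ofReal_add (by positivity) (by positivity), ← ENNReal.ofReal_coe_nnreal,
    ← ENNReal.ofReal_mul (by positivity)]
  apply le_of_eq; congr 1; ring

lemma rpow_scale_identities {x a m : ℝ} (hx : 0 < x) (ham : a + m ≠ 0) :
    (x ^ (1 / (a + m))) ^ (-a) * x = x ^ (m / (a + m)) ∧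
      (x ^ (1 / (a + m))) ^ m = x ^ (m / (a + m)) := by
  constructor
  · rw [← Real.rpow_mul hx.le]
    nth_rewrite 2 [← Real.rpow_one x]
    rw [← Real.rpow_add hx]
    congr 1
    field_simp; ring
  · rw [← Real.rpow_mul hx.le]
    congr 1
    field_simp

/-- The upper bounds for the extremal function. -/
lemma exists_Hsup_le (hd : 1 ≤ d) {p q p' : ℝ≥0∞} (hq : 1 ≤ q) (hqp : q < p)
    (hconj : 1/p + 1/p' = 1) (hmax : 2 ≤ q ∨ 2 ≤ p') {A B : ℝ × ℝ}
    (hA1 : 0 < A.1) (hA2 : 0 < A.2) (hB1 : 0 < B.1) (hB2 : 0 < B.2) {m₁ m₂ : ℝ}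
    (hm₁ : m₁ = B.1 + (d : ℝ) * ((1/p).toReal + (1/q).toReal - 1))
    (hm₂ : m₂ = B.2 + (d : ℝ) * ((1/p).toReal + (1/q).toReal - 1)) (hm₂0 : 0 < m₂)
    (hs : 0 < (1/q).toReal - (1/p).toReal) :
    ∃ C : ℝ, 0 < C ∧ ∀ x : ℝ, 0 < x →
      (x < 1 → Hsup d A B q p x ≤ ENNReal.ofReal (C * x ^ (m₂ / (A.1 + m₂)))) ∧
      (1 ≤ x → m₁ ≠ 0 →
        Hsup d A B q p x ≤ ENNReal.ofReal (C * x ^ (max m₁ 0 / (A.2 + max m₁ 0)))) ∧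
      (1 ≤ x → m₁ = 0 → Hsup d A B q p x ≤
        ENNReal.ofReal (C * Real.log (x + 1) ^ ((1/q).toReal - (1/p).toReal))) := by
  obtain ⟨C, hC⟩ := exists_eLpNorm_le_add hd hq hqp hconj hmax hA1 hA2 hB1 hB2 hm₁ hm₂ hm₂0
  set s := (1/q).toReal - (1/p).toReal with hs_def
  have hl2 : 0 < Real.log 2 := Real.log_pos (by norm_num)
  set a : ℝ := (1 / Real.log 2) ^ s + 1 with ha
  set b : ℝ := (1 / Real.log 2 + 1 / A.2) ^ s + 1 with hb
  have hapos : 0 ≤ (1 / Real.log 2) ^ s := by positivity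
  have hbpos : 0 ≤ (1 / Real.log 2 + 1 / A.2) ^ s := by positivity
  have ha0 : 0 ≤ a := by positivity
  have hb0 : 0 ≤ b := by positivity
  have weaken {H : ℝ≥0∞} {T : ℝ} (hT : 0 ≤ T) (h : H ≤ ENNReal.ofReal (C * (a + b) * T)) :
      H ≤ ENNReal.ofReal (((C : ℝ) + 1) * (a + b) * T) := by
    refine h.trans (ENNReal.ofReal_le_ofReal ?_)
    gcongr
    linarith
  refine ⟨((C : ℝ) + 1) * (a + b), by positivity, fun x hx => ⟨fun hx1 => ?_, fun hx1 hm => ?_,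
    fun hx1 hm => ?_⟩⟩
  · have hδ1 : x ^ (1 / (A.1 + m₂)) ≤ 1 := Real.rpow_le_one hx.le hx1.le (by positivity)
    obtain ⟨e1, e2⟩ := rpow_scale_identities hx (a := A.1) (m := m₂) (by positivity)
    have hT : 0 ≤ x ^ (m₂ / (A.1 + m₂)) := by positivity
    refine weaken hT (Hsup_le_of_forall (by positivity) ?_ ?_
      (fun f => (hC _ (by positivity) f).1 hδ1) ha0 hb0 hT)
    · rw [e1]
      exact le_mul_of_one_le_left hT (by rw [ha]; linarith)
    · rw [e2]
      exact le_mul_of_one_le_left hT (by rw [hb]; linarith)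
  · have hmax0 : 0 ≤ max m₁ 0 := le_max_right _ _
    have hδ1 : 1 ≤ x ^ (1 / (A.2 + max m₁ 0)) := Real.one_le_rpow hx1 (by positivity)
    obtain ⟨e1, e2⟩ := rpow_scale_identities hx (a := A.2) (m := max m₁ 0) (by positivity)
    have hT : 0 ≤ x ^ (max m₁ 0 / (A.2 + max m₁ 0)) := by positivity
    refine weaken hT (Hsup_le_of_forall (by positivity) ?_ ?_
      (fun f => (hC _ (by positivity) f).2 hδ1) ha0 hb0 hT)
    · rw [e1]
      exact le_mul_of_one_le_left hT (by rw [ha]; linarith)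
    · rw [localRate, if_neg hm, e2]
      exact le_mul_of_one_le_left hT (by rw [hb]; linarith)
  · have hδ1 : 1 ≤ x ^ (1 / A.2) := Real.one_le_rpow hx1 (by positivity)
    obtain ⟨e1, -⟩ := rpow_scale_identities hx (a := A.2) (m := 0) (by positivity)
    simp only [add_zero, zero_div, Real.rpow_zero] at e1
    have hL2 : Real.log 2 ≤ Real.log (x + 1) := Real.log_le_log (by norm_num) (by linarith)
    have hL : 0 < Real.log (x + 1) := by linarith
    have hLx : Real.log x ≤ Real.log (x + 1) := Real.log_le_log hx (by linarith)
    have hx0 : 0 ≤ Real.log x := Real.log_nonneg hx1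
    have hT : 0 ≤ Real.log (x + 1) ^ s := by positivity
    have h1 : 1 ≤ 1 / Real.log 2 * Real.log (x + 1) := by
      rw [one_div_mul_eq_div, one_le_div hl2]; exact hL2
    refine weaken hT (Hsup_le_of_forall (by positivity) ?_ ?_
      (fun f => (hC _ (by positivity) f).2 hδ1) ha0 hb0 hT)
    · rw [e1, ha, add_mul, ← Real.mul_rpow (by positivity) hL.le]
      have := Real.one_le_rpow h1 hs.le
      linarith
    · rw [localRate, if_pos hm, hb, add_mul, ← Real.mul_rpow (by positivity) hL.le,
        Real.log_rpow hx]
      have h2 : 1 + 1 / A.2 * Real.log x ≤ (1 / Real.log 2 + 1 / A.2) * Real.log (x + 1) := by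
        rw [add_mul]
        gcongr
      have : (1 + 1 / A.2 * Real.log x) ^ s ≤
          ((1 / Real.log 2 + 1 / A.2) * Real.log (x + 1)) ^ s := by
        gcongr
      linarith
end

section
variable {d : ℕ}

lemma eLpNorm_comp_smul {F : Type*} [NormedAddCommGroup F] {c : ℝ} (hc : 0 < c)
    (f : EuclideanSpace ℝ (Fin d) → F) (q : ℝ≥0∞) :
    eLpNorm (fun y => f (c • y)) q volume =
      ENNReal.ofReal (c ^ (-((d : ℝ) * (1/q).toReal))) * eLpNorm f q volume := by
  have h := ((Homeomorph.smulOfNeZero c hc.ne').measurableEmbedding.eLpNorm_map_measure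
    (g := f) (p := q) (μ := (volume : Measure (EuclideanSpace ℝ (Fin d)))))
  have h2 : Measure.map (⇑(Homeomorph.smulOfNeZero c hc.ne'))
      (volume : Measure (EuclideanSpace ℝ (Fin d))) = ENNReal.ofReal (c ^ (-(d : ℝ))) • volume := by
    have := Measure.map_addHaar_smul (volume : Measure (EuclideanSpace ℝ (Fin d))) hc.ne'
    rw [abs_of_pos (by positivity), finrank_euclideanSpace_fin] at this
    rw [Real.rpow_neg hc.le, Real.rpow_natCast]
    exact this
  have h0 : ENNReal.ofReal (c ^ (-(d : ℝ))) ≠ 0 := by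
    rw [Ne, ENNReal.ofReal_eq_zero, not_le]; positivity
  rw [h2, eLpNorm_smul_measure_of_ne_zero h0, ENNReal.ofReal_rpow_of_pos (by positivity),
    ← Real.rpow_mul hc.le, neg_mul] at h
  exact h.symm

lemma exists_comp_smul (f : 𝓢(EuclideanSpace ℝ (Fin d), ℂ)) {c : ℝ} (hc : c ≠ 0) :
    ∃ g : 𝓢(EuclideanSpace ℝ (Fin d), ℂ), ∀ y, g y = f (c • y) :=
  ⟨SchwartzMap.compCLMOfContinuousLinearEquiv ℝ
    (ContinuousLinearEquiv.smulLeft (Units.mk0 c hc)) f, fun _ => rfl⟩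

lemma fourier_comp_smul (f : EuclideanSpace ℝ (Fin d) → ℂ) {δ : ℝ} (hδ : 0 < δ)
    (ξ : EuclideanSpace ℝ (Fin d)) :
    𝓕 (fun y => f (δ⁻¹ • y)) ξ = ((δ ^ d : ℝ) : ℂ) * 𝓕 f (δ • ξ) := by
  rw [Real.fourier_eq, Real.fourier_eq]
  have := Measure.integral_comp_smul (volume : Measure (EuclideanSpace ℝ (Fin d)))
    (fun v => Real.fourierChar (-(inner ℝ v (δ • ξ))) • f v) δ⁻¹
  rw [finrank_euclideanSpace_fin, inv_pow, inv_inv, abs_of_pos (by positivity),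
    Complex.real_smul] at this
  rw [← this]
  congr 1; ext v
  rw [real_inner_smul_left, real_inner_smul_right, inv_mul_cancel_left₀ hδ.ne']

lemma rpow_le_one_add_sq_pow {t a : ℝ} {k : ℕ} (ht : 0 ≤ t) (ha : 0 ≤ a) (hk : a ≤ k) :
    t ^ a ≤ (1 + t ^ 2) ^ k := by
  have h1 : 1 ≤ 1 + t ^ 2 := by nlinarith
  rcases le_total t 1 with h | h
  · exact (Real.rpow_le_one ht h ha).trans (one_le_pow₀ h1)
  · calc t ^ a ≤ t ^ (k : ℝ) := Real.rpow_le_rpow_of_exponent_le h hk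
      _ = t ^ k := Real.rpow_natCast _ _
      _ ≤ _ := pow_le_pow_left₀ ht (by nlinarith) _

lemma exists_norm_eq_one_add_sq_pow_mul (f : 𝓢(EuclideanSpace ℝ (Fin d), ℂ)) (k : ℕ) :
    ∃ g : 𝓢(EuclideanSpace ℝ (Fin d), ℂ), ∀ x, ‖g x‖ = (1 + ‖x‖ ^ 2) ^ k * ‖f x‖ := by
  have h : (fun x : EuclideanSpace ℝ (Fin d) => (1 + ‖x‖ ^ 2) ^ k).HasTemperateGrowth := by
    fun_prop
  refine ⟨SchwartzMap.smulLeftCLM ℂ (fun x => (1 + ‖x‖ ^ 2) ^ k) f, fun x => ?_⟩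
  rw [SchwartzMap.smulLeftCLM_apply_apply h, norm_smul, Real.norm_of_nonneg (by positivity)]

/-- A weight at the rescaled point `c • η` is at most its rate at scale `c` times a weight in
`η`. -/
lemma brokenWeight_smul_le {A : ℝ × ℝ} (hA2 : 0 < A.2) {a c : ℝ} (hc : 0 < c)
    (ha : (c ≤ 1 ∧ a = A.1) ∨ (1 ≤ c ∧ a = A.2)) (η : EuclideanSpace ℝ (Fin d)) :
    brokenWeight A (c • η) ≤ c ^ a * (‖η‖ ^ A.1 + ‖η‖ ^ A.2) := by
  have h1 : 0 ≤ c ^ a * ‖η‖ ^ A.1 := by positivity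
  have h2 : 0 ≤ c ^ a * ‖η‖ ^ A.2 := by positivity
  have hn : ‖c • η‖ = c * ‖η‖ := by rw [norm_smul, Real.norm_of_nonneg hc.le]
  have ht : 0 ≤ ‖η‖ := norm_nonneg η
  have hct : 0 ≤ c * ‖η‖ := by positivity
  rw [mul_add, brokenWeight, hn]
  rcases ha with ⟨h, rfl⟩ | ⟨h, rfl⟩
  · split_ifs with hlt
    · rw [Real.mul_rpow hc.le ht]; linarith
    · have hge : 1 ≤ c * ‖η‖ := not_lt.1 hlt
      rcases le_total A.1 A.2 with h12 | h12
      · have := Real.rpow_le_rpow_of_exponent_ge hc h h12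
        rw [Real.mul_rpow hc.le ht]
        have : c ^ A.2 * ‖η‖ ^ A.2 ≤ c ^ A.1 * ‖η‖ ^ A.2 := by gcongr
        linarith
      · have := Real.rpow_le_rpow_of_exponent_le hge h12
        rw [Real.mul_rpow hc.le ht (z := A.1)] at this; linarith
  · split_ifs with hlt
    · rcases le_total A.1 A.2 with h12 | h12
      · have := Real.rpow_le_rpow_of_exponent_le h h12
        rw [Real.mul_rpow hc.le ht]
        have : c ^ A.1 * ‖η‖ ^ A.1 ≤ c ^ A.2 * ‖η‖ ^ A.1 := by gcongr
        linarith
      · have := Real.rpow_le_rpow_of_exponent_ge' hct hlt.le hA2.le h12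
        rw [Real.mul_rpow hc.le ht (z := A.2)] at this; linarith
    · rw [Real.mul_rpow hc.le ht]; linarith

lemma exists_eLpNorm_weight_mul_le {A : ℝ × ℝ} (hA1 : 0 < A.1) (hA2 : 0 < A.2)
    (f : 𝓢(EuclideanSpace ℝ (Fin d), ℂ)) {q : ℝ≥0∞} :
    ∃ K : ℝ, 0 < K ∧
      eLpNorm (fun y => (‖y‖ ^ A.1 + ‖y‖ ^ A.2) * ‖f y‖) q volume ≤ ENNReal.ofReal K := by
  obtain ⟨k, hk⟩ := exists_nat_ge (max A.1 A.2)
  obtain ⟨g, hg⟩ := exists_norm_eq_one_add_sq_pow_mul f k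
  have hfin : ENNReal.ofReal 2 * eLpNorm g q volume ≠ ∞ :=
    ENNReal.mul_ne_top ENNReal.ofReal_ne_top (g.memLp q volume).2.ne
  refine ⟨(ENNReal.ofReal 2 * eLpNorm g q volume).toReal + 1,
    by linarith [ENNReal.toReal_nonneg (a := ENNReal.ofReal 2 * eLpNorm g q volume)], ?_⟩
  refine (eLpNorm_le_mul_eLpNorm_of_ae_le_mul (g := g) (c := 2) (.of_forall fun y => ?_) q).trans ?_
  · rw [hg, Real.norm_of_nonneg (by positivity), ← mul_assoc, two_mul]
    gcongr
    · exact rpow_le_one_add_sq_pow (norm_nonneg _) hA1.le ((le_max_left _ _).trans hk)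
    · exact rpow_le_one_add_sq_pow (norm_nonneg _) hA2.le ((le_max_right _ _).trans hk)
  · rw [ENNReal.le_ofReal_iff_toReal_le hfin
      (by linarith [ENNReal.toReal_nonneg (a := ENNReal.ofReal 2 * eLpNorm g q volume)])]
    linarith

/-- The weighted norms of the dilates of a fixed Schwartz function. -/
lemma exists_dilation_bounds {A B : ℝ × ℝ} (hA1 : 0 < A.1) (hA2 : 0 < A.2) (hB1 : 0 < B.1)
    (hB2 : 0 < B.2) (f : 𝓢(EuclideanSpace ℝ (Fin d), ℂ)) (q p : ℝ≥0∞) :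
    ∃ K : ℝ, 0 < K ∧ ∀ δ : ℝ, 0 < δ → ∀ a b : ℝ,
      (δ ≤ 1 ∧ a = A.1 ∧ b = B.2) ∨ (1 ≤ δ ∧ a = A.2 ∧ b = B.1) →
      eLpNorm (fun y => brokenWeight A y * ‖f (δ⁻¹ • y)‖) q volume ≤
          ENNReal.ofReal (K * δ ^ (a + (d : ℝ) * (1/q).toReal)) ∧
        eLpNorm (fun ξ => brokenWeight B ξ * ‖𝓕 (fun y => f (δ⁻¹ • y)) ξ‖) p volume ≤
          ENNReal.ofReal (K * δ ^ ((d : ℝ) - b - (d : ℝ) * (1/p).toReal)) := by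
  obtain ⟨K₁, hK₁, h₁⟩ := exists_eLpNorm_weight_mul_le hA1 hA2 f (q := q)
  obtain ⟨K₂, hK₂, h₂⟩ := exists_eLpNorm_weight_mul_le hB1 hB2 (𝓕 f) (q := p)
  set W₁ : EuclideanSpace ℝ (Fin d) → ℝ := fun y => (‖y‖ ^ A.1 + ‖y‖ ^ A.2) * ‖f y‖ with hW₁
  set W₂ : EuclideanSpace ℝ (Fin d) → ℝ := fun y =>
    (‖y‖ ^ B.1 + ‖y‖ ^ B.2) * ‖(𝓕 f : 𝓢(EuclideanSpace ℝ (Fin d), ℂ)) y‖ with hW₂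
  have hW₁0 (y) : 0 ≤ W₁ y := by rw [hW₁]; positivity
  have hW₂0 (y) : 0 ≤ W₂ y := by rw [hW₂]; positivity
  refine ⟨K₁ + K₂, by positivity, fun δ hδ a b hab => ⟨?_, ?_⟩⟩
  · refine (eLpNorm_le_mul_eLpNorm_of_ae_le_mul (c := δ ^ a)
      (g := fun y => W₁ (δ⁻¹ • y))
      (.of_forall fun y => ?_) q).trans ?_
    · rw [Real.norm_of_nonneg (mul_nonneg (brokenWeight_nonneg _ _) (norm_nonneg _)),
        Real.norm_of_nonneg (hW₁0 _), hW₁, ← mul_assoc]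
      gcongr
      have := brokenWeight_smul_le hA2 (a := a) hδ (by tauto) (δ⁻¹ • y)
      rwa [smul_inv_smul₀ hδ.ne'] at this
    · rw [eLpNorm_comp_smul (inv_pos.2 hδ)]
      grw [h₁]
      rw [← ENNReal.ofReal_mul (by positivity), ← ENNReal.ofReal_mul (by positivity)]
      apply ENNReal.ofReal_le_ofReal
      rw [Real.inv_rpow hδ.le, Real.rpow_neg hδ.le, inv_inv, Real.rpow_add hδ]
      have : 0 < δ ^ a * δ ^ ((d : ℝ) * (1/q).toReal) := by positivity
      nlinarith
  · refine (eLpNorm_le_mul_eLpNorm_of_ae_le_mul (c := δ ^ (-b) * δ ^ d)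
      (g := fun y => W₂ (δ • y))
      (.of_forall fun ξ => ?_) p).trans ?_
    · rw [Real.norm_of_nonneg (mul_nonneg (brokenWeight_nonneg _ _) (norm_nonneg _)),
        Real.norm_of_nonneg (hW₂0 _), fourier_comp_smul _ hδ, norm_mul, Complex.norm_real,
        Real.norm_of_nonneg (by positivity), hW₂]
      simp only [SchwartzMap.fourier_coe]
      have := brokenWeight_smul_le hB2 (a := b) (inv_pos.2 hδ) (by
        rcases hab with ⟨h, -, h'⟩ | ⟨h, -, h'⟩
        · exact .inr ⟨(one_le_inv₀ hδ).2 h, h'⟩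
        · exact .inl ⟨inv_le_one_of_one_le₀ h, h'⟩) (δ • ξ)
      rw [inv_smul_smul₀ hδ.ne', Real.inv_rpow hδ.le, ← Real.rpow_neg hδ.le] at this
      calc _ ≤ δ ^ (-b) * (‖δ • ξ‖ ^ B.1 + ‖δ • ξ‖ ^ B.2) * (δ ^ d * ‖𝓕 (⇑f) (δ • ξ)‖) := by
            gcongr
        _ = _ := by ring
    · rw [eLpNorm_comp_smul hδ]
      grw [h₂]
      rw [← ENNReal.ofReal_mul (by positivity), ← ENNReal.ofReal_mul (by positivity)]
      apply ENNReal.ofReal_le_ofReal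
      have e : δ ^ ((d : ℝ) - b - (d : ℝ) * (1/p).toReal) =
          δ ^ (-b) * δ ^ d * δ ^ (-((d : ℝ) * (1/p).toReal)) := by
        rw [← Real.rpow_natCast, ← Real.rpow_add hδ, ← Real.rpow_add hδ]; congr 1; ring
      rw [e]
      have : 0 < δ ^ (-b) * δ ^ d * δ ^ (-((d : ℝ) * (1/p).toReal)) := by positivity
      nlinarith

/-- Any Schwartz function gives a lower bound for the extremal function, after normalization. -/
lemma le_Hsup {A B : ℝ × ℝ} {q p : ℝ≥0∞} {x K : ℝ} (hK : 0 < K)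
    (f : 𝓢(EuclideanSpace ℝ (Fin d), ℂ))
    (h1 : eLpNorm (fun y => brokenWeight A y * ‖f y‖) q volume ≤ ENNReal.ofReal (K * x))
    (h2 : eLpNorm (fun ξ => brokenWeight B ξ * ‖𝓕 (⇑f) ξ‖) p volume ≤ ENNReal.ofReal K) :
    ENNReal.ofReal K⁻¹ * eLpNorm f q volume ≤ Hsup d A B q p x := by
  have hK' : 0 < K⁻¹ := inv_pos.2 hK
  have hn : ‖((K⁻¹ : ℝ) : ℂ)‖ₑ = ENNReal.ofReal K⁻¹ := by
    rw [← ofReal_norm, Complex.norm_real, Real.norm_of_nonneg hK'.le]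
  have hn' : ‖K⁻¹‖ₑ = ENNReal.ofReal K⁻¹ := Real.enorm_of_nonneg hK'.le
  by_cases hf : f = 0
  · simp [hf]
  set g : 𝓢(EuclideanSpace ℝ (Fin d), ℂ) := ((K⁻¹ : ℝ) : ℂ) • f with hg
  have hgc : (⇑g : EuclideanSpace ℝ (Fin d) → ℂ) = ((K⁻¹ : ℝ) : ℂ) • ⇑f := rfl
  have hgF (ξ) : 𝓕 (⇑g) ξ = ((K⁻¹ : ℝ) : ℂ) * 𝓕 (⇑f) ξ := by
    rw [← SchwartzMap.fourier_coe, ← SchwartzMap.fourier_coe, hg, FourierTransform.fourier_smul]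
    rfl
  have e1 : (fun y => brokenWeight A y * ‖g y‖) =
      K⁻¹ • fun y => brokenWeight A y * ‖f y‖ := by
    ext y
    rw [hgc, Pi.smul_apply, norm_smul, Complex.norm_real, Real.norm_of_nonneg hK'.le,
      Pi.smul_apply, smul_eq_mul]
    ring
  have e2 : (fun ξ => brokenWeight B ξ * ‖𝓕 (⇑g) ξ‖) =
      K⁻¹ • fun ξ => brokenWeight B ξ * ‖𝓕 (⇑f) ξ‖ := by
    ext y
    rw [hgF, Pi.smul_apply, norm_mul, Complex.norm_real, Real.norm_of_nonneg hK'.le, smul_eq_mul]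
    ring
  refine le_trans (le_of_eq ?_) (le_iSup_of_le ⟨g, ?_, ?_, ?_⟩ le_rfl)
  · change _ = eLpNorm (⇑g) q volume
    rw [hgc, eLpNorm_const_smul, hn]
  · exact smul_ne_zero (by exact_mod_cast hK'.ne') hf
  · rw [e1, eLpNorm_const_smul, hn']
    grw [h1]
    rw [← ENNReal.ofReal_mul hK'.le, inv_mul_cancel_left₀ hK.ne']
  · rw [e2, eLpNorm_const_smul, hn']
    grw [h2]
    rw [← ENNReal.ofReal_mul hK'.le, inv_mul_cancel₀ hK.ne', ENNReal.ofReal_one]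

end

section
variable {d : ℕ}

/-- There is a nonzero Schwartz function with nonnegative real values. -/
lemma exists_nonneg_schwartz (d : ℕ) :
    ∃ G : 𝓢(EuclideanSpace ℝ (Fin d), ℂ), G ≠ 0 ∧ ∀ y, G y = ((‖G y‖ : ℝ) : ℂ) := by
  let b : ContDiffBump (0 : EuclideanSpace ℝ (Fin d)) := ⟨1, 2, one_pos, by norm_num⟩
  have h1 : HasCompactSupport (fun y => ((b y : ℝ) : ℂ)) :=
    b.hasCompactSupport.comp_left (g := ((↑) : ℝ → ℂ)) rfl
  have h2 : ContDiff ℝ (⊤ : ℕ∞) (fun y => ((b y : ℝ) : ℂ)) :=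
    Complex.ofRealCLM.contDiff.comp b.contDiff
  refine ⟨h1.toSchwartzMap h2, fun h => ?_, fun y => ?_⟩
  · have := DFunLike.congr_fun h 0
    have hb : b 0 = 1 := b.one_of_mem_closedBall (by simp [b])
    simp [hb] at this
  · simp [abs_of_nonneg b.nonneg]

lemma eLpNorm_ne_zero_of_ne_zero {G : 𝓢(EuclideanSpace ℝ (Fin d), ℂ)} (hG : G ≠ 0) {q : ℝ≥0∞}
    (hq : q ≠ 0) : eLpNorm G q volume ≠ 0 := by
  rw [Ne, eLpNorm_eq_zero_iff G.continuous.aestronglyMeasurable hq]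
  intro h
  rw [Continuous.ae_eq_iff_eq _ G.continuous continuous_zero] at h
  exact hG (DFunLike.coe_injective h)

/-- Lower bound from a single dilate of a fixed function. -/
lemma exists_le_Hsup_of_scale {q p : ℝ≥0∞} (hq : 1 ≤ q) {A B : ℝ × ℝ} (hA1 : 0 < A.1)
    (hA2 : 0 < A.2) (hB1 : 0 < B.1) (hB2 : 0 < B.2) :
    ∃ c : ℝ, 0 < c ∧ ∀ δ : ℝ, 0 < δ → ∀ a b m : ℝ,
      (δ ≤ 1 ∧ a = A.1 ∧ b = B.2) ∨ (1 ≤ δ ∧ a = A.2 ∧ b = B.1) →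
      m = b + (d : ℝ) * ((1/p).toReal + (1/q).toReal - 1) →
      ∀ x : ℝ, δ ^ (a + m) ≤ x → ENNReal.ofReal (c * δ ^ m) ≤ Hsup d A B q p x := by
  obtain ⟨G, hG, -⟩ := exists_nonneg_schwartz d
  obtain ⟨K, hK, h⟩ := exists_dilation_bounds hA1 hA2 hB1 hB2 G q p
  have hN0 := eLpNorm_ne_zero_of_ne_zero hG (q := q) (by positivity)
  have hNt := (G.memLp q volume).2.ne
  refine ⟨K⁻¹ * (eLpNorm G q volume).toReal, mul_pos (inv_pos.2 hK) (ENNReal.toReal_pos hN0 hNt),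
    fun δ hδ a b m hab hm x hx => ?_⟩
  obtain ⟨g, hg⟩ := exists_comp_smul G (inv_ne_zero hδ.ne')
  obtain ⟨h1, h2⟩ := h δ hδ a b hab
  have hgc : (⇑g : EuclideanSpace ℝ (Fin d) → ℂ) = fun y => G (δ⁻¹ • y) := funext hg
  have hδm : 0 < δ ^ ((d : ℝ) - b - (d : ℝ) * (1/p).toReal) := by positivity
  have key := le_Hsup (A := A) (B := B) (q := q) (p := p) (x := x) (mul_pos hK hδm) g ?_ ?_
  · refine le_trans (le_of_eq ?_) key
    rw [hgc, eLpNorm_comp_smul (inv_pos.2 hδ), ← ENNReal.ofReal_toReal hNt,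
      ENNReal.toReal_ofReal ENNReal.toReal_nonneg, ← ENNReal.ofReal_mul (by positivity),
      ← ENNReal.ofReal_mul (by positivity)]
    congr 1
    rw [Real.inv_rpow hδ.le, ← Real.rpow_neg hδ.le, mul_inv, ← Real.rpow_neg hδ.le, neg_neg]
    have : δ ^ m = δ ^ (-((d : ℝ) - b - (d : ℝ) * (1/p).toReal)) *
        δ ^ ((d : ℝ) * (1/q).toReal) := by
      rw [← Real.rpow_add hδ]; congr 1; rw [hm]; ring
    rw [this]; ring
  · rw [hgc]
    refine h1.trans (ENNReal.ofReal_le_ofReal ?_)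
    have : δ ^ (a + (d : ℝ) * (1/q).toReal) =
        δ ^ ((d : ℝ) - b - (d : ℝ) * (1/p).toReal) * δ ^ (a + m) := by
      rw [← Real.rpow_add hδ]; congr 1; rw [hm]; ring
    rw [this, mul_assoc]
    gcongr
  · rw [hgc]; exact h2

/-- The power type lower bounds for the extremal function. -/
lemma exists_le_Hsup_rpow {q p : ℝ≥0∞} (hq : 1 ≤ q) {A B : ℝ × ℝ} (hA1 : 0 < A.1)
    (hA2 : 0 < A.2) (hB1 : 0 < B.1) (hB2 : 0 < B.2) {m₁ m₂ : ℝ}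
    (hm₁ : m₁ = B.1 + (d : ℝ) * ((1/p).toReal + (1/q).toReal - 1))
    (hm₂ : m₂ = B.2 + (d : ℝ) * ((1/p).toReal + (1/q).toReal - 1)) (hm₂0 : 0 < m₂) :
    ∃ c : ℝ, 0 < c ∧ ∀ x : ℝ, 0 < x →
      (x < 1 → ENNReal.ofReal (c * x ^ (m₂ / (A.1 + m₂))) ≤ Hsup d A B q p x) ∧
      (1 ≤ x → ENNReal.ofReal (c * x ^ (max m₁ 0 / (A.2 + max m₁ 0))) ≤ Hsup d A B q p x) := by
  obtain ⟨c, hc, h⟩ := exists_le_Hsup_of_scale (d := d) (p := p) hq hA1 hA2 hB1 hB2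
  have hpow {x a m : ℝ} (hx : 0 < x) (ham : a + m ≠ 0) : (x ^ (1 / (a + m))) ^ (a + m) = x := by
    rw [← Real.rpow_mul hx.le, one_div_mul_cancel ham, Real.rpow_one]
  refine ⟨c, hc, fun x hx => ⟨fun hx1 => ?_, fun hx1 => ?_⟩⟩
  · have := h (x ^ (1 / (A.1 + m₂))) (by positivity) A.1 B.2 m₂
      (.inl ⟨Real.rpow_le_one hx.le hx1.le (by positivity), rfl, rfl⟩) hm₂ x
      (hpow hx (by positivity)).le
    rwa [(rpow_scale_identities hx (by positivity)).2] at this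
  · rcases le_total m₁ 0 with hm | hm
    · have := h 1 one_pos A.2 B.1 m₁ (.inr ⟨le_rfl, rfl, rfl⟩) hm₁ x (by simpa using hx1)
      simpa [max_eq_right hm] using this
    · rw [max_eq_left hm]
      have := h (x ^ (1 / (A.2 + m₁))) (by positivity) A.2 B.1 m₁
        (.inr ⟨Real.one_le_rpow hx1 (by positivity), rfl, rfl⟩) hm₁ x
        (hpow hx (by positivity)).le
      rwa [(rpow_scale_identities hx (by positivity)).2] at this
end

section

/-- A bump on the positive half line that decays like a power at both ends. -/
noncomputable def powerBump (v t : ℝ) : ℝ := t ^ v / (1 + t ^ v) ^ 2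

lemma powerBump_nonneg (v : ℝ) {t : ℝ} (ht : 0 ≤ t) : 0 ≤ powerBump v t := by
  unfold powerBump; positivity

lemma measurable_powerBump (v : ℝ) : Measurable (powerBump v) := by
  unfold powerBump; fun_prop

lemma powerBump_le_rpow (v : ℝ) {t : ℝ} (ht : 0 ≤ t) : powerBump v t ≤ t ^ v := by
  have : 0 ≤ t ^ v := by positivity
  exact div_le_self this (by nlinarith)

lemma powerBump_le_rpow_neg (v : ℝ) {t : ℝ} (ht : 0 < t) : powerBump v t ≤ t ^ (-v) := by
  have : 0 < t ^ v := by positivity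
  rw [Real.rpow_neg ht.le, powerBump, div_le_iff₀ (by positivity), inv_mul_eq_div,
    le_div_iff₀ this]
  nlinarith

lemma sum_powerBump_le {v : ℝ} (hv : 0 < v) {t : ℝ} (ht : 0 ≤ t) (n : ℕ) :
    ∑ j ∈ Finset.range n, powerBump v (2 ^ j * t) ≤ 2 ^ v / (2 ^ v - 1) := by
  set w : ℝ := 2 ^ v with hw
  have hw1 : 1 < w := Real.one_lt_rpow (by norm_num) hv
  have hw1' : 0 < w - 1 := by linarith
  set s : ℕ → ℝ := fun j => (2 ^ j * t) ^ v with hs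
  have hs0 (j) : 0 ≤ s j := by rw [hs]; positivity
  have hsucc (j) : s (j + 1) = w * s j := by
    simp only [hs, hw]
    rw [← Real.mul_rpow (by norm_num) (by positivity)]
    congr 1; ring
  have step (j) : powerBump v (2 ^ j * t) * ((w - 1) / w) ≤
      s (j + 1) / (1 + s (j + 1)) - s j / (1 + s j) := by
    rw [hsucc, powerBump]
    change s j / (1 + s j) ^ 2 * _ ≤ _
    have h0 := hs0 j
    have h1 : 0 < 1 + w * s j := by positivity
    have h2 : 0 < 1 + s j := by positivity
    have e : w * s j / (1 + w * s j) - s j / (1 + s j) =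
        (w - 1) * s j / ((1 + w * s j) * (1 + s j)) := by
      field_simp; ring
    rw [e, div_mul_div_comm, mul_comm (s j)]
    refine div_le_div_of_nonneg_left (by positivity) (by positivity) ?_
    nlinarith
  have htel := Finset.sum_le_sum (s := Finset.range n) fun j _ => step j
  rw [Finset.sum_range_sub (fun j => s j / (1 + s j)), ← Finset.sum_mul] at htel
  have h1 : s n / (1 + s n) ≤ 1 := by
    rw [div_le_one (by linarith [hs0 n])]; linarith
  have h2 : 0 ≤ s 0 / (1 + s 0) := div_nonneg (hs0 0) (by linarith [hs0 0])
  rw [le_div_iff₀ hw1']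
  rw [← mul_div_assoc, div_le_iff₀ (by linarith)] at htel
  nlinarith

variable {d : ℕ}

lemma exists_lintegral_powerBump_le [Nontrivial (EuclideanSpace ℝ (Fin d))] {v : ℝ} (hv : 0 < v) :
    ∃ C : NNReal, ∀ s : ℝ, 0 < s →
      ∫⁻ ξ : EuclideanSpace ℝ (Fin d), ENNReal.ofReal (‖ξ‖ ^ (-(d : ℝ)) * powerBump v (s * ‖ξ‖)) ≤
        C := by
  obtain ⟨C₁, h₁⟩ := exists_setLIntegral_closedBall_enorm_rpow_le (EuclideanSpace ℝ (Fin d))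
    (a := v - d) (by simpa using hv)
  obtain ⟨C₂, h₂⟩ := exists_setLIntegral_compl_ball_enorm_rpow_le (EuclideanSpace ℝ (Fin d))
    (a := -v - d) (by simpa using hv)
  have hof {ξ : EuclideanSpace ℝ (Fin d)} (hξ : ξ ≠ 0) {s w : ℝ} (hs : 0 < s) :
      ENNReal.ofReal (‖ξ‖ ^ (-(d : ℝ)) * (s * ‖ξ‖) ^ w) =
        ENNReal.ofReal (s ^ w) * ‖ξ‖ₑ ^ (w - d) := by
    have hξ' := norm_pos_iff.2 hξ
    rw [← ofReal_norm, ENNReal.ofReal_rpow_of_pos hξ', ← ENNReal.ofReal_mul (by positivity),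
      Real.mul_rpow hs.le hξ'.le, sub_eq_add_neg, Real.rpow_add hξ']
    congr 1; ring
  refine ⟨C₁ + C₂, fun s hs => ?_⟩
  rw [← lintegral_add_compl _ (Metric.isClosed_closedBall (x := (0 : EuclideanSpace ℝ (Fin d)))
    (ε := s⁻¹)).measurableSet, ENNReal.coe_add]
  have hinv : 0 < s⁻¹ := inv_pos.2 hs
  have cancel (w : ℝ) (C : NNReal) :
      ENNReal.ofReal (s ^ w) * (C * ENNReal.ofReal s⁻¹ ^ w) = C := by
    rw [ENNReal.ofReal_rpow_of_pos hinv, mul_left_comm, ← ENNReal.ofReal_mul (by positivity),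
      ← Real.mul_rpow hs.le hinv.le, mul_inv_cancel₀ hs.ne', Real.one_rpow, ENNReal.ofReal_one,
      mul_one]
  gcongr
  · calc _ ≤ ∫⁻ ξ : EuclideanSpace ℝ (Fin d) in Metric.closedBall 0 s⁻¹,
          ENNReal.ofReal (s ^ v) * ‖ξ‖ₑ ^ (v - d) := by
          refine lintegral_mono_ae (ae_restrict_of_ae ?_)
          filter_upwards [ae_ne_zero] with ξ hξ
          rw [← hof hξ hs]
          gcongr
          exact powerBump_le_rpow v (by positivity)
      _ ≤ _ := by
          rw [lintegral_const_mul' _ _ ENNReal.ofReal_ne_top]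
          grw [h₁ _ hinv.le]
          rw [finrank_euclideanSpace_fin, sub_add_cancel, cancel]
  · calc _ ≤ ∫⁻ ξ : EuclideanSpace ℝ (Fin d) in {ξ | s⁻¹ ≤ ‖ξ‖},
          ENNReal.ofReal (‖ξ‖ ^ (-(d : ℝ)) * powerBump v (s * ‖ξ‖)) := by
          refine lintegral_mono_set fun ξ hξ => ?_
          simp only [Set.mem_compl_iff, mem_closedBall_zero_iff, not_le] at hξ
          exact hξ.le
      _ ≤ ∫⁻ ξ : EuclideanSpace ℝ (Fin d) in {ξ | s⁻¹ ≤ ‖ξ‖},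
          ENNReal.ofReal (s ^ (-v)) * ‖ξ‖ₑ ^ (-v - d) := by
          refine lintegral_mono_ae (ae_restrict_of_ae ?_)
          filter_upwards [ae_ne_zero] with ξ hξ
          rw [← hof hξ hs]
          have hξ' := norm_pos_iff.2 hξ
          gcongr
          exact powerBump_le_rpow_neg v (by positivity)
      _ ≤ _ := by
          rw [lintegral_const_mul' _ _ ENNReal.ofReal_ne_top]
          grw [h₂ _ hinv]
          rw [finrank_euclideanSpace_fin, sub_add_cancel, cancel]

lemma exists_eLpNorm_sum_powerBump_le [Nontrivial (EuclideanSpace ℝ (Fin d))] {v : ℝ} (hv : 0 < v)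
    {p : ℝ≥0∞} (hp : 1 ≤ p) :
    ∃ C : ℝ, 0 < C ∧ ∀ n : ℕ, 1 ≤ n →
      eLpNorm (fun ξ : EuclideanSpace ℝ (Fin d) => ‖ξ‖ ^ (-((d : ℝ) * (1/p).toReal)) *
        ∑ j ∈ Finset.range n, powerBump v (2 ^ j * ‖ξ‖)) p volume ≤
        ENNReal.ofReal (C * (n : ℝ) ^ (1/p).toReal) := by
  obtain ⟨D, hD⟩ := exists_lintegral_powerBump_le (d := d) hv
  set M : ℝ := 2 ^ v / (2 ^ v - 1) with hM
  have hM0 : 0 < M := by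
    have : (1 : ℝ) < 2 ^ v := Real.one_lt_rpow (by norm_num) hv
    exact div_pos (by positivity) (by linarith)
  have hS0 (n : ℕ) (ξ : EuclideanSpace ℝ (Fin d)) :
      0 ≤ ∑ j ∈ Finset.range n, powerBump v (2 ^ j * ‖ξ‖) :=
    Finset.sum_nonneg fun j _ => powerBump_nonneg v (by positivity)
  rcases eq_or_ne p ∞ with rfl | hpt
  · refine ⟨M, hM0, fun n hn => ?_⟩
    simp only [ENNReal.div_top, ENNReal.toReal_zero, mul_zero, neg_zero, Real.rpow_zero, one_mul,
      mul_one]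
    rw [eLpNorm_exponent_top]
    refine eLpNormEssSup_le_of_ae_bound (.of_forall fun ξ => ?_)
    rw [Real.norm_of_nonneg (hS0 n ξ)]
    exact sum_powerBump_le hv (norm_nonneg _) n
  · have hp0 : p ≠ 0 := by positivity
    set P := p.toReal with hP
    have hP1 : 1 ≤ P := by
      rw [hP, ← ENNReal.toReal_one]; exact ENNReal.toReal_mono hpt hp
    have hinv : (1/p).toReal = 1 / P := by rw [ENNReal.toReal_div, ENNReal.toReal_one]
    refine ⟨(M ^ (P - 1) * (D + 1)) ^ (1 / P), by positivity, fun n hn => ?_⟩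
    rw [hinv, eLpNorm_eq_lintegral_rpow_enorm_toReal hp0 hpt, ← hP,
      ← Real.mul_rpow (by positivity) (by positivity),
      ← ENNReal.ofReal_rpow_of_nonneg (by positivity) (by positivity)]
    gcongr
    calc _ ≤ ∫⁻ ξ : EuclideanSpace ℝ (Fin d), ENNReal.ofReal (M ^ (P - 1)) *
          ∑ j ∈ Finset.range n,
            ENNReal.ofReal (‖ξ‖ ^ (-(d : ℝ)) * powerBump v (2 ^ j * ‖ξ‖)) := by
          refine lintegral_mono fun ξ => ?_
          have hS := hS0 n ξ
          rw [Real.enorm_of_nonneg (by positivity),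
            ENNReal.ofReal_rpow_of_nonneg (by positivity) (by positivity),
            Real.mul_rpow (by positivity) hS, ← Real.rpow_mul (norm_nonneg _),
            ← ENNReal.ofReal_sum_of_nonneg fun j _ =>
              mul_nonneg (by positivity) (powerBump_nonneg v (by positivity)),
            ← ENNReal.ofReal_mul (by positivity), ← Finset.mul_sum]
          apply ENNReal.ofReal_le_ofReal
          have e1 : -((d : ℝ) * (1 / P)) * P = -d := by field_simp
          have e2 : (∑ j ∈ Finset.range n, powerBump v (2 ^ j * ‖ξ‖)) ^ P ≤
              M ^ (P - 1) * ∑ j ∈ Finset.range n, powerBump v (2 ^ j * ‖ξ‖) := by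
            rcases hS.eq_or_lt with h0 | h0
            · rw [← h0, Real.zero_rpow (by linarith), mul_zero]
            · nth_rewrite 1 [show P = (P - 1) + 1 by ring]
              rw [Real.rpow_add h0, Real.rpow_one]
              gcongr ?_ ^ _ * _
              exact sum_powerBump_le hv (norm_nonneg _) n
          rw [e1, mul_left_comm]
          gcongr
      _ = ENNReal.ofReal (M ^ (P - 1)) * ∑ j ∈ Finset.range n,
          ∫⁻ ξ : EuclideanSpace ℝ (Fin d),
            ENNReal.ofReal (‖ξ‖ ^ (-(d : ℝ)) * powerBump v (2 ^ j * ‖ξ‖)) := by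
          rw [lintegral_const_mul' _ _ ENNReal.ofReal_ne_top, lintegral_finsetSum]
          intro j _
          have := measurable_powerBump v
          fun_prop
      _ ≤ ENNReal.ofReal (M ^ (P - 1)) * ∑ j ∈ Finset.range n, (D : ℝ≥0∞) := by
          gcongr with j _
          exact hD _ (by positivity)
      _ ≤ _ := by
          rw [Finset.sum_const, Finset.card_range, nsmul_eq_mul, ← ENNReal.ofReal_coe_nnreal,
            ← ENNReal.ofReal_natCast, ← ENNReal.ofReal_mul (by positivity),
            ← ENNReal.ofReal_mul (by positivity)]
          apply ENNReal.ofReal_le_ofReal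
          rw [mul_assoc, mul_comm (n : ℝ)]
          gcongr
          linarith

lemma sum_rpow_le_rpow_sum {ι : Type*} (s : Finset ι) (f : ι → ℝ≥0∞) {r : ℝ} (hr : 1 ≤ r) :
    ∑ i ∈ s, f i ^ r ≤ (∑ i ∈ s, f i) ^ r := by
  classical
  induction s using Finset.induction_on with
  | empty => simp
  | insert i s hi ih =>
    rw [Finset.sum_insert hi, Finset.sum_insert hi]
    grw [ih]
    exact ENNReal.add_rpow_le_rpow_add _ _ hr

/-- Functions without cancellation have an additive `q`-th power lower bound. -/
lemma card_rpow_mul_le_eLpNorm_sum {α ι : Type*} [MeasurableSpace α] {μ : Measure α}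
    (s : Finset ι) {f : ι → α → ℂ} {q : ℝ≥0∞} (hq : 1 ≤ q) (hqt : q ≠ ∞)
    (hf : ∀ i x, f i x = ((‖f i x‖ : ℝ) : ℂ)) (hfm : ∀ i, Measurable (f i)) {D : ℝ≥0∞}
    (hD : ∀ i ∈ s, eLpNorm (f i) q μ = D) :
    (s.card : ℝ≥0∞) ^ (1/q).toReal * D ≤ eLpNorm (∑ i ∈ s, f i) q μ := by
  have hq0 : q ≠ 0 := by positivity
  have hQ1 : 1 ≤ q.toReal := by
    rw [← ENNReal.toReal_one]; exact ENNReal.toReal_mono hqt hq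
  have hQ0 : 0 < q.toReal := by linarith
  have hnorm (x) : ‖(∑ i ∈ s, f i) x‖ₑ = ∑ i ∈ s, ‖f i x‖ₑ := by
    have : (∑ i ∈ s, f i) x = ((∑ i ∈ s, ‖f i x‖ : ℝ) : ℂ) := by
      rw [Finset.sum_apply, Complex.ofReal_sum]
      exact Finset.sum_congr rfl fun i _ => hf i x
    rw [this, ← ofReal_norm, Complex.norm_real,
      Real.norm_of_nonneg (Finset.sum_nonneg fun _ _ => norm_nonneg _),
      ENNReal.ofReal_sum_of_nonneg fun _ _ => norm_nonneg _]
    exact Finset.sum_congr rfl fun i _ => ofReal_norm _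
  rw [← ENNReal.rpow_le_rpow_iff hQ0, ENNReal.mul_rpow_of_nonneg _ _ hQ0.le,
    ← ENNReal.rpow_mul, ENNReal.toReal_div, ENNReal.toReal_one, one_div_mul_cancel hQ0.ne',
    ENNReal.rpow_one, eLpNorm_eq_lintegral_rpow_enorm_toReal hq0 hqt, ← ENNReal.rpow_mul,
    one_div_mul_cancel hQ0.ne', ENNReal.rpow_one]
  calc _ = ∑ i ∈ s, ∫⁻ x, ‖f i x‖ₑ ^ q.toReal ∂μ := by
        rw [← nsmul_eq_mul, ← Finset.sum_const]
        refine Finset.sum_congr rfl fun i hi => ?_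
        rw [← hD i hi, eLpNorm_eq_lintegral_rpow_enorm_toReal hq0 hqt, ← ENNReal.rpow_mul,
          one_div_mul_cancel hQ0.ne', ENNReal.rpow_one]
    _ = ∫⁻ x, ∑ i ∈ s, ‖f i x‖ₑ ^ q.toReal ∂μ := by
        rw [lintegral_finsetSum _ fun i _ => (hfm i).enorm.pow_const _]
    _ ≤ _ := by
        refine lintegral_mono fun x => ?_
        rw [hnorm]
        exact sum_rpow_le_rpow_sum _ _ hQ1
end

section
variable {d : ℕ}

lemma exists_weight_mul_le_powerBump {B : ℝ × ℝ} (hB1 : 0 < B.1) (hB2 : 0 < B.2) {e : ℝ}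
    (he : 0 ≤ e) (f : 𝓢(EuclideanSpace ℝ (Fin d), ℂ)) :
    ∃ C : ℝ, 0 < C ∧ ∀ η, ‖η‖ ^ e * (‖η‖ ^ B.1 + ‖η‖ ^ B.2) * ‖f η‖ ≤
      C * powerBump (min B.1 B.2) ‖η‖ := by
  set v := min B.1 B.2 with hv
  have hv0 : 0 < v := lt_min hB1 hB2
  have hv1 : v ≤ B.1 := min_le_left _ _
  have hv2 : v ≤ B.2 := min_le_right _ _
  obtain ⟨k, hk⟩ := exists_nat_ge (e + B.1 + B.2 + v)
  obtain ⟨g, hg⟩ := exists_norm_eq_one_add_sq_pow_mul f (k + k + k + k)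
  obtain ⟨C, hC0, hC⟩ := g.decay 0 0
  simp only [pow_zero, one_mul, norm_iteratedFDeriv_zero] at hC
  refine ⟨2 * 4 * C, by positivity, fun η => ?_⟩
  set t := ‖η‖ with ht
  have ht0 : 0 ≤ t := norm_nonneg η
  set Y := (1 + t ^ 2) ^ k with hY
  have hY1 : 1 ≤ Y := one_le_pow₀ (by nlinarith)
  have b {a : ℝ} (h0 : 0 ≤ a) (h1 : a ≤ e + B.1 + B.2 + v) : t ^ a ≤ Y :=
    rpow_le_one_add_sq_pow ht0 h0 (h1.trans hk)
  have hs1 : t ^ B.1 = t ^ v * t ^ (B.1 - v) := by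
    rw [← Real.rpow_add' ht0 (by rw [add_sub_cancel]; exact hB1.ne'), add_sub_cancel]
  have hs2 : t ^ B.2 = t ^ v * t ^ (B.2 - v) := by
    rw [← Real.rpow_add' ht0 (by rw [add_sub_cancel]; exact hB2.ne'), add_sub_cancel]
  have htv : 0 ≤ t ^ v := by positivity
  have hgη : Y * Y * Y * Y * ‖f η‖ ≤ C := by
    have := hC η
    rwa [hg, pow_add, pow_add, pow_add] at this
  rw [powerBump, ← mul_div_assoc, le_div_iff₀ (by positivity), hs1, hs2]
  calc t ^ e * (t ^ v * t ^ (B.1 - v) + t ^ v * t ^ (B.2 - v)) * ‖f η‖ * (1 + t ^ v) ^ 2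
      ≤ Y * (t ^ v * Y + t ^ v * Y) * ‖f η‖ * (Y + Y) ^ 2 := by
        gcongr
        · exact b he (by linarith)
        · exact b (by linarith) (by linarith)
        · exact b (by linarith) (by linarith)
        · exact b (by linarith) (by linarith)
    _ = 2 * 4 * (Y * Y * Y * Y * ‖f η‖) * t ^ v := by ring
    _ ≤ _ := by gcongr

/-- Superposition of dyadic dilates of a fixed Schwartz function, normalized in `L^q`. -/
lemma exists_dyadic_superposition (G : 𝓢(EuclideanSpace ℝ (Fin d), ℂ)) (s : ℝ) (n : ℕ) :
    ∃ f : 𝓢(EuclideanSpace ℝ (Fin d), ℂ),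
      (⇑f = ∑ j ∈ Finset.range n, fun y =>
        ((((2 : ℝ) ^ j) ^ (-s) : ℝ) : ℂ) * G (((2 : ℝ) ^ j)⁻¹ • y)) ∧
      ∀ ξ, 𝓕 (⇑f) ξ = ∑ j ∈ Finset.range n,
        ((((2 : ℝ) ^ j) ^ (-s) * ((2 : ℝ) ^ j) ^ d : ℝ) : ℂ) * 𝓕 (⇑G) ((2 : ℝ) ^ j • ξ) := by
  have h2 (j : ℕ) : (0 : ℝ) < 2 ^ j := by positivity
  choose g hg using fun j : ℕ => exists_comp_smul G (inv_ne_zero (h2 j).ne')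
  have hgc (j) : (⇑(g j) : EuclideanSpace ℝ (Fin d) → ℂ) = fun y => G (((2 : ℝ) ^ j)⁻¹ • y) :=
    funext (hg j)
  refine ⟨∑ j ∈ Finset.range n, ((((2 : ℝ) ^ j) ^ (-s) : ℝ) : ℂ) • g j, ?_, fun ξ => ?_⟩
  · ext y
    rw [sum_apply, Finset.sum_apply]
    refine Finset.sum_congr rfl fun j _ => ?_
    rw [smul_apply, hg, smul_eq_mul]
  · rw [← SchwartzMap.fourier_coe, FourierTransform.fourier_sum, sum_apply]
    refine Finset.sum_congr rfl fun j _ => ?_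
    rw [FourierTransform.fourier_smul, smul_apply, SchwartzMap.fourier_coe, hgc,
      fourier_comp_smul _ (h2 j), smul_eq_mul, Complex.ofReal_mul, mul_assoc]

lemma exists_sum_rpow_le {a : ℝ} (ha : 0 < a) :
    ∃ C : ℝ, 0 < C ∧ ∀ n : ℕ, ∑ j ∈ Finset.range (n + 1), ((2 : ℝ) ^ j) ^ a ≤
      C * ((2 : ℝ) ^ n) ^ a := by
  set w : ℝ := 2 ^ a with hw
  have hw1 : 1 < w := Real.one_lt_rpow (by norm_num) ha
  have hw1' : 0 < w - 1 := by linarith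
  have hpow (j : ℕ) : ((2 : ℝ) ^ j) ^ a = w ^ j := by
    rw [hw, ← Real.rpow_natCast, ← Real.rpow_natCast, ← Real.rpow_mul (by norm_num),
      ← Real.rpow_mul (by norm_num), mul_comm]
  refine ⟨w / (w - 1), by positivity, fun n => ?_⟩
  simp only [hpow]
  rw [geom_sum_eq hw1.ne', div_mul_eq_mul_div, pow_succ']
  gcongr
  linarith

/-- Lower bound from superpositions of dyadic dilates, in the critical case. -/
lemma exists_le_Hsup_of_superposition [Nontrivial (EuclideanSpace ℝ (Fin d))] {q p : ℝ≥0∞}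
    (hq : 1 ≤ q) (hqp : q < p) {A B : ℝ × ℝ} (hA1 : 0 < A.1) (hA2 : 0 < A.2) (hB1 : 0 < B.1)
    (hB2 : 0 < B.2) (hm : B.1 + (d : ℝ) * ((1/p).toReal + (1/q).toReal - 1) = 0) :
    ∃ c : ℝ, 0 < c ∧ ∀ n : ℕ, ∀ x : ℝ, ((2 : ℝ) ^ n) ^ A.2 ≤ x →
      ENNReal.ofReal (c * ((n : ℝ) + 1) ^ ((1/q).toReal - (1/p).toReal)) ≤ Hsup d A B q p x := by
  have hqt : q ≠ ∞ := hqp.ne_top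
  have hp : 1 ≤ p := hq.trans hqp.le
  obtain ⟨G, hG, hGpos⟩ := exists_nonneg_schwartz d
  have hN0 := eLpNorm_ne_zero_of_ne_zero hG (q := q) (by positivity)
  have hNt := (G.memLp q volume).2.ne
  obtain ⟨K, hK, hdil⟩ := exists_dilation_bounds hA1 hA2 hB1 hB2 G q p
  obtain ⟨Cg, hCg, hgeom⟩ := exists_sum_rpow_le hA2
  obtain ⟨Cb, hCb, hbump⟩ := exists_weight_mul_le_powerBump hB1 hB2
    (e := (d : ℝ) * (1/p).toReal) (by positivity) (𝓕 G)
  obtain ⟨Cs, hCs, hsum⟩ := exists_eLpNorm_sum_powerBump_le (d := d) (lt_min hB1 hB2) hp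
  set iq := (1/q).toReal with hiq
  set ip := (1/p).toReal with hip
  have hip0 : 0 ≤ ip := ENNReal.toReal_nonneg
  have h2 (j : ℕ) : (0 : ℝ) < 2 ^ j := by positivity
  have h21 (j : ℕ) : (1 : ℝ) ≤ 2 ^ j := one_le_pow₀ (by norm_num)
  refine ⟨(K * Cg + Cb * Cs)⁻¹ * (eLpNorm G q volume).toReal,
    mul_pos (by positivity) (ENNReal.toReal_pos hN0 hNt), fun n x hx => ?_⟩
  obtain ⟨f, hf, hfF⟩ := exists_dyadic_superposition G (d * iq) (n + 1)
  set h : ℕ → EuclideanSpace ℝ (Fin d) → ℂ := fun j y =>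
    ((((2 : ℝ) ^ j) ^ (-(d * iq)) : ℝ) : ℂ) * G (((2 : ℝ) ^ j)⁻¹ • y) with hh
  have hn1 : (1 : ℝ) ≤ ((n : ℝ) + 1) ^ ip := Real.one_le_rpow (by linarith [n.cast_nonneg (α := ℝ)]) hip0
  have hlow : ENNReal.ofReal (((n : ℝ) + 1) ^ iq) * eLpNorm G q volume ≤ eLpNorm f q volume := by
    have := card_rpow_mul_le_eLpNorm_sum (μ := volume) (Finset.range (n + 1)) (f := h) hq hqt
      (D := eLpNorm G q volume) ?_ ?_ ?_
    · rw [hf]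
      refine le_trans (le_of_eq ?_) this
      rw [Finset.card_range, ← ENNReal.ofReal_natCast,
        ENNReal.ofReal_rpow_of_nonneg (by positivity) ENNReal.toReal_nonneg, Nat.cast_succ]
    · intro j y
      rw [hh]
      simp only [norm_mul, Complex.norm_real, Complex.ofReal_mul]
      rw [← hGpos, Real.norm_of_nonneg (by positivity)]
    · intro j
      have := G.continuous
      rw [hh]
      fun_prop
    · intro j _
      have e : h j = ((((2 : ℝ) ^ j) ^ (-(d * iq)) : ℝ) : ℂ) • fun y => G (((2 : ℝ) ^ j)⁻¹ • y) :=
        rfl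
      rw [e, eLpNorm_const_smul, eLpNorm_comp_smul (inv_pos.2 (h2 j)), ← mul_assoc, ← ofReal_norm,
        Complex.norm_real, Real.norm_of_nonneg (by positivity),
        ← ENNReal.ofReal_mul (by positivity), Real.inv_rpow (h2 j).le,
        mul_inv_cancel₀ (by positivity), ENNReal.ofReal_one, one_mul]
  have hA : eLpNorm (fun y => brokenWeight A y * ‖f y‖) q volume ≤
      ENNReal.ofReal (K * Cg * x) := by
    calc _ ≤ eLpNorm (∑ j ∈ Finset.range (n + 1), ((2 : ℝ) ^ j) ^ (-(d * iq)) •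
          fun y => brokenWeight A y * ‖G (((2 : ℝ) ^ j)⁻¹ • y)‖) q volume := by
          refine eLpNorm_mono fun y => ?_
          have h0 : 0 ≤ brokenWeight A y := brokenWeight_nonneg A y
          rw [Real.norm_of_nonneg (by positivity), hf, Finset.sum_apply, Finset.sum_apply]
          refine le_trans ?_ (le_abs_self _)
          grw [norm_sum_le]
          rw [Finset.mul_sum]
          refine (Finset.sum_congr rfl fun j _ => ?_).le
          simp only [Pi.smul_apply, smul_eq_mul, norm_mul, Complex.norm_real]
          rw [Real.norm_of_nonneg (by positivity)]
          ring
      _ ≤ ∑ j ∈ Finset.range (n + 1), eLpNorm (((2 : ℝ) ^ j) ^ (-(d * iq)) •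
          fun y => brokenWeight A y * ‖G (((2 : ℝ) ^ j)⁻¹ • y)‖) q volume := by
          refine eLpNorm_sum_le (fun j _ => ?_) hq
          have := G.continuous
          exact (aestronglyMeasurable_brokenWeight_mul A
            (f := fun y => G (((2 : ℝ) ^ j)⁻¹ • y)) (by fun_prop)).const_smul _
      _ ≤ ∑ j ∈ Finset.range (n + 1), ENNReal.ofReal (K * ((2 : ℝ) ^ j) ^ A.2) := by
          gcongr with j _
          rw [eLpNorm_const_smul, Real.enorm_of_nonneg (by positivity)]
          grw [(hdil _ (h2 j) A.2 B.1 (.inr ⟨h21 j, rfl, rfl⟩)).1]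
          rw [← ENNReal.ofReal_mul (by positivity), mul_left_comm, ← Real.rpow_add (h2 j)]
          apply le_of_eq; congr 3; ring
      _ ≤ _ := by
          rw [← ENNReal.ofReal_sum_of_nonneg fun _ _ => by positivity, ← Finset.mul_sum, mul_assoc]
          grw [hgeom n, hx]
  have hB : eLpNorm (fun ξ => brokenWeight B ξ * ‖𝓕 (⇑f) ξ‖) p volume ≤
      ENNReal.ofReal (Cb * Cs * ((n : ℝ) + 1) ^ ip) := by
    refine (eLpNorm_le_mul_eLpNorm_of_ae_le_mul (c := Cb) (g := fun ξ => ‖ξ‖ ^ (-((d : ℝ) * ip)) *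
        ∑ j ∈ Finset.range (n + 1), powerBump (min B.1 B.2) (2 ^ j * ‖ξ‖)) ?_ p).trans ?_
    · filter_upwards [ae_ne_zero] with ξ hξ
      have hξ' : 0 < ‖ξ‖ := norm_pos_iff.2 hξ
      have h0 : 0 ≤ brokenWeight B ξ := brokenWeight_nonneg B ξ
      rw [Real.norm_of_nonneg (by positivity), Real.norm_of_nonneg (mul_nonneg (by positivity)
        (Finset.sum_nonneg fun j _ => powerBump_nonneg _ (by positivity))), hfF]
      grw [norm_sum_le]
      rw [Finset.mul_sum, Finset.mul_sum, Finset.mul_sum]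
      refine Finset.sum_le_sum fun j _ => ?_
      rw [norm_mul, Complex.norm_real, Real.norm_of_nonneg (by positivity)]
      have hw := brokenWeight_smul_le hB2 (a := B.1) (inv_pos.2 (h2 j))
        (.inl ⟨inv_le_one_of_one_le₀ (h21 j), rfl⟩) ((2 : ℝ) ^ j • ξ)
      rw [inv_smul_smul₀ (h2 j).ne'] at hw
      have hb := hbump ((2 : ℝ) ^ j • ξ)
      rw [SchwartzMap.fourier_coe] at hb
      have hnorm : ‖(2 : ℝ) ^ j • ξ‖ = 2 ^ j * ‖ξ‖ := by
        rw [norm_smul, Real.norm_of_nonneg (h2 j).le]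
      rw [hnorm] at hb hw
      set W := (2 ^ j * ‖ξ‖) ^ B.1 + (2 ^ j * ‖ξ‖) ^ B.2 with hW
      set F := ‖𝓕 (⇑G) ((2 : ℝ) ^ j • ξ)‖ with hF
      rw [Real.mul_rpow (h2 j).le hξ'.le] at hb
      have hone : (((2 : ℝ) ^ j)⁻¹) ^ B.1 * (((2 : ℝ) ^ j) ^ (-(d * iq)) * ((2 : ℝ) ^ j) ^ d) =
          ((2 : ℝ) ^ j) ^ ((d : ℝ) * ip) := by
        rw [Real.inv_rpow (h2 j).le, ← Real.rpow_neg (h2 j).le, ← Real.rpow_natCast _ d,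
          ← Real.rpow_add (h2 j), ← Real.rpow_add (h2 j)]
        congr 1; linarith
      have hcancel : ‖ξ‖ ^ (-((d : ℝ) * ip)) * ‖ξ‖ ^ ((d : ℝ) * ip) = 1 := by
        rw [← Real.rpow_add hξ', neg_add_cancel, Real.rpow_zero]
      calc _ ≤ ((((2 : ℝ) ^ j)⁻¹) ^ B.1 * W) *
            (((2 : ℝ) ^ j) ^ (-(d * iq)) * ((2 : ℝ) ^ j) ^ d * F) := by gcongr
        _ = ((2 : ℝ) ^ j) ^ ((d : ℝ) * ip) * W * F := by rw [← hone]; ring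
        _ = (‖ξ‖ ^ (-((d : ℝ) * ip)) * ‖ξ‖ ^ ((d : ℝ) * ip)) *
            (((2 : ℝ) ^ j) ^ ((d : ℝ) * ip) * W * F) := by rw [hcancel, one_mul]
        _ = ‖ξ‖ ^ (-((d : ℝ) * ip)) *
            (((2 : ℝ) ^ j) ^ ((d : ℝ) * ip) * ‖ξ‖ ^ ((d : ℝ) * ip) * W * F) := by ring
        _ ≤ ‖ξ‖ ^ (-((d : ℝ) * ip)) * (Cb * powerBump (min B.1 B.2) (2 ^ j * ‖ξ‖)) := by gcongr
        _ = _ := by ring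
    · grw [hsum (n + 1) (by lia)]
      rw [← ENNReal.ofReal_mul hCb.le, Nat.cast_succ, mul_assoc]
  have hxpos : 0 < x := lt_of_lt_of_le (by positivity) hx
  have key := le_Hsup (A := A) (B := B) (q := q) (p := p) (x := x)
    (K := (K * Cg + Cb * Cs) * ((n : ℝ) + 1) ^ ip) (by positivity) f
    (hA.trans (ENNReal.ofReal_le_ofReal ?_)) (hB.trans (ENNReal.ofReal_le_ofReal ?_))
  · refine le_trans ?_ key
    grw [← hlow]
    rw [← ENNReal.ofReal_toReal hNt, ENNReal.toReal_ofReal ENNReal.toReal_nonneg,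
      ← ENNReal.ofReal_mul (by positivity), ← ENNReal.ofReal_mul (by positivity)]
    apply le_of_eq; congr 1
    rw [sub_eq_add_neg, Real.rpow_add (by positivity), Real.rpow_neg (by positivity), mul_inv]
    ring
  · gcongr ?_ * x
    calc K * Cg ≤ (K * Cg + Cb * Cs) * 1 := by nlinarith [mul_pos hCb hCs]
      _ ≤ _ := by gcongr
  · gcongr
    nlinarith [mul_pos hK hCg]

/-- The logarithmic lower bound for the extremal function. -/
lemma exists_le_Hsup_log [Nontrivial (EuclideanSpace ℝ (Fin d))] {q p : ℝ≥0∞}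
    (hq : 1 ≤ q) (hqp : q < p) {A B : ℝ × ℝ} (hA1 : 0 < A.1) (hA2 : 0 < A.2) (hB1 : 0 < B.1)
    (hB2 : 0 < B.2) (hm : B.1 + (d : ℝ) * ((1/p).toReal + (1/q).toReal - 1) = 0)
    (hs : 0 < (1/q).toReal - (1/p).toReal) :
    ∃ c : ℝ, 0 < c ∧ ∀ x : ℝ, 1 ≤ x →
      ENNReal.ofReal (c * Real.log (x + 1) ^ ((1/q).toReal - (1/p).toReal)) ≤
        Hsup d A B q p x := by
  obtain ⟨c, hc, h⟩ := exists_le_Hsup_of_superposition hq hqp hA1 hA2 hB1 hB2 hm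
  set s := (1/q).toReal - (1/p).toReal with hs_def
  have hl2 : 0 < Real.log 2 := Real.log_pos (by norm_num)
  set κ := Real.log 2 + A.2 * Real.log 2 with hκ
  have hκ0 : 0 < κ := by positivity
  refine ⟨c * κ⁻¹ ^ s, by positivity, fun x hx => ?_⟩
  have hx0 : 0 < x := by linarith
  have hlx : 0 ≤ Real.log x := Real.log_nonneg hx
  have hl : 0 ≤ Real.log (x + 1) := Real.log_nonneg (by linarith)
  have hAl : 0 < A.2 * Real.log 2 := by positivity
  set n := ⌊Real.log x / (A.2 * Real.log 2)⌋₊ with hn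
  have hn1 : (n : ℝ) * (A.2 * Real.log 2) ≤ Real.log x := by
    rw [← le_div_iff₀ hAl]; exact Nat.floor_le (by positivity)
  have hn2 : Real.log x ≤ ((n : ℝ) + 1) * (A.2 * Real.log 2) := by
    rw [← div_le_iff₀ hAl]; exact (Nat.lt_floor_add_one _).le
  refine (ENNReal.ofReal_le_ofReal ?_).trans (h n x ?_)
  · rw [mul_assoc, ← Real.mul_rpow (by positivity) hl]
    gcongr
    rw [inv_mul_le_iff₀ hκ0]
    calc Real.log (x + 1) ≤ Real.log (2 * x) := Real.log_le_log (by linarith) (by linarith)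
      _ = Real.log 2 + Real.log x := Real.log_mul (by norm_num) hx0.ne'
      _ ≤ _ := by
        rw [hκ]
        nlinarith [mul_nonneg n.cast_nonneg (α := ℝ) hl2.le]
  · rw [← Real.log_le_log_iff (by positivity) hx0, Real.log_rpow (by positivity), Real.log_pow]
    linarith
end

/-- Theorem 3.1, item (2): for `1 ≤ q < p ≤ ∞` with `max(q,p') ≥ 2` and
`B₂ > d(1−1/p−1/q)`, the asymptotics of the extremal function `H`. -/
theorem Hsup_asymptotics_q_lt_p
    (d : ℕ) (hd : 1 ≤ d) (p q p' : ℝ≥0∞) (hq : 1 ≤ q) (hqp : q < p)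
    (hconj : 1/p + 1/p' = 1) (hmax : 2 ≤ q ∨ 2 ≤ p')
    (A B : ℝ × ℝ) (hA1 : 0 < A.1) (hA2 : 0 < A.2) (hB1 : 0 < B.1) (hB2 : 0 < B.2)
    (hB2' : (d : ℝ) * (1 - (1/p).toReal - (1/q).toReal) < B.2) :
    ∃ c C : ℝ, 0 < c ∧ 0 < C ∧ ∀ x : ℝ, 0 < x →
      ((B.1 + (d : ℝ) * ((1/p).toReal + (1/q).toReal - 1) ≠ 0 →
          (x < 1 →
            Approx (Hsup d A B q p x) c C
              (x ^ ((B.2 + (d : ℝ) * ((1/p).toReal + (1/q).toReal - 1)) /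
                (A.1 + (B.2 + (d : ℝ) * ((1/p).toReal + (1/q).toReal - 1)))))) ∧
          (1 ≤ x →
            Approx (Hsup d A B q p x) c C
              (x ^ (max (B.1 + (d : ℝ) * ((1/p).toReal + (1/q).toReal - 1)) 0 /
                (A.2 + max (B.1 + (d : ℝ) * ((1/p).toReal + (1/q).toReal - 1)) 0))))) ∧
        (B.1 + (d : ℝ) * ((1/p).toReal + (1/q).toReal - 1) = 0 →
          (x < 1 →
            Approx (Hsup d A B q p x) c C
              (x ^ ((B.2 + (d : ℝ) * ((1/p).toReal + (1/q).toReal - 1)) /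
                (A.1 + (B.2 + (d : ℝ) * ((1/p).toReal + (1/q).toReal - 1)))))) ∧
          (1 ≤ x →
            Approx (Hsup d A B q p x) c C
              (Real.log (x + 1) ^ ((1/q).toReal - (1/p).toReal))))) := by
  have : Nontrivial (EuclideanSpace ℝ (Fin d)) :=
    Module.nontrivial_of_finrank_pos (R := ℝ) (by simp; lia)
  have hqt : q ≠ ∞ := hqp.ne_top
  have hs : 0 < (1/q).toReal - (1/p).toReal := by
    rw [sub_pos, ENNReal.toReal_lt_toReal]
    · simpa [one_div] using ENNReal.inv_lt_inv.2 hqp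
    · simpa [one_div] using (hq.trans hqp.le).trans_lt' one_pos |>.ne'
    · simpa [one_div] using (one_pos.trans_le hq).ne'
  have hm₂0 : 0 < B.2 + (d : ℝ) * ((1/p).toReal + (1/q).toReal - 1) := by linarith
  obtain ⟨C, hC, hup⟩ := exists_Hsup_le hd hq hqp hconj hmax hA1 hA2 hB1 hB2 rfl rfl hm₂0 hs
  obtain ⟨c₁, hc₁, hlow⟩ := exists_le_Hsup_rpow (d := d) (p := p) hq hA1 hA2 hB1 hB2 rfl rfl hm₂0
  by_cases hm : B.1 + (d : ℝ) * ((1/p).toReal + (1/q).toReal - 1) = 0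
  · obtain ⟨c₂, hc₂, hlog⟩ := exists_le_Hsup_log hq hqp hA1 hA2 hB1 hB2 hm hs
    refine ⟨min c₁ c₂, C, lt_min hc₁ hc₂, hC, fun x hx => ⟨fun h => absurd hm h, fun _ =>
      ⟨fun hx1 => ⟨le_trans ?_ ((hlow x hx).1 hx1), (hup x hx).1 hx1⟩,
        fun hx1 => ⟨le_trans ?_ (hlog x hx1), (hup x hx).2.2 hx1 hm⟩⟩⟩⟩
    · gcongr
      exact min_le_left _ _
    · have : 0 ≤ Real.log (x + 1) := Real.log_nonneg (by linarith)
      gcongr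
      exact min_le_right _ _
  · exact ⟨c₁, C, hc₁, hC, fun x hx => ⟨fun _ =>
      ⟨fun hx1 => ⟨(hlow x hx).1 hx1, (hup x hx).1 hx1⟩,
        fun hx1 => ⟨(hlow x hx).2 hx1, (hup x hx).2.1 hx1 hm⟩⟩, fun h => absurd h hm⟩⟩
end

section
/- Let d ≥ 1, 2 ≤ p ≤ ∞, and let A = (A₁,A₂), B = (B₁,B₂) be pairs of positive reals. Suppose there is a constant C such that ‖f‖_p ‖f̂‖_{p′} ≤ C ‖ x^A f ‖_p ‖ ξ^B f̂ ‖_{p′} for all Schwartz functions f on ℝ^d. Then: (i) for every λ > 0 and every Schwartz f, ( λ^{−pA₁} ∫_{|x|≤λ} |f|^p |x|^{pA₁} dx + λ^{−pA₂} ∫_{|x|≥λ} |f|^p |x|^{pA₂} dx )^{1/p} · ( λ^{p′B₁} ∫_{|ξ|≤1/λ} |f̂|^{p′} |ξ|^{p′B₁} dξ + λ^{p′B₂} ∫_{|ξ|≥1/λ} |f̂|^{p′} |ξ|^{p′B₂} dξ )^{1/p′} ≳ ‖f‖_p ‖f̂‖_{p′}, with constant independent of λ and f; (ii) A₁ ≤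 B₂ and B₁ ≤ A₂; (iii) if A₂ = B₁, then the inequality also holds (with some constant) with A replaced by (A₂,A₂) and B by (B₁,B₁); (iv) if A₁ = B₂, then it also holds with A replaced by (A₁,A₁) and B by (B₂,B₂). -/
open MeasureTheory
open scoped ENNReal FourierTransform

/-- The rescaled broken power weight with breakpoint `λ`:
`(|x|/λ)^{A₁}` for `|x| < λ` and `(|x|/λ)^{A₂}` for `|x| ≥ λ`. -/
noncomputable def scaledBrokenWeight {d : ℕ} (A : ℝ × ℝ) (l : ℝ)
    (x : EuclideanSpace ℝ (Fin d)) : ℝ :=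
  if ‖x‖ < l then (‖x‖ / l) ^ A.1 else (‖x‖ / l) ^ A.2

lemma scaledBrokenWeight_nonneg {d : ℕ} (A : ℝ × ℝ) {l : ℝ} (hl : 0 < l)
    (x : EuclideanSpace ℝ (Fin d)) : 0 ≤ scaledBrokenWeight A l x := by
  unfold scaledBrokenWeight
  split_ifs <;> positivity

lemma scaledBrokenWeight_smul {d : ℕ} (A : ℝ × ℝ) {l : ℝ} (hl : 0 < l)
    (x : EuclideanSpace ℝ (Fin d)) :
    scaledBrokenWeight A l (l • x) = brokenWeight A x := by
  have h : ‖x‖ * l < l ↔ ‖x‖ < 1 := by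
    rw [mul_comm]; exact mul_lt_iff_lt_one_right hl
  simp only [scaledBrokenWeight, brokenWeight, norm_smul, Real.norm_of_nonneg hl.le,
    mul_comm l, h, mul_div_cancel_right₀ _ hl.ne']

lemma rpow_mul_div_rpow {a m t l : ℝ} (hl : 0 < l) (ht : 0 ≤ t) :
    l ^ a * (t / l) ^ m = l ^ (a - m) * t ^ m := by
  rw [Real.div_rpow ht hl.le, Real.rpow_sub hl]
  ring

/-- The inner power dominates: the outer part is controlled by a higher power `|x|^m`. -/
lemma rpow_fst_mul_scaledBrokenWeight_le {d : ℕ} (A : ℝ × ℝ) {l m : ℝ} (hl : 0 < l)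
    (hm : A.2 ≤ m) (x : EuclideanSpace ℝ (Fin d)) :
    l ^ A.1 * scaledBrokenWeight A l x ≤ ‖x‖ ^ A.1 + l ^ (A.1 - m) * ‖x‖ ^ m := by
  unfold scaledBrokenWeight
  split_ifs with h
  · rw [rpow_mul_div_rpow hl (norm_nonneg x), sub_self, Real.rpow_zero, one_mul]
    exact le_add_of_nonneg_right (by positivity)
  · rw [← rpow_mul_div_rpow hl (norm_nonneg x)]
    have h1 : 1 ≤ ‖x‖ / l := (one_le_div hl).2 (not_lt.1 h)
    have h2 := Real.rpow_le_rpow_of_exponent_le h1 hm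
    calc l ^ A.1 * (‖x‖ / l) ^ A.2 ≤ l ^ A.1 * (‖x‖ / l) ^ m := by gcongr
      _ ≤ _ := le_add_of_nonneg_left (by positivity)

/-- The outer power dominates: the inner part is bounded by a constant. -/
lemma rpow_snd_mul_scaledBrokenWeight_le {d : ℕ} (A : ℝ × ℝ) {l : ℝ} (hl : 0 < l)
    (hA : 0 ≤ A.1) (x : EuclideanSpace ℝ (Fin d)) :
    l ^ A.2 * scaledBrokenWeight A l x ≤
      ‖x‖ ^ A.2 + l ^ (A.2 - 0) * ‖x‖ ^ (0 : ℝ) := by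
  unfold scaledBrokenWeight
  split_ifs with h
  · rw [← rpow_mul_div_rpow hl (norm_nonneg x), Real.rpow_zero]
    have h1 : (‖x‖ / l) ^ A.1 ≤ 1 :=
      Real.rpow_le_one (by positivity) ((div_le_one hl).2 h.le) hA
    calc l ^ A.2 * (‖x‖ / l) ^ A.1 ≤ l ^ A.2 * 1 := by gcongr
      _ ≤ _ := le_add_of_nonneg_left (by positivity)
  · rw [rpow_mul_div_rpow hl (norm_nonneg x), sub_self, Real.rpow_zero, one_mul]
    exact le_add_of_nonneg_right (by positivity)

lemma eLpNorm_rpow_norm_mul_lt_top {d : ℕ} (q : ℝ≥0∞)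
    (g : SchwartzMap (EuclideanSpace ℝ (Fin d)) ℂ) (m : ℝ) (hm : 0 ≤ m) :
    eLpNorm (fun x => ‖x‖ ^ m * ‖g x‖) q volume < ∞ := by
  have hT := Function.hasTemperateGrowth_one_add_norm_sq_rpow
    (EuclideanSpace ℝ (Fin d)) m
  refine lt_of_le_of_lt (eLpNorm_mono fun x => ?_)
    ((SchwartzMap.smulLeftCLM ℂ
      (fun x : EuclideanSpace ℝ (Fin d) => (1 + ‖x‖ ^ 2) ^ m) g).eLpNorm_lt_top q volume)
  rw [SchwartzMap.smulLeftCLM_apply_apply hT, norm_smul, norm_mul, norm_norm]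
  gcongr
  rw [Real.norm_of_nonneg (by positivity), Real.norm_of_nonneg (by positivity)]
  exact Real.rpow_le_rpow (norm_nonneg x) (by nlinarith [sq_nonneg (‖x‖ - 1)]) hm

lemma ofReal_rpow_mul_eLpNorm_scaledBrokenWeight_le {d : ℕ} {q : ℝ≥0∞} (hq : 1 ≤ q)
    {g : EuclideanSpace ℝ (Fin d) → ℂ} (hg : Continuous g) (A : ℝ × ℝ) {l a m : ℝ}
    (hl : 0 < l) (ha : 0 ≤ a) (hm : 0 ≤ m)
    (h : ∀ x : EuclideanSpace ℝ (Fin d),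
      l ^ a * scaledBrokenWeight A l x ≤ ‖x‖ ^ a + l ^ (a - m) * ‖x‖ ^ m) :
    ENNReal.ofReal (l ^ a) * eLpNorm (fun x => scaledBrokenWeight A l x * ‖g x‖) q volume ≤
      eLpNorm (fun x => ‖x‖ ^ a * ‖g x‖) q volume +
        ENNReal.ofReal (l ^ (a - m)) * eLpNorm (fun x => ‖x‖ ^ m * ‖g x‖) q volume := by
  have hmeas : ∀ s : ℝ, 0 ≤ s → Continuous
      (fun x : EuclideanSpace ℝ (Fin d) => ‖x‖ ^ s * ‖g x‖) := fun s hs =>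
    (continuous_norm.rpow_const fun _ => Or.inr hs).mul hg.norm
  have hsmul : ∀ (s : ℝ) (u : EuclideanSpace ℝ (Fin d) → ℝ),
      ENNReal.ofReal (l ^ s) * eLpNorm u q volume = eLpNorm ((l ^ s) • u) q volume := by
    intro s u
    rw [eLpNorm_const_smul, Real.enorm_of_nonneg (by positivity)]
  rw [hsmul, hsmul]
  refine le_trans (eLpNorm_mono_real (fun x => ?_)) (eLpNorm_add_le
    (hmeas a ha).aestronglyMeasurable
    ((hmeas m hm).const_smul (l ^ (a - m))).aestronglyMeasurable hq)
  have hw := scaledBrokenWeight_nonneg A hl x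
  simp only [Pi.smul_apply, Pi.add_apply, smul_eq_mul]
  rw [Real.norm_of_nonneg (by positivity), ← mul_assoc, ← mul_assoc, ← add_mul]
  gcongr
  exact h x

lemma eLpNorm_comp_const_smul {d : ℕ} {F : Type*} [NormedAddCommGroup F]
    (q : ℝ≥0∞) (g : EuclideanSpace ℝ (Fin d) → F) {l : ℝ} (hl : 0 < l) :
    eLpNorm (fun x => g (l • x)) q volume =
      ENNReal.ofReal |(l ^ d)⁻¹| ^ (1 / q).toReal * eLpNorm g q volume := by
  have he : MeasurableEmbedding (fun x : EuclideanSpace ℝ (Fin d) => l • x) :=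
    (Homeomorph.smulOfNeZero l hl.ne').measurableEmbedding
  have h := he.eLpNorm_map_measure (g := g) (p := q) (μ := volume)
  rw [Measure.map_addHaar_smul volume hl.ne',
    eLpNorm_smul_measure_of_ne_zero (by simpa using pow_pos (abs_pos.2 hl.ne') _), finrank_euclideanSpace_fin] at h
  exact h.symm

lemma fourier_comp_const_smul {d : ℕ} (g : EuclideanSpace ℝ (Fin d) → ℂ) {l : ℝ} (hl : 0 < l)
    (ξ : EuclideanSpace ℝ (Fin d)) :
    𝓕 (fun x => g (l • x)) ξ = |(l ^ d)⁻¹| • 𝓕 g (l⁻¹ • ξ) := by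
  have h := Measure.integral_comp_smul volume
    (fun v : EuclideanSpace ℝ (Fin d) => Real.fourierChar (-inner ℝ v (l⁻¹ • ξ)) • g v) l
  rw [finrank_euclideanSpace_fin] at h
  rw [Real.fourier_eq, Real.fourier_eq, ← h]
  congr 1 with x
  rw [real_inner_smul_left, real_inner_smul_right, mul_inv_cancel_left₀ hl.ne']

/-- Applying the inequality to the dilates of `f` moves the breakpoints to `l` and `l⁻¹`. -/
lemma eLpNorm_mul_le_scaledBrokenWeight {d : ℕ} {p p' : ℝ≥0∞} {A B : ℝ × ℝ} {c : ℝ≥0∞}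
    (hmain : ∀ f : SchwartzMap (EuclideanSpace ℝ (Fin d)) ℂ,
      eLpNorm (⇑f) p volume * eLpNorm (𝓕 (⇑f)) p' volume ≤ c *
        (eLpNorm (fun x => brokenWeight A x * ‖f x‖) p volume *
          eLpNorm (fun ξ => brokenWeight B ξ * ‖𝓕 (⇑f) ξ‖) p' volume))
    {l : ℝ} (hl : 0 < l) (f : SchwartzMap (EuclideanSpace ℝ (Fin d)) ℂ) :
    eLpNorm (⇑f) p volume * eLpNorm (𝓕 (⇑f)) p' volume ≤ c *
      (eLpNorm (fun x => scaledBrokenWeight A l x * ‖f x‖) p volume *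
        eLpNorm (fun ξ => scaledBrokenWeight B l⁻¹ ξ * ‖𝓕 (⇑f) ξ‖) p' volume) := by
  have hl' : 0 < l⁻¹ := inv_pos.2 hl
  have h := hmain (SchwartzMap.compCLMOfContinuousLinearEquiv ℂ
    (ContinuousLinearEquiv.smulLeft (Units.mk0 l hl.ne')) f)
  have hf : ⇑(SchwartzMap.compCLMOfContinuousLinearEquiv ℂ
      (ContinuousLinearEquiv.smulLeft (Units.mk0 l hl.ne')) f) = fun x => f (l • x) := rfl
  have hF : 𝓕 (fun x => f (l • x)) = |(l ^ d)⁻¹| • fun ξ => 𝓕 (⇑f) (l⁻¹ • ξ) :=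
    funext fun ξ => fourier_comp_const_smul f hl ξ
  have hA : (fun x => brokenWeight A x * ‖f (l • x)‖) =
      fun x => (fun y => scaledBrokenWeight A l y * ‖f y‖) (l • x) := by
    funext x
    rw [← scaledBrokenWeight_smul A hl]
  have hB : (fun ξ => brokenWeight B ξ * ‖(|(l ^ d)⁻¹| • fun ξ => 𝓕 (⇑f) (l⁻¹ • ξ)) ξ‖) =
      |(l ^ d)⁻¹| •
        fun ξ => (fun η => scaledBrokenWeight B l⁻¹ η * ‖𝓕 (⇑f) η‖) (l⁻¹ • ξ) := by
    funext ξ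
    simp only [Pi.smul_apply, norm_smul, smul_eq_mul, Real.norm_eq_abs, abs_abs,
      scaledBrokenWeight_smul B hl']
    ring
  rw [hf, hF, hA, hB, eLpNorm_const_smul, eLpNorm_const_smul, eLpNorm_comp_const_smul p f hl,
    eLpNorm_comp_const_smul p (fun y => scaledBrokenWeight A l y * ‖f y‖) hl,
    eLpNorm_comp_const_smul p' (𝓕 (⇑f)) hl',
    eLpNorm_comp_const_smul p' (fun η => scaledBrokenWeight B l⁻¹ η * ‖𝓕 (⇑f) η‖) hl'] at h
  have hpow : ∀ (q : ℝ≥0∞) (t : ℝ), 0 < t →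
      ENNReal.ofReal |(t ^ d)⁻¹| ^ (1 / q).toReal ≠ 0 ∧
        ENNReal.ofReal |(t ^ d)⁻¹| ^ (1 / q).toReal ≠ ∞ := fun q t ht =>
    ⟨(ENNReal.rpow_pos (by simpa using pow_pos (abs_pos.2 ht.ne') d) ENNReal.ofReal_ne_top).ne',
      ENNReal.rpow_ne_top_of_nonneg ENNReal.toReal_nonneg ENNReal.ofReal_ne_top⟩
  obtain ⟨h1, h1'⟩ := hpow p l hl
  obtain ⟨h2, h2'⟩ := hpow p' l⁻¹ hl'
  have h3 : ‖|(l ^ d)⁻¹|‖ₑ ≠ 0 := by simp [hl.ne']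
  have h3' : ‖|(l ^ d)⁻¹|‖ₑ ≠ ∞ := enorm_ne_top
  generalize ENNReal.ofReal |(l ^ d)⁻¹| ^ (1 / p).toReal = s at *
  generalize ENNReal.ofReal |((l⁻¹) ^ d)⁻¹| ^ (1 / p').toReal = t at *
  generalize ‖|(l ^ d)⁻¹|‖ₑ = r at *
  refine (ENNReal.mul_le_mul_iff_right (a := s * (r * t))
    (mul_ne_zero h1 (mul_ne_zero h3 h2))
    (ENNReal.mul_ne_top h1' (ENNReal.mul_ne_top h3' h2'))).1 ?_
  convert h using 1 <;> ring

/-- Passing to the limit in the rescaled inequality. -/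
lemma eLpNorm_mul_le_of_tendsto {d : ℕ} {p p' : ℝ≥0∞} (hp : 1 ≤ p) (hp' : 1 ≤ p')
    {A B : ℝ × ℝ} {C a b m k κ : ℝ} (ha : 0 ≤ a) (hb : 0 ≤ b) (hm : 0 ≤ m) (hk : 0 ≤ k)
    {f : SchwartzMap (EuclideanSpace ℝ (Fin d)) ℂ}
    (hscaled : ∀ l : ℝ, 0 < l →
      eLpNorm (⇑f) p volume * eLpNorm (𝓕 (⇑f)) p' volume ≤ ENNReal.ofReal C *
        (eLpNorm (fun x => scaledBrokenWeight A l x * ‖f x‖) p volume *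
          eLpNorm (fun ξ => scaledBrokenWeight B l⁻¹ ξ * ‖𝓕 (⇑f) ξ‖) p' volume))
    (hwA : ∀ (l : ℝ) (x : EuclideanSpace ℝ (Fin d)), 0 < l →
      l ^ a * scaledBrokenWeight A l x ≤ ‖x‖ ^ a + l ^ (a - m) * ‖x‖ ^ m)
    (hwB : ∀ (l : ℝ) (x : EuclideanSpace ℝ (Fin d)), 0 < l →
      l ^ b * scaledBrokenWeight B l x ≤ ‖x‖ ^ b + l ^ (b - k) * ‖x‖ ^ k)
    (L : Filter ℝ) [L.NeBot] (hpos : ∀ᶠ l in L, 0 < l)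
    (hma : Filter.Tendsto (fun l : ℝ => l ^ (a - m)) L (nhds 0))
    (hkb : Filter.Tendsto (fun l : ℝ => l⁻¹ ^ (b - k)) L (nhds 0))
    (hκ : Filter.Tendsto (fun l : ℝ => l ^ (b - a)) L (nhds κ)) :
    eLpNorm (⇑f) p volume * eLpNorm (𝓕 (⇑f)) p' volume ≤ ENNReal.ofReal κ *
      (ENNReal.ofReal C * (eLpNorm (fun x => ‖x‖ ^ a * ‖f x‖) p volume *
        eLpNorm (fun ξ => ‖ξ‖ ^ b * ‖𝓕 (⇑f) ξ‖) p' volume)) := by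
  have hX : ∀ s : ℝ, 0 ≤ s → eLpNorm (fun x => ‖x‖ ^ s * ‖f x‖) p volume ≠ ∞ :=
    fun s hs => (eLpNorm_rpow_norm_mul_lt_top p f s hs).ne
  have hY : ∀ s : ℝ, 0 ≤ s → eLpNorm (fun ξ => ‖ξ‖ ^ s * ‖𝓕 (⇑f) ξ‖) p' volume ≠ ∞ :=
    fun s hs => (eLpNorm_rpow_norm_mul_lt_top p' (𝓕 f) s hs).ne
  have hA := hX a ha
  have hB := hY b hb
  have lim : ∀ {u : ℝ → ℝ} (X Y : ℝ≥0∞), Y ≠ ∞ → Filter.Tendsto u L (nhds 0) →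
      Filter.Tendsto (fun l => X + ENNReal.ofReal (u l) * Y) L (nhds X) := by
    intro u X Y hY hu
    have := ENNReal.Tendsto.mul_const (ENNReal.tendsto_ofReal hu) (Or.inr hY)
    simpa using this.const_add X
  have hlimA := lim (eLpNorm (fun x => ‖x‖ ^ a * ‖f x‖) p volume) _ (hX m hm) hma
  have hlimB := lim (eLpNorm (fun ξ => ‖ξ‖ ^ b * ‖𝓕 (⇑f) ξ‖) p' volume) _ (hY k hk) hkb
  have hlim := ENNReal.Tendsto.mul (ENNReal.tendsto_ofReal hκ)
    (Or.inr (ENNReal.mul_ne_top ENNReal.ofReal_ne_top (ENNReal.mul_ne_top hA hB)))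
    (ENNReal.Tendsto.const_mul (a := ENNReal.ofReal C)
      (ENNReal.Tendsto.mul hlimA (Or.inr hB) hlimB (Or.inr hA))
      (Or.inr ENNReal.ofReal_ne_top)) (Or.inr ENNReal.ofReal_ne_top)
  refine ge_of_tendsto hlim (hpos.mono fun l hl => ?_)
  have hl' : 0 < l⁻¹ := inv_pos.2 hl
  have hone : ENNReal.ofReal (l ^ (b - a)) *
      (ENNReal.ofReal (l ^ a) * ENNReal.ofReal (l⁻¹ ^ b)) = 1 := by
    rw [← ENNReal.ofReal_mul (by positivity), ← ENNReal.ofReal_mul (by positivity),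
      Real.rpow_sub hl, Real.inv_rpow hl.le]
    have := (Real.rpow_pos_of_pos hl a).ne'
    have := (Real.rpow_pos_of_pos hl b).ne'
    rw [← ENNReal.ofReal_one]
    congr 1
    field_simp
  calc eLpNorm (⇑f) p volume * eLpNorm (𝓕 (⇑f)) p' volume
      ≤ _ := hscaled l hl
    _ = ENNReal.ofReal (l ^ (b - a)) * (ENNReal.ofReal C *
        ((ENNReal.ofReal (l ^ a) *
          eLpNorm (fun x => scaledBrokenWeight A l x * ‖f x‖) p volume) *
        (ENNReal.ofReal (l⁻¹ ^ b) *
          eLpNorm (fun ξ => scaledBrokenWeight B l⁻¹ ξ * ‖𝓕 (⇑f) ξ‖) p' volume))) := by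
      rw [← one_mul (ENNReal.ofReal C * _), ← hone]
      ring
    _ ≤ _ := by
      gcongr
      · exact ofReal_rpow_mul_eLpNorm_scaledBrokenWeight_le hp f.continuous A hl ha hm
          fun x => hwA l x hl
      · exact ofReal_rpow_mul_eLpNorm_scaledBrokenWeight_le hp' (𝓕 f).continuous B hl' hb hk
          fun x => hwB l⁻¹ x hl'

lemma SchwartzMap.exists_ne_zero (E : Type*) [NormedAddCommGroup E] [InnerProductSpace ℝ E]
    [FiniteDimensional ℝ E] : ∃ f : SchwartzMap E ℂ, f ≠ 0 := by
  let u : ContDiffBump (0 : E) := ⟨1, 2, one_pos, one_lt_two⟩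
  have hu : HasCompactSupport (fun x => (u x : ℂ)) :=
    u.hasCompactSupport.comp_left Complex.ofReal_zero
  refine ⟨hu.toSchwartzMap (Complex.ofRealCLM.contDiff.comp u.contDiff), fun h => ?_⟩
  have h0 := DFunLike.congr_fun h 0
  have h1 : u 0 = 1 := u.one_of_mem_closedBall (by simp [u.rIn_pos.le])
  have h2 : ((u 0 : ℝ) : ℂ) = 0 := h0
  simp [h1] at h2

lemma SchwartzMap.eLpNorm_ne_zero {d : ℕ} {q : ℝ≥0∞} (hq : q ≠ 0)
    {f : SchwartzMap (EuclideanSpace ℝ (Fin d)) ℂ} (hf : f ≠ 0) :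
    eLpNorm (⇑f) q volume ≠ 0 := by
  rw [Ne, eLpNorm_eq_zero_iff f.continuous.aestronglyMeasurable hq]
  intro h
  exact hf (DFunLike.coe_injective ((f.continuous.ae_eq_iff_eq _ continuous_const).1 h))

/-- Lemma 4.1: consequences of the symmetric uncertainty inequality
`‖f‖_p ‖f̂‖_{p'} ≲ ‖x^A f‖_p ‖ξ^B f̂‖_{p'}` with broken power weights. -/
theorem symmetric_uncertainty_scaling_consequences
    (d : ℕ) (hd : 1 ≤ d) (p p' : ℝ≥0∞) (hp : 2 ≤ p) (hconj : 1/p + 1/p' = 1)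
    (A B : ℝ × ℝ) (hA1 : 0 < A.1) (hA2 : 0 < A.2) (hB1 : 0 < B.1) (hB2 : 0 < B.2)
    (C : ℝ) (hC : 0 < C)
    (hmain : ∀ f : SchwartzMap (EuclideanSpace ℝ (Fin d)) ℂ,
      eLpNorm (⇑f) p volume * eLpNorm (𝓕 (⇑f)) p' volume ≤ ENNReal.ofReal C *
        (eLpNorm (fun x => brokenWeight A x * ‖f x‖) p volume *
          eLpNorm (fun ξ => brokenWeight B ξ * ‖𝓕 (⇑f) ξ‖) p' volume)) :
    -- (i) the rescaled inequality, uniformly in λ > 0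
    (∃ c : ℝ, 0 < c ∧ ∀ l : ℝ, 0 < l → ∀ f : SchwartzMap (EuclideanSpace ℝ (Fin d)) ℂ,
      eLpNorm (⇑f) p volume * eLpNorm (𝓕 (⇑f)) p' volume ≤ ENNReal.ofReal c *
        (eLpNorm (fun x => scaledBrokenWeight A l x * ‖f x‖) p volume *
          eLpNorm (fun ξ => scaledBrokenWeight B l⁻¹ ξ * ‖𝓕 (⇑f) ξ‖) p' volume)) ∧
    -- (ii) necessary relations between the exponents
    (A.1 ≤ B.2 ∧ B.1 ≤ A.2) ∧
    -- (iii) the case A₂ = B₁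
    (A.2 = B.1 →
      ∃ C' : ℝ, 0 < C' ∧ ∀ f : SchwartzMap (EuclideanSpace ℝ (Fin d)) ℂ,
        eLpNorm (⇑f) p volume * eLpNorm (𝓕 (⇑f)) p' volume ≤ ENNReal.ofReal C' *
          (eLpNorm (fun x => brokenWeight (A.2, A.2) x * ‖f x‖) p volume *
            eLpNorm (fun ξ => brokenWeight (B.1, B.1) ξ * ‖𝓕 (⇑f) ξ‖) p' volume)) ∧
    -- (iv) the case A₁ = B₂
    (A.1 = B.2 →
      ∃ C' : ℝ, 0 < C' ∧ ∀ f : SchwartzMap (EuclideanSpace ℝ (Fin d)) ℂ,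
        eLpNorm (⇑f) p volume * eLpNorm (𝓕 (⇑f)) p' volume ≤ ENNReal.ofReal C' *
          (eLpNorm (fun x => brokenWeight (A.1, A.1) x * ‖f x‖) p volume *
            eLpNorm (fun ξ => brokenWeight (B.2, B.2) ξ * ‖𝓕 (⇑f) ξ‖) p' volume)) := by
  have hp1 : 1 ≤ p := one_le_two.trans hp
  have hp1' : 1 ≤ p' := by
    have h : 1 / p' ≤ 1 := le_add_self.trans_eq hconj
    simpa using h
  have hscaled := fun (f : SchwartzMap (EuclideanSpace ℝ (Fin d)) ℂ) (l : ℝ) (hl : 0 < l) =>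
    eLpNorm_mul_le_scaledBrokenWeight hmain hl f
  obtain ⟨f₀, hf₀⟩ := SchwartzMap.exists_ne_zero (EuclideanSpace ℝ (Fin d))
  have hne : eLpNorm (⇑f₀) p volume * eLpNorm (𝓕 (⇑f₀)) p' volume ≠ 0 := by
    refine mul_ne_zero (SchwartzMap.eLpNorm_ne_zero (one_pos.trans_le hp1).ne' hf₀)
      (SchwartzMap.eLpNorm_ne_zero (f := 𝓕 f₀) (one_pos.trans_le hp1').ne' fun h => hf₀ ?_)
    rw [← FourierTransform.fourierInv_fourier_eq
      (F := SchwartzMap (EuclideanSpace ℝ (Fin d)) ℂ) f₀, h, FourierTransform.fourierInv_zero]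
  have hinv0 : Filter.Tendsto (fun l : ℝ => l⁻¹) (nhdsWithin 0 (Set.Ioi 0)) Filter.atTop :=
    tendsto_inv_nhdsGT_zero
  have htop : ∀ s : ℝ, s < 0 →
      Filter.Tendsto (fun l : ℝ => l ^ s) Filter.atTop (nhds 0) := fun s hs => by
    simpa using tendsto_rpow_neg_atTop (neg_pos.2 hs)
  have hzero : ∀ s : ℝ, 0 < s →
      Filter.Tendsto (fun l : ℝ => l ^ s) (nhdsWithin 0 (Set.Ioi 0)) (nhds 0) := fun s hs => by
    have h := (Real.continuousAt_rpow_const 0 s (Or.inr hs.le)).tendsto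
    rw [Real.zero_rpow hs.ne'] at h
    exact h.mono_left nhdsWithin_le_nhds
  have hsmall : ∀ (f : SchwartzMap (EuclideanSpace ℝ (Fin d)) ℂ) (κ : ℝ),
      Filter.Tendsto (fun l : ℝ => l ^ (B.1 - A.2)) (nhdsWithin 0 (Set.Ioi 0)) (nhds κ) →
      eLpNorm (⇑f) p volume * eLpNorm (𝓕 (⇑f)) p' volume ≤ ENNReal.ofReal κ *
        (ENNReal.ofReal C * (eLpNorm (fun x => ‖x‖ ^ A.2 * ‖f x‖) p volume *
          eLpNorm (fun ξ => ‖ξ‖ ^ B.1 * ‖𝓕 (⇑f) ξ‖) p' volume)) := fun f κ hκ =>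
    eLpNorm_mul_le_of_tendsto hp1 hp1' hA2.le hB1.le le_rfl
      (add_pos hB1 hB2).le (hscaled f)
      (fun l x hl => rpow_snd_mul_scaledBrokenWeight_le A hl hA1.le x)
      (fun l x hl => rpow_fst_mul_scaledBrokenWeight_le B hl (by linarith) x)
      (nhdsWithin 0 (Set.Ioi 0)) self_mem_nhdsWithin (hzero _ (by linarith))
      ((htop _ (by linarith)).comp hinv0) hκ
  have hlarge : ∀ (f : SchwartzMap (EuclideanSpace ℝ (Fin d)) ℂ) (κ : ℝ),
      Filter.Tendsto (fun l : ℝ => l ^ (B.2 - A.1)) Filter.atTop (nhds κ) →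
      eLpNorm (⇑f) p volume * eLpNorm (𝓕 (⇑f)) p' volume ≤ ENNReal.ofReal κ *
        (ENNReal.ofReal C * (eLpNorm (fun x => ‖x‖ ^ A.1 * ‖f x‖) p volume *
          eLpNorm (fun ξ => ‖ξ‖ ^ B.2 * ‖𝓕 (⇑f) ξ‖) p' volume)) := fun f κ hκ =>
    eLpNorm_mul_le_of_tendsto hp1 hp1' hA1.le hB2.le (add_pos hA1 hA2).le le_rfl (hscaled f)
      (fun l x hl => rpow_fst_mul_scaledBrokenWeight_le A hl (by linarith) x)
      (fun l x hl => rpow_snd_mul_scaledBrokenWeight_le B hl hB1.le x)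
      Filter.atTop (Filter.eventually_gt_atTop 0) (htop _ (by linarith))
      ((hzero _ (by linarith)).comp tendsto_inv_atTop_nhdsGT_zero) hκ
  refine ⟨⟨C, hC, fun l hl f => hscaled f l hl⟩, ⟨?_, ?_⟩, fun h => ⟨C, hC, fun f => ?_⟩,
    fun h => ⟨C, hC, fun f => ?_⟩⟩
  · by_contra! hlt
    exact hne (by simpa using hlarge f₀ 0 (htop _ (by linarith)))
  · by_contra! hlt
    exact hne (by simpa using hsmall f₀ 0 (hzero _ (by linarith)))
  · simpa [brokenWeight] using hsmall f 1 (by simp [h])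
  · simpa [brokenWeight] using hlarge f 1 (by simp [h])
end
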